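/- There exist a₀ ∈ (0,1), λ₀ ≥ 8 and a constant C, depending only on the cutoffs, such that for all 0 < h ≤ 1 and 0 < a ≤ a₀ with λ = a^{3/2}/h ≥ λ₀, every integer N with 1 ≤ |N| ≤ λ^{1/3}, every X ≥ 0, Y ∈ ℝ, and every T with 1/|N| ≤ |T − 4N| and |T| ≤ 2a^{−1/2}: |W_{N,a}(T,X,Y)| ≤ C h^{1/3} h^{−2} / (1 + |N(T−4N)|^{1/4}). -/

import Mathlib

open Real Complex Filter MeasureTheory

/-- `A₊(z) = e^{-iπ/3} Ai(e^{-iπ/3} z)`. -/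
noncomputable def Aplus (Ai : ℂ → ℂ) (z : ℂ) : ℂ :=
  Complex.exp (-(Real.pi / 3 : ℂ) * Complex.I) * Ai (Complex.exp (-(Real.pi / 3 : ℂ) * Complex.I) * z)

/-- `A₋(z) = e^{iπ/3} Ai(e^{iπ/3} z)`. -/
noncomputable def Aminus (Ai : ℂ → ℂ) (z : ℂ) : ℂ :=
  Complex.exp ((Real.pi / 3 : ℂ) * Complex.I) * Ai (Complex.exp ((Real.pi / 3 : ℂ) * Complex.I) * z)

/-- `B(u) = (4/3)u + π/2 − L(u^{2/3})`. -/
noncomputable def Bfun (L : ℝ → ℝ) (u : ℝ) : ℝ :=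
  (4/3) * u + Real.pi / 2 - L (u ^ ((2 : ℝ)/3))

/-- The phase `Ψ_{N,a}(T,X,Y,Υ,S,A,η)` of the tangential reflected waves, with `λ = a^{3/2}/h`. -/
noncomputable def PsiTan (L : ℝ → ℝ) (h a : ℝ) (N : ℤ) (T X Y Υ S A η : ℝ) : ℝ :=
  η * (Y + Υ ^ 3 / 3 + Υ * (X - A) + S ^ 3 / 3 + S * (1 - A)
      + T * Real.sqrt (1 + a) * (A - 1) / (Real.sqrt (1 + a * A) + Real.sqrt (1 + a))
      - (4/3) * (N : ℝ) * A ^ ((3:ℝ)/2))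
    + ((N : ℝ) / (a ^ ((3:ℝ)/2) / h)) * Bfun L (η * (a ^ ((3:ℝ)/2) / h) * A ^ ((3:ℝ)/2))

/-- The `N`-th tangential reflected wave `W_{N,a}(T,X,Y)`; the integration variables are
`S = v.1`, `Υ = v.2.1`, `A = v.2.2.1`, `η = v.2.2.2`. -/
noncomputable def Wtan (L : ℝ → ℝ) (ψ : ℝ → ℝ) (χ₂ : ℝ × ℝ → ℝ) (ψ₃ : ℝ → ℝ)
    (h a : ℝ) (N : ℤ) (T X Y : ℝ) : ℂ :=
  ((a ^ 2 / (2 * Real.pi * h) ^ 3 : ℝ) : ℂ) * ∫ v : ℝ × ℝ × ℝ × ℝ,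
    Complex.exp (Complex.I *
      (((a ^ ((3:ℝ)/2) / h) * PsiTan L h a N T X Y v.2.1 v.1 v.2.2.1 v.2.2.2 : ℝ) : ℂ)) *
    ((v.2.2.2 ^ 2 * ψ v.2.2.2 * χ₂ (v.1, v.2.1) * ψ₃ v.2.2.1 : ℝ) : ℂ)

/-- `G^♯(T,X,Y) = Σ_{|N| ≤ 2a^{−1/2}} W_{N,a}(T,X,Y)`. -/
noncomputable def Gsharp (L : ℝ → ℝ) (ψ : ℝ → ℝ) (χ₂ : ℝ × ℝ → ℝ) (ψ₃ : ℝ → ℝ)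
    (h a : ℝ) (T X Y : ℝ) : ℂ :=
  ∑' N : ℤ, Set.indicator {N : ℤ | |(N : ℝ)| ≤ 2 / Real.sqrt a}
    (fun N => Wtan L ψ χ₂ ψ₃ h a N T X Y) N

/-- The unimodular function `t ↦ e^{it}`. -/
noncomputable def cis (t : ℝ) : ℂ := Complex.exp (Complex.I * (t : ℂ))

theorem norm_cis (t : ℝ) : ‖cis t‖ = 1 := by
  rw [cis, mul_comm, Complex.norm_exp_ofReal_mul_I]

theorem continuous_cis : Continuous cis := by unfold cis; fun_prop

theorem conj_cis (t : ℝ) : (starRingEnd ℂ) (cis t) = cis (-t) := by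
  simp [cis, ← Complex.exp_conj]

theorem cis_add (s t : ℝ) : cis (s + t) = cis s * cis t := by
  simp [cis, mul_add, Complex.exp_add]

theorem hasDerivAt_cis {E : ℝ → ℝ} {e x : ℝ} (h : HasDerivAt E e x) :
    HasDerivAt (fun t => cis (E t)) (Complex.I * (e : ℂ) * cis (E x)) x := by
  have h1 : HasDerivAt (fun t => Complex.I * ((E t : ℝ) : ℂ)) (Complex.I * (e : ℂ)) x :=
    (h.ofReal_comp).const_mul Complex.I
  have := h1.cexp
  unfold cis
  convert this using 1
  ring

/-- Integration by parts against a phase without critical points. -/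
theorem norm_integral_osc_le_of_ne_zero {a b : ℝ} (hab : a ≤ b) {E e1 e2 : ℝ → ℝ} {c c' : ℝ → ℂ}
    (hE : ∀ x ∈ Set.Icc a b, HasDerivAt E (e1 x) x)
    (hE1 : ∀ x ∈ Set.Icc a b, HasDerivAt e1 (e2 x) x)
    (hc : ∀ x ∈ Set.Icc a b, HasDerivAt c (c' x) x)
    (hne : ∀ x ∈ Set.Icc a b, e1 x ≠ 0)
    (he2 : ContinuousOn e2 (Set.Icc a b))
    (hci : IntervalIntegrable c' MeasureTheory.volume a b) :
    ‖∫ x in a..b, c x * cis (E x)‖ ≤ ‖c b‖ / |e1 b| + ‖c a‖ / |e1 a|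
      + ∫ x in a..b, (‖c' x‖ / |e1 x| + ‖c x‖ * |e2 x| / e1 x ^ 2) := by
  have hcE : ContinuousOn E (Set.Icc a b) := fun x hx => (hE x hx).continuousAt.continuousWithinAt
  have hce1 : ContinuousOn e1 (Set.Icc a b) :=
    fun x hx => (hE1 x hx).continuousAt.continuousWithinAt
  have hcc : ContinuousOn c (Set.Icc a b) := fun x hx => (hc x hx).continuousAt.continuousWithinAt
  have hI : Set.uIcc a b = Set.Icc a b := Set.uIcc_of_le hab
  set u : ℝ → ℂ := fun x => c x * ((1 / e1 x : ℝ) : ℂ) / Complex.I with hu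
  set u' : ℝ → ℂ := fun x => (c' x * ((1 / e1 x : ℝ) : ℂ)
    + c x * ((-(e2 x) / e1 x ^ 2 : ℝ) : ℂ)) / Complex.I with hu'
  have hinv : ContinuousOn (fun x => ((1 / e1 x : ℝ) : ℂ)) (Set.Icc a b) :=
    Complex.continuous_ofReal.comp_continuousOn (continuousOn_const.div hce1 hne)
  have hq : ContinuousOn (fun x => ((-(e2 x) / e1 x ^ 2 : ℝ) : ℂ)) (Set.Icc a b) :=
    Complex.continuous_ofReal.comp_continuousOn
      (he2.neg.div (hce1.pow 2) (fun x hx => pow_ne_zero 2 (hne x hx)))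
  have hud : ∀ x ∈ Set.Icc a b, HasDerivAt u (u' x) x := by
    intro x hx
    have h1 : HasDerivAt (fun x => (1 / e1 x : ℝ)) (-(e2 x) / e1 x ^ 2) x := by
      have h2 : HasDerivAt (fun x => (e1 x)⁻¹) (-(e2 x) / e1 x ^ 2) x := (hE1 x hx).inv (hne x hx)
      simpa only [one_div] using h2
    exact ((hc x hx).mul h1.ofReal_comp).div_const _
  have hu'i : IntervalIntegrable u' MeasureTheory.volume a b := by
    apply IntervalIntegrable.div_const
    apply IntervalIntegrable.add
    · exact hci.mul_continuousOn (by rwa [hI])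
    · exact (hcc.mul hq).intervalIntegrable_of_Icc hab
  have hvc : ContinuousOn (fun x => cis (E x)) (Set.Icc a b) := continuous_cis.comp_continuousOn hcE
  have hv'c : ContinuousOn (fun x => Complex.I * (e1 x : ℂ) * cis (E x)) (Set.Icc a b) :=
    (continuousOn_const.mul (Complex.continuous_ofReal.comp_continuousOn hce1)).mul hvc
  have key := intervalIntegral.integral_mul_deriv_eq_deriv_mul (a := a) (b := b)
    (u := u) (v := fun x => cis (E x)) (u' := u') (v' := fun x => Complex.I * (e1 x : ℂ) * cis (E x))
    (fun x hx => hud x (hI ▸ hx)) (fun x hx => hasDerivAt_cis (hE x (hI ▸ hx))) hu'i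
    (hv'c.intervalIntegrable_of_Icc hab)
  have h0 : ∫ x in a..b, c x * cis (E x)
      = ∫ x in a..b, u x * (Complex.I * (e1 x : ℂ) * cis (E x)) := by
    apply intervalIntegral.integral_congr
    intro x hx
    rw [hI] at hx
    have h2 : (e1 x : ℂ) ≠ 0 := by exact_mod_cast hne x hx
    simp only [hu]
    push_cast
    field_simp
  rw [h0, key]
  have hnu : ∀ x, ‖u x * cis (E x)‖ = ‖c x‖ / |e1 x| := by
    intro x
    simp only [hu]
    rw [norm_mul, norm_cis, norm_div, norm_mul, Complex.norm_real, Complex.norm_I]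
    simp [div_eq_mul_inv]
  have hbd : ∀ x, ‖u' x * cis (E x)‖ ≤ ‖c' x‖ / |e1 x| + ‖c x‖ * |e2 x| / e1 x ^ 2 := by
    intro x
    rw [norm_mul, norm_cis, mul_one]
    simp only [hu']
    rw [norm_div, Complex.norm_I, div_one]
    refine (norm_add_le _ _).trans (le_of_eq ?_)
    rw [norm_mul, norm_mul, Complex.norm_real, Complex.norm_real]
    simp [div_eq_mul_inv]
    ring
  have hgi : IntervalIntegrable (fun x => ‖c' x‖ / |e1 x| + ‖c x‖ * |e2 x| / e1 x ^ 2)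
      MeasureTheory.volume a b := by
    apply IntervalIntegrable.add
    · simp only [div_eq_mul_inv]
      apply hci.norm.mul_continuousOn
      rw [hI]
      exact hce1.abs.inv₀ (fun x hx => abs_ne_zero.mpr (hne x hx))
    · exact ((hcc.norm.mul he2.abs).div (hce1.pow 2)
        (fun x hx => pow_ne_zero 2 (hne x hx))).intervalIntegrable_of_Icc hab
  have h3 : ‖∫ x in a..b, u' x * cis (E x)‖
      ≤ ∫ x in a..b, (‖c' x‖ / |e1 x| + ‖c x‖ * |e2 x| / e1 x ^ 2) :=
    intervalIntegral.norm_integral_le_of_norm_le hab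
      (Filter.Eventually.of_forall fun x _ => hbd x) hgi
  calc _ ≤ ‖u b * cis (E b)‖ + ‖u a * cis (E a)‖ + ‖∫ x in a..b, u' x * cis (E x)‖ :=
        (norm_sub_le _ _).trans (add_le_add_left (norm_sub_le _ _) _)
    _ ≤ _ := by rw [hnu, hnu]; gcongr

/-- First derivative test for a convex phase. -/
theorem vdc_first {a b μ : ℝ} (hab : a ≤ b) (hμ : 0 < μ) {E e1 e2 : ℝ → ℝ}
    (hE : ∀ x ∈ Set.Icc a b, HasDerivAt E (e1 x) x)
    (hE1 : ∀ x ∈ Set.Icc a b, HasDerivAt e1 (e2 x) x)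
    (he2 : ContinuousOn e2 (Set.Icc a b)) (h2 : ∀ x ∈ Set.Icc a b, 0 ≤ e2 x)
    (h1 : ∀ x ∈ Set.Icc a b, μ ≤ e1 x) :
    ‖∫ x in a..b, cis (E x)‖ ≤ 3 / μ := by
  have hpos : ∀ x ∈ Set.Icc a b, 0 < e1 x := fun x hx => hμ.trans_le (h1 x hx)
  have hI : Set.uIcc a b = Set.Icc a b := Set.uIcc_of_le hab
  have hce1 : ContinuousOn e1 (Set.Icc a b) :=
    fun x hx => (hE1 x hx).continuousAt.continuousWithinAt
  have key := norm_integral_osc_le_of_ne_zero hab (c := fun _ => 1) (c' := fun _ => 0) hE hE1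
    (fun x _ => hasDerivAt_const x 1) (fun x hx => (hpos x hx).ne') he2 (by simp)
  have h_int : ∫ x in a..b, (e2 x / e1 x ^ 2) = 1 / e1 a - 1 / e1 b := by
    have hd : ∀ x ∈ Set.uIcc a b, HasDerivAt (fun x => -(1 / e1 x)) (e2 x / e1 x ^ 2) x := by
      intro x hx
      rw [hI] at hx
      have h3 : HasDerivAt (fun x => -(e1 x)⁻¹) (-(-(e2 x) / e1 x ^ 2)) x :=
        ((hE1 x hx).inv (hpos x hx).ne').neg
      simp only [one_div]
      exact h3.congr_deriv (by ring)
    rw [intervalIntegral.integral_eq_sub_of_hasDerivAt hd]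
    · ring
    · exact (he2.div (hce1.pow 2) (fun x hx => pow_ne_zero 2 (hpos x hx).ne')).intervalIntegrable_of_Icc
        hab
  have hcong : ∫ x in a..b, (‖(0:ℂ)‖ / |e1 x| + ‖(1:ℂ)‖ * |e2 x| / e1 x ^ 2)
      = ∫ x in a..b, (e2 x / e1 x ^ 2) := by
    apply intervalIntegral.integral_congr
    intro x hx
    rw [hI] at hx
    simp [abs_of_nonneg (h2 x hx)]
  simp only [one_mul] at key
  rw [hcong, h_int] at key
  have ha := h1 a (Set.left_mem_Icc.mpr hab)
  have hb := h1 b (Set.right_mem_Icc.mpr hab)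
  have pa := hpos a (Set.left_mem_Icc.mpr hab)
  have pb := hpos b (Set.right_mem_Icc.mpr hab)
  rw [abs_of_pos pa, abs_of_pos pb, norm_one] at key
  have q1 : 1 / e1 a ≤ 1 / μ := one_div_le_one_div_of_le hμ ha
  have q2 : 0 < 1 / e1 b := by positivity
  have : 3 / μ = 3 * (1 / μ) := by ring
  have q3 : 0 < 1 / μ := by positivity
  rw [this]; linarith

theorem norm_integral_cis_le {a b : ℝ} (hab : a ≤ b) (E : ℝ → ℝ) :
    ‖∫ x in a..b, cis (E x)‖ ≤ b - a := by
  have := intervalIntegral.norm_integral_le_of_norm_le_const (a := a) (b := b) (C := 1)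
    (f := fun x => cis (E x)) (fun x _ => (norm_cis _).le)
  rwa [one_mul, abs_of_nonneg (by linarith)] at this

theorem norm_integral_split {a b t : ℝ} {f : ℝ → ℂ} {B₁ B₂ : ℝ}
    (hat : a ≤ t) (htb : t ≤ b) (hf : ContinuousOn f (Set.Icc a b))
    (h1 : ‖∫ x in a..t, f x‖ ≤ B₁) (h2 : ‖∫ x in t..b, f x‖ ≤ B₂) :
    ‖∫ x in a..b, f x‖ ≤ B₁ + B₂ := by
  have e1 : IntervalIntegrable f MeasureTheory.volume a t :=
    (hf.mono (Set.Icc_subset_Icc le_rfl htb)).intervalIntegrable_of_Icc hat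
  have e2 : IntervalIntegrable f MeasureTheory.volume t b :=
    (hf.mono (Set.Icc_subset_Icc hat le_rfl)).intervalIntegrable_of_Icc htb
  rw [← intervalIntegral.integral_add_adjacent_intervals e1 e2]
  exact (norm_add_le _ _).trans (add_le_add h1 h2)

theorem norm_integral_conj_cis {a b : ℝ} (E : ℝ → ℝ) :
    ‖∫ x in a..b, cis (-E x)‖ = ‖∫ x in a..b, cis (E x)‖ := by
  have : ∫ x in a..b, cis (-E x) = (starRingEnd ℂ) (∫ x in a..b, cis (E x)) := by
    simp only [intervalIntegral, map_sub, ← integral_conj, conj_cis]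
  rw [this, RCLike.norm_conj]

theorem vdc_second_right {a b κ : ℝ} (hab : a ≤ b) (hκ : 0 < κ) {E e1 e2 : ℝ → ℝ}
    (hE : ∀ x ∈ Set.Icc a b, HasDerivAt E (e1 x) x)
    (hE1 : ∀ x ∈ Set.Icc a b, HasDerivAt e1 (e2 x) x)
    (he2 : ContinuousOn e2 (Set.Icc a b)) (h2 : ∀ x ∈ Set.Icc a b, 0 ≤ e2 x)
    (h1 : ∀ x ∈ Set.Icc a b, κ * (x - a) ≤ e1 x) :
    ‖∫ x in a..b, cis (E x)‖ ≤ 4 / √κ := by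
  have hs : 0 < √κ := Real.sqrt_pos.mpr hκ
  have hss : √κ * √κ = κ := Real.mul_self_sqrt hκ.le
  have hcE : ContinuousOn (fun x => cis (E x)) (Set.Icc a b) := continuous_cis.comp_continuousOn
    fun x hx => (hE x hx).continuousAt.continuousWithinAt
  have hδ : 0 < 1 / √κ := by positivity
  rcases le_total b (a + 1 / √κ) with hb | hb
  · refine (norm_integral_cis_le hab E).trans ?_
    have : 4 / √κ = 4 * (1 / √κ) := by ring
    rw [this]; linarith
  · have hsub : Set.Icc (a + 1 / √κ) b ⊆ Set.Icc a b := Set.Icc_subset_Icc (by linarith) le_rfl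
    have k1 := norm_integral_cis_le (show a ≤ a + 1 / √κ by linarith) E
    have k2 := vdc_first (μ := √κ) hb hs (fun x hx => hE x (hsub hx)) (fun x hx => hE1 x (hsub hx))
      (he2.mono hsub) (fun x hx => h2 x (hsub hx)) (fun x hx => by
        refine le_trans ?_ (h1 x (hsub hx))
        have : 1 / √κ ≤ x - a := by linarith [hx.1]
        calc √κ = κ * (1 / √κ) := by rw [eq_comm, mul_one_div, div_eq_iff hs.ne']; exact hss.symm
          _ ≤ _ := by gcongr)
    refine (norm_integral_split (by linarith) hb hcE k1 k2).trans (le_of_eq ?_)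
    ring

theorem integral_reflect {a b : ℝ} (f : ℝ → ℂ) :
    ∫ x in a..b, f x = ∫ x in (-b)..(-a), f (-x) := by
  rw [intervalIntegral.integral_comp_neg]; simp

theorem vdc_second_left {a b κ : ℝ} (hab : a ≤ b) (hκ : 0 < κ) {E e1 e2 : ℝ → ℝ}
    (hE : ∀ x ∈ Set.Icc a b, HasDerivAt E (e1 x) x)
    (hE1 : ∀ x ∈ Set.Icc a b, HasDerivAt e1 (e2 x) x)
    (he2 : ContinuousOn e2 (Set.Icc a b)) (h2 : ∀ x ∈ Set.Icc a b, 0 ≤ e2 x)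
    (h1 : ∀ x ∈ Set.Icc a b, e1 x ≤ -(κ * (b - x))) :
    ‖∫ x in a..b, cis (E x)‖ ≤ 4 / √κ := by
  have hm : ∀ x ∈ Set.Icc (-b) (-a), -x ∈ Set.Icc a b := fun x hx =>
    ⟨by linarith [hx.2], by linarith [hx.1]⟩
  rw [integral_reflect]
  refine vdc_second_right (E := fun x => E (-x)) (e1 := fun x => -e1 (-x)) (e2 := fun x => e2 (-x))
    (by linarith) hκ ?_ ?_ ?_ ?_ ?_
  · intro x hx
    exact ((hE _ (hm x hx)).scomp x (hasDerivAt_neg x)).congr_deriv (by simp)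
  · intro x hx
    exact ((hE1 _ (hm x hx)).scomp x (hasDerivAt_neg x)).neg.congr_deriv (by simp)
  · exact he2.comp continuous_neg.continuousOn hm
  · exact fun x hx => h2 _ (hm x hx)
  · intro x hx
    have := h1 _ (hm x hx)
    linarith

theorem mul_sub_le_sub_of_le_hasDerivAt {a b κ : ℝ} {g g' : ℝ → ℝ}
    (hg : ∀ x ∈ Set.Icc a b, HasDerivAt g (g' x) x) (hκ : ∀ x ∈ Set.Icc a b, κ ≤ g' x) :
    ∀ x ∈ Set.Icc a b, ∀ y ∈ Set.Icc a b, x ≤ y → κ * (y - x) ≤ g y - g x := by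
  have hcg : ContinuousOn g (Set.Icc a b) := fun x hx => (hg x hx).continuousAt.continuousWithinAt
  refine Convex.mul_sub_le_image_sub_of_le_deriv (convex_Icc a b) hcg ?_ ?_
  · intro x hx
    exact (hg x (interior_subset hx)).differentiableAt.differentiableWithinAt
  · intro x hx
    rw [(hg x (interior_subset hx)).deriv]; exact hκ x (interior_subset hx)

/-- A function with derivative at least `κ` vanishes somewhere or keeps its sign. -/
theorem exists_split_point {a b κ : ℝ} (hab : a ≤ b) {g g' : ℝ → ℝ}
    (hg : ∀ x ∈ Set.Icc a b, HasDerivAt g (g' x) x) (hκ : ∀ x ∈ Set.Icc a b, κ ≤ g' x) :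
    ∃ t ∈ Set.Icc a b, (t < b → ∀ x ∈ Set.Icc t b, κ * (x - t) ≤ g x) ∧
      (a < t → ∀ x ∈ Set.Icc a t, g x ≤ -(κ * (t - x))) := by
  have hcg : ContinuousOn g (Set.Icc a b) := fun x hx => (hg x hx).continuousAt.continuousWithinAt
  have hgrow := mul_sub_le_sub_of_le_hasDerivAt hg hκ
  have la := Set.left_mem_Icc.mpr hab
  have lb := Set.right_mem_Icc.mpr hab
  have hz : ∃ t ∈ Set.Icc a b, (t < b → 0 ≤ g t) ∧ (a < t → g t ≤ 0) := by
    rcases le_total 0 (g a) with h | h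
    · exact ⟨a, la, fun _ => h, fun h => absurd h (lt_irrefl _)⟩
    · rcases le_total (g b) 0 with h' | h'
      · exact ⟨b, lb, fun h => absurd h (lt_irrefl _), fun _ => h'⟩
      · obtain ⟨t, ht, ht0⟩ := intermediate_value_Icc hab hcg ⟨h, h'⟩
        exact ⟨t, ht, fun _ => ht0.ge, fun _ => ht0.le⟩
  obtain ⟨t, ht, h1, h2⟩ := hz
  refine ⟨t, ht, fun htb x hx => ?_, fun hat x hx => ?_⟩
  · linarith [h1 htb, hgrow t ht x ⟨ht.1.trans hx.1, hx.2⟩ hx.1]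
  · linarith [h2 hat, hgrow x ⟨hx.1, hx.2.trans ht.2⟩ t ht hx.2]

/-- Splitting at a point where each nondegenerate half is controlled. -/
theorem norm_integral_split_of_lt {a b t V : ℝ} {f : ℝ → ℂ} (hV : 0 ≤ V)
    (ht : t ∈ Set.Icc a b) (hf : ContinuousOn f (Set.Icc a b))
    (h1 : a < t → ‖∫ x in a..t, f x‖ ≤ V) (h2 : t < b → ‖∫ x in t..b, f x‖ ≤ V) :
    ‖∫ x in a..b, f x‖ ≤ V + V := by
  refine norm_integral_split ht.1 ht.2 hf ?_ ?_
  · rcases ht.1.eq_or_lt with h | h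
    · simpa [h] using hV
    · exact h1 h
  · rcases ht.2.eq_or_lt with h | h
    · simpa [h] using hV
    · exact h2 h

/-- Van der Corput's second derivative test. -/
theorem vdc_second {a b κ : ℝ} (hab : a ≤ b) (hκ : 0 < κ) {E e1 e2 : ℝ → ℝ}
    (hE : ∀ x ∈ Set.Icc a b, HasDerivAt E (e1 x) x)
    (hE1 : ∀ x ∈ Set.Icc a b, HasDerivAt e1 (e2 x) x)
    (he2 : ContinuousOn e2 (Set.Icc a b)) (h2 : ∀ x ∈ Set.Icc a b, κ ≤ e2 x) :
    ‖∫ x in a..b, cis (E x)‖ ≤ 8 / √κ := by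
  have hcE : ContinuousOn (fun x => cis (E x)) (Set.Icc a b) := continuous_cis.comp_continuousOn
    fun x hx => (hE x hx).continuousAt.continuousWithinAt
  obtain ⟨t, ht, hr, hl⟩ := exists_split_point hab hE1 h2
  have hsl : Set.Icc a t ⊆ Set.Icc a b := Set.Icc_subset_Icc le_rfl ht.2
  have hsr : Set.Icc t b ⊆ Set.Icc a b := Set.Icc_subset_Icc ht.1 le_rfl
  refine (norm_integral_split_of_lt (V := 4 / √κ) (by positivity) ht hcE (fun h => ?_)
    (fun h => ?_)).trans (le_of_eq (by ring))
  · exact vdc_second_left ht.1 hκ (fun x hx => hE x (hsl hx)) (fun x hx => hE1 x (hsl hx))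
      (he2.mono hsl) (fun x hx => hκ.le.trans (h2 x (hsl hx))) (hl h)
  · exact vdc_second_right ht.2 hκ (fun x hx => hE x (hsr hx)) (fun x hx => hE1 x (hsr hx))
      (he2.mono hsr) (fun x hx => hκ.le.trans (h2 x (hsr hx))) (hr h)

theorem vdc_second_neg {a b κ : ℝ} (hab : a ≤ b) (hκ : 0 < κ) {E e1 e2 : ℝ → ℝ}
    (hE : ∀ x ∈ Set.Icc a b, HasDerivAt E (e1 x) x)
    (hE1 : ∀ x ∈ Set.Icc a b, HasDerivAt e1 (e2 x) x)
    (he2 : ContinuousOn e2 (Set.Icc a b)) (h2 : ∀ x ∈ Set.Icc a b, e2 x ≤ -κ) :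
    ‖∫ x in a..b, cis (E x)‖ ≤ 8 / √κ := by
  rw [← norm_integral_conj_cis]
  exact vdc_second (E := fun x => -E x) (e1 := fun x => -e1 x) (e2 := fun x => -e2 x) hab hκ
    (fun x hx => (hE x hx).neg) (fun x hx => (hE1 x hx).neg) he2.neg
    (fun x hx => by linarith [h2 x hx])

theorem vdc_third_right {a b δ : ℝ} (hab : a ≤ b) (hδ : 0 < δ) {E e1 e2 : ℝ → ℝ}
    (hE : ∀ x ∈ Set.Icc a b, HasDerivAt E (e1 x) x)
    (hE1 : ∀ x ∈ Set.Icc a b, HasDerivAt e1 (e2 x) x)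
    (he2 : ContinuousOn e2 (Set.Icc a b))
    (h2 : ∀ x ∈ Set.Icc a b, δ⁻¹ ^ 3 * (x - a) ≤ e2 x) :
    ‖∫ x in a..b, cis (E x)‖ ≤ 9 * δ := by
  have hcE : ContinuousOn (fun x => cis (E x)) (Set.Icc a b) := continuous_cis.comp_continuousOn
    fun x hx => (hE x hx).continuousAt.continuousWithinAt
  rcases le_total b (a + δ) with hb | hb
  · refine (norm_integral_cis_le hab E).trans ?_
    linarith
  · have hsub : Set.Icc (a + δ) b ⊆ Set.Icc a b := Set.Icc_subset_Icc (by linarith) le_rfl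
    have k1 := norm_integral_cis_le (show a ≤ a + δ by linarith) E
    have k2 := vdc_second (κ := δ⁻¹ ^ 2) hb (by positivity) (fun x hx => hE x (hsub hx))
      (fun x hx => hE1 x (hsub hx)) (he2.mono hsub) (fun x hx => by
        refine le_trans ?_ (h2 x (hsub hx))
        have : δ ≤ x - a := by linarith [hx.1]
        calc δ⁻¹ ^ 2 = δ⁻¹ ^ 3 * δ := by field_simp
          _ ≤ _ := by gcongr)
    rw [Real.sqrt_sq (by positivity), div_inv_eq_mul] at k2
    refine (norm_integral_split (by linarith) hb hcE k1 k2).trans (le_of_eq ?_)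
    ring

theorem vdc_third_left {a b δ : ℝ} (hab : a ≤ b) (hδ : 0 < δ) {E e1 e2 : ℝ → ℝ}
    (hE : ∀ x ∈ Set.Icc a b, HasDerivAt E (e1 x) x)
    (hE1 : ∀ x ∈ Set.Icc a b, HasDerivAt e1 (e2 x) x)
    (he2 : ContinuousOn e2 (Set.Icc a b))
    (h2 : ∀ x ∈ Set.Icc a b, e2 x ≤ -(δ⁻¹ ^ 3 * (b - x))) :
    ‖∫ x in a..b, cis (E x)‖ ≤ 9 * δ := by
  have hm : ∀ x ∈ Set.Icc (-b) (-a), -x ∈ Set.Icc a b := fun x hx =>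
    ⟨by linarith [hx.2], by linarith [hx.1]⟩
  rw [← norm_integral_conj_cis, integral_reflect]
  refine vdc_third_right (E := fun x => -E (-x)) (e1 := fun x => e1 (-x)) (e2 := fun x => -e2 (-x))
    (by linarith) hδ ?_ ?_ ?_ ?_
  · intro x hx
    exact ((hE _ (hm x hx)).scomp x (hasDerivAt_neg x)).neg.congr_deriv (by simp)
  · intro x hx
    exact ((hE1 _ (hm x hx)).scomp x (hasDerivAt_neg x)).congr_deriv (by simp)
  · exact (he2.comp continuous_neg.continuousOn hm).neg
  · intro x hx
    have := h2 _ (hm x hx)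
    linarith

/-- Van der Corput's third derivative test. -/
theorem vdc_third {a b δ : ℝ} (hab : a ≤ b) (hδ : 0 < δ) {E e1 e2 e3 : ℝ → ℝ}
    (hE : ∀ x ∈ Set.Icc a b, HasDerivAt E (e1 x) x)
    (hE1 : ∀ x ∈ Set.Icc a b, HasDerivAt e1 (e2 x) x)
    (hE2 : ∀ x ∈ Set.Icc a b, HasDerivAt e2 (e3 x) x)
    (h3 : ∀ x ∈ Set.Icc a b, δ⁻¹ ^ 3 ≤ e3 x) :
    ‖∫ x in a..b, cis (E x)‖ ≤ 18 * δ := by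
  have hcE : ContinuousOn (fun x => cis (E x)) (Set.Icc a b) := continuous_cis.comp_continuousOn
    fun x hx => (hE x hx).continuousAt.continuousWithinAt
  have he2 : ContinuousOn e2 (Set.Icc a b) := fun x hx => (hE2 x hx).continuousAt.continuousWithinAt
  obtain ⟨t, ht, hr, hl⟩ := exists_split_point hab hE2 h3
  have hsl : Set.Icc a t ⊆ Set.Icc a b := Set.Icc_subset_Icc le_rfl ht.2
  have hsr : Set.Icc t b ⊆ Set.Icc a b := Set.Icc_subset_Icc ht.1 le_rfl
  refine (norm_integral_split_of_lt (V := 9 * δ) (by positivity) ht hcE (fun h => ?_)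
    (fun h => ?_)).trans (le_of_eq (by ring))
  · exact vdc_third_left ht.1 hδ (fun x hx => hE x (hsl hx)) (fun x hx => hE1 x (hsl hx))
      (he2.mono hsl) (hl h)
  · exact vdc_third_right ht.2 hδ (fun x hx => hE x (hsr hx)) (fun x hx => hE1 x (hsr hx))
      (he2.mono hsr) (hr h)

theorem intervalIntegrable_deriv_of_norm_le {a b : ℝ} (hab : a ≤ b) {c c' : ℝ → ℂ} {g : ℝ → ℝ}
    (hc : ∀ x ∈ Set.Icc a b, HasDerivAt c (c' x) x)
    (hg : ∀ x ∈ Set.Icc a b, ‖c' x‖ ≤ g x) (hgi : IntervalIntegrable g MeasureTheory.volume a b) :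
    IntervalIntegrable c' MeasureTheory.volume a b := by
  have hsub : Set.uIoc a b ⊆ Set.Icc a b := by
    rw [Set.uIoc_of_le hab]; exact Set.Ioc_subset_Icc_self
  have h1 : IntervalIntegrable (deriv c) MeasureTheory.volume a b := by
    refine hgi.mono_fun' (stronglyMeasurable_deriv c).aestronglyMeasurable ?_
    refine (MeasureTheory.ae_restrict_mem measurableSet_uIoc).mono fun x hx => ?_
    simp only
    rw [(hc x (hsub hx)).deriv]
    exact hg x (hsub hx)
  exact h1.congr fun x hx => (hc x (hsub hx)).deriv

/-- Inserting an amplitude into an oscillatory integral with uniformly bounded partial integrals. -/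
theorem norm_integral_amplitude_le {a b V : ℝ} (hab : a ≤ b) {f c c' : ℝ → ℂ}
    {g : ℝ → ℝ} (hf : ContinuousOn f (Set.Icc a b))
    (hc : ∀ x ∈ Set.Icc a b, HasDerivAt c (c' x) x)
    (hg : ∀ x ∈ Set.Icc a b, ‖c' x‖ ≤ g x) (hgi : IntervalIntegrable g MeasureTheory.volume a b)
    (hV : ∀ t ∈ Set.Icc a b, ‖∫ x in a..t, f x‖ ≤ V) :
    ‖∫ x in a..b, c x * f x‖ ≤ V * (‖c b‖ + ∫ x in a..b, g x) := by
  have hI : Set.uIcc a b = Set.Icc a b := Set.uIcc_of_le hab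
  have hV0 : 0 ≤ V := (norm_nonneg _).trans (hV a (Set.left_mem_Icc.mpr hab))
  have hci := intervalIntegrable_deriv_of_norm_le hab hc hg hgi
  have hcc : ContinuousOn c (Set.Icc a b) := fun x hx => (hc x hx).continuousAt.continuousWithinAt
  have key := intervalIntegral.integral_mul_deriv_eq_deriv_mul_of_hasDeriv_right (a := a) (b := b)
    (u := c) (u' := c') (v := fun t => ∫ x in a..t, f x) (v' := f) (by rwa [hI])
    (intervalIntegral.continuousOn_primitive_interval (by rw [hI]; exact hf.integrableOn_Icc))
    (fun x hx => by
      rw [min_eq_left hab, max_eq_right hab] at hx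
      exact (hc x (Set.Ioo_subset_Icc_self hx)).hasDerivWithinAt)
    (fun x hx => by
      rw [min_eq_left hab, max_eq_right hab] at hx
      have hn : Set.Icc a b ∈ nhds x := Icc_mem_nhds hx.1 hx.2
      refine (intervalIntegral.integral_hasDerivAt_right
        ((hf.mono (Set.Icc_subset_Icc le_rfl hx.2.le)).intervalIntegrable_of_Icc hx.1.le) ?_
        (hf.continuousAt hn)).hasDerivWithinAt
      exact ⟨Set.Icc a b, hn, hf.aestronglyMeasurable measurableSet_Icc⟩)
    hci (hf.intervalIntegrable_of_Icc hab)
  rw [key, intervalIntegral.integral_same, mul_zero, sub_zero, mul_add, mul_comm V]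
  have hVb := hV b (Set.right_mem_Icc.mpr hab)
  refine (norm_sub_le _ _).trans (add_le_add ?_ ?_)
  · rw [norm_mul]
    gcongr
  · rw [← intervalIntegral.integral_const_mul]
    refine intervalIntegral.norm_integral_le_of_norm_le hab
      (Filter.Eventually.of_forall fun x hx => ?_) (hgi.const_mul V)
    have hx' := Set.Ioc_subset_Icc_self hx
    rw [norm_mul, mul_comm]
    exact mul_le_mul (hV x hx') (hg x hx') (norm_nonneg _) hV0

/-- The Laplace-type integrals `∫₀^∞ t^q e^{-wt-t³/12} dt`. -/
noncomputable def cubicLaplace (q w : ℝ) : ℝ :=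
  ∫ t in Set.Ioi (0:ℝ), t ^ q * Real.exp (-(w * t) - t ^ 3 / 12)

theorem linear_sub_cubic_le {R t : ℝ} (hR : 0 ≤ R) (ht : 0 ≤ t) :
    R * t - t ^ 3 / 12 ≤ 12 * (R + 1) ^ 2 + -t := by
  rcases le_total t (12 * (R + 1)) with h | h
  · nlinarith [pow_nonneg ht 3, mul_le_mul_of_nonneg_left h (by linarith : 0 ≤ R + 1)]
  · nlinarith [mul_le_mul h h (by linarith) ht,
      mul_le_mul_of_nonneg_left (mul_le_mul h h (by linarith) ht) ht,
      mul_nonneg ht (mul_nonneg hR hR), mul_nonneg ht hR]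

theorem integrableOn_rpow_mul_exp_linear {q R : ℝ} (hq : -1 < q) (hR : 0 ≤ R) :
    MeasureTheory.IntegrableOn (fun t : ℝ => t ^ q * Real.exp (R * t - t ^ 3 / 12))
      (Set.Ioi 0) MeasureTheory.volume := by
  have h1 := (Real.GammaIntegral_convergent (s := q + 1) (by linarith)).const_mul
    (Real.exp (12 * (R + 1) ^ 2))
  refine MeasureTheory.Integrable.mono' h1 (by fun_prop) ?_
  refine (MeasureTheory.ae_restrict_mem measurableSet_Ioi).mono fun t ht => ?_
  have ht' : (0:ℝ) < t := ht
  have hp : 0 ≤ t ^ q := Real.rpow_nonneg ht'.le q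
  rw [Real.norm_of_nonneg (by positivity), add_sub_cancel_right, ← mul_assoc, ← Real.exp_add, mul_comm]
  gcongr
  exact linear_sub_cubic_le hR ht'.le

theorem integrableOn_cubicLaplace {q : ℝ} (hq : -1 < q) (w : ℝ) :
    MeasureTheory.IntegrableOn (fun t : ℝ => t ^ q * Real.exp (-(w * t) - t ^ 3 / 12))
      (Set.Ioi 0) MeasureTheory.volume := by
  refine MeasureTheory.Integrable.mono' (integrableOn_rpow_mul_exp_linear hq (abs_nonneg w))
    (by fun_prop) ?_
  refine (MeasureTheory.ae_restrict_mem measurableSet_Ioi).mono fun t ht => ?_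
  have ht' : (0:ℝ) < t := ht
  have hp : 0 ≤ t ^ q := Real.rpow_nonneg ht'.le q
  rw [Real.norm_of_nonneg (by positivity)]
  gcongr
  nlinarith [neg_abs_le w]

theorem hasDerivAt_cubicLaplace {q : ℝ} (hq : -1 < q) (w : ℝ) :
    HasDerivAt (cubicLaplace q) (-cubicLaplace (q + 1) w) w := by
  have key := hasDerivAt_integral_of_dominated_loc_of_deriv_le
    (μ := MeasureTheory.volume.restrict (Set.Ioi (0:ℝ))) (𝕜 := ℝ)
    (F := fun w t => t ^ q * Real.exp (-(w * t) - t ^ 3 / 12))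
    (F' := fun w t => -(t ^ (q + 1) * Real.exp (-(w * t) - t ^ 3 / 12)))
    (bound := fun t => t ^ (q + 1) * Real.exp ((|w| + 1) * t - t ^ 3 / 12))
    (x₀ := w) (Metric.ball_mem_nhds w one_pos)
    (Filter.Eventually.of_forall fun w => by fun_prop) (integrableOn_cubicLaplace hq w)
    (by fun_prop) ?_ (integrableOn_rpow_mul_exp_linear (by linarith) (by positivity)) ?_
  · have h2 := key.2
    rw [MeasureTheory.integral_neg] at h2
    exact h2
  · refine (MeasureTheory.ae_restrict_mem measurableSet_Ioi).mono fun t ht x hx => ?_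
    have ht' : (0:ℝ) < t := ht
    have hp : 0 ≤ t ^ (q + 1) := Real.rpow_nonneg ht'.le _
    rw [norm_neg, Real.norm_of_nonneg (by positivity)]
    gcongr
    have hx2 : |x - w| < 1 := by simpa [Real.dist_eq] using hx
    have := abs_lt.mp hx2
    nlinarith [neg_abs_le w]
  · refine (MeasureTheory.ae_restrict_mem measurableSet_Ioi).mono fun t ht x hx => ?_
    have ht' : (0:ℝ) < t := ht
    have h1 : HasDerivAt (fun x : ℝ => -(x * t) - t ^ 3 / 12) (-(1 * t)) x :=
      (((hasDerivAt_id x).mul_const t).neg).sub_const _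
    refine (h1.exp.const_mul (t ^ q)).congr_deriv ?_
    rw [Real.rpow_add_one ht'.ne']
    ring

theorem cubicLaplace_ode (w : ℝ) :
    cubicLaplace (5/2) w = 2 * cubicLaplace (-1/2) w - 4 * w * cubicLaplace (1/2) w := by
  have hd : ∀ t ∈ Set.Ioi (0:ℝ), HasDerivAt
      (fun t : ℝ => 4 * (t ^ (1/2 : ℝ) * Real.exp (-(w * t) - t ^ 3 / 12)))
      (2 * (t ^ (-1/2 : ℝ) * Real.exp (-(w * t) - t ^ 3 / 12))
        - 4 * w * (t ^ (1/2 : ℝ) * Real.exp (-(w * t) - t ^ 3 / 12))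
        - t ^ (5/2 : ℝ) * Real.exp (-(w * t) - t ^ 3 / 12)) t := by
    intro t ht
    have ht' : (0:ℝ) < t := ht
    have h1 : HasDerivAt (fun t : ℝ => -(w * t) - t ^ 3 / 12) (-(w * 1) - ((3:ℕ) * t ^ 2) / 12) t :=
      (((hasDerivAt_id t).const_mul w).neg).sub ((hasDerivAt_pow 3 t).div_const 12)
    have h2 := Real.hasDerivAt_rpow_const (x := t) (p := 1/2) (Or.inl ht'.ne')
    refine ((h2.mul h1.exp).const_mul 4).congr_deriv ?_
    have e1 : t ^ (1/2 - 1 : ℝ) = t ^ (-1/2 : ℝ) := by norm_num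
    have e2 : t ^ (5/2 : ℝ) = t ^ (1/2 : ℝ) * t ^ 2 := by
      rw [← Real.rpow_natCast t 2, ← Real.rpow_add ht']; norm_num
    rw [e1, e2]
    push_cast
    ring
  have i1 := (integrableOn_cubicLaplace (q := -1/2) (by norm_num) w).const_mul 2
  have i2 := (integrableOn_cubicLaplace (q := 1/2) (by norm_num) w).const_mul (4 * w)
  have i3 := integrableOn_cubicLaplace (q := 5/2) (by norm_num) w
  have i12 : MeasureTheory.IntegrableOn
      (fun t : ℝ => 2 * (t ^ (-1/2 : ℝ) * Real.exp (-(w * t) - t ^ 3 / 12))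
        - 4 * w * (t ^ (1/2 : ℝ) * Real.exp (-(w * t) - t ^ 3 / 12)))
      (Set.Ioi 0) MeasureTheory.volume := i1.sub i2
  have key := MeasureTheory.integral_Ioi_of_hasDerivAt_of_tendsto (a := 0) (m := 0) ?_ hd
    (i12.sub i3) ?_
  · rw [MeasureTheory.integral_sub i12 i3, MeasureTheory.integral_sub i1 i2,
      MeasureTheory.integral_const_mul, MeasureTheory.integral_const_mul] at key
    change 2 * cubicLaplace (-1/2) w - 4 * w * cubicLaplace (1/2) w - cubicLaplace (5/2) w = _ at key
    rw [Real.zero_rpow (by norm_num)] at key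
    linarith
  · refine Continuous.continuousWithinAt ?_
    have : Continuous fun t : ℝ => t ^ (1/2 : ℝ) := Real.continuous_rpow_const (by norm_num)
    fun_prop
  · have h0 := (Real.tendsto_pow_mul_exp_neg_atTop_nhds_zero 1).const_mul
      (4 * Real.exp (12 * (|w| + 1) ^ 2))
    rw [mul_zero] at h0
    refine squeeze_zero' ?_ ?_ h0
    · filter_upwards [Filter.eventually_ge_atTop 1] with t ht
      have : (0:ℝ) ≤ t := by linarith
      positivity
    · filter_upwards [Filter.eventually_ge_atTop 1] with t ht
      have ht0 : (0:ℝ) ≤ t := by linarith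
      have e1 : t ^ (1/2 : ℝ) ≤ t ^ 1 := by
        rw [pow_one]
        exact (Real.rpow_le_rpow_of_exponent_le ht (by norm_num : (1/2:ℝ) ≤ 1)).trans
          (Real.rpow_one t).le
      have e2 : Real.exp (-(w * t) - t ^ 3 / 12)
          ≤ Real.exp (12 * (|w| + 1) ^ 2) * Real.exp (-t) := by
        rw [← Real.exp_add]
        refine Real.exp_le_exp.mpr (le_trans ?_ (linear_sub_cubic_le (abs_nonneg w) ht0))
        nlinarith [neg_abs_le w]
      calc _ ≤ 4 * (t ^ 1 * (Real.exp (12 * (|w| + 1) ^ 2) * Real.exp (-t))) := by gcongr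
        _ = _ := by ring

theorem cubicLaplace_zero {q : ℝ} (hq : -1 < q) :
    cubicLaplace q 0 = (1/12 : ℝ) ^ (-(q + 1) / 3) * (1 / 3) * Real.Gamma ((q + 1) / 3) := by
  rw [← integral_rpow_mul_exp_neg_mul_rpow (by norm_num) hq (by norm_num), cubicLaplace]
  refine MeasureTheory.setIntegral_congr_fun measurableSet_Ioi fun t ht => ?_
  have : t ^ (3:ℝ) = t ^ 3 := by exact_mod_cast Real.rpow_natCast t 3
  simp only [this]
  ring_nf

theorem cubicLaplace_bounds {w : ℝ} (hw : 0 < w) :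
    cubicLaplace (-1/2) w ≤ (1 / w) ^ (1/2 : ℝ) * √Real.pi ∧
    (1 / w) ^ (1/2 : ℝ) * √Real.pi - cubicLaplace (-1/2) w
      ≤ (1 / w) ^ (7/2 : ℝ) * (5/32 * √Real.pi) := by
  have e1 : ∫ t in Set.Ioi (0:ℝ), t ^ (-1/2 : ℝ) * Real.exp (-(w * t)) = (1 / w) ^ (1/2 : ℝ) * √Real.pi := by
    rw [← Real.Gamma_one_half_eq, ← Real.integral_rpow_mul_exp_neg_mul_Ioi (by norm_num) hw]
    norm_num
  have e2 : ∫ t in Set.Ioi (0:ℝ), t ^ (5/2 : ℝ) * Real.exp (-(w * t))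
      = (1 / w) ^ (7/2 : ℝ) * (15/8 * √Real.pi) := by
    have : Real.Gamma (7/2) = 15/8 * √Real.pi := by
      rw [show (7/2:ℝ) = 5/2 + 1 by norm_num, Real.Gamma_add_one (by norm_num),
        show (5/2:ℝ) = 3/2 + 1 by norm_num, Real.Gamma_add_one (by norm_num),
        show (3/2:ℝ) = 1/2 + 1 by norm_num, Real.Gamma_add_one (by norm_num),
        Real.Gamma_one_half_eq]
      ring
    rw [← this, ← Real.integral_rpow_mul_exp_neg_mul_Ioi (by norm_num) hw]
    norm_num
  have hi : ∀ q : ℝ, -1 < q → MeasureTheory.IntegrableOn (fun t : ℝ => t ^ q * Real.exp (-(w * t)))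
      (Set.Ioi 0) MeasureTheory.volume := by
    intro q hq
    simpa [neg_mul] using integrableOn_rpow_mul_exp_neg_mul_rpow (p := 1) hq one_pos hw
  have i0 := integrableOn_cubicLaplace (q := -1/2) (by norm_num) w
  have i1 := hi (-1/2) (by norm_num)
  have i2 := hi (5/2) (by norm_num)
  constructor
  · rw [← e1, cubicLaplace]
    refine MeasureTheory.setIntegral_mono_on i0 i1 measurableSet_Ioi fun t ht => ?_
    have ht' : (0:ℝ) < t := ht
    gcongr
    have := pow_pos ht' 3
    linarith
  · rw [← e1, cubicLaplace, ← MeasureTheory.integral_sub i1 i0]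
    have : (1 / w) ^ (7/2 : ℝ) * (5/32 * √Real.pi)
        = ∫ t in Set.Ioi (0:ℝ), 1/12 * (t ^ (5/2 : ℝ) * Real.exp (-(w * t))) := by
      rw [MeasureTheory.integral_const_mul, e2]; ring
    rw [this]
    refine MeasureTheory.setIntegral_mono_on (i1.sub i0) (i2.const_mul _) measurableSet_Ioi fun t ht => ?_
    have ht' : (0:ℝ) < t := ht
    have h1 : Real.exp (-(w * t) - t ^ 3 / 12) = Real.exp (-(w * t)) * Real.exp (-(t ^ 3 / 12)) := by
      rw [← Real.exp_add]; ring_nf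
    have h2 : 1 - Real.exp (-(t ^ 3 / 12)) ≤ t ^ 3 / 12 := by
      linarith [Real.add_one_le_exp (-(t ^ 3 / 12))]
    have h3 : t ^ (5/2 : ℝ) = t ^ (-1/2 : ℝ) * t ^ 3 := by
      rw [← Real.rpow_natCast t 3, ← Real.rpow_add ht']; norm_num
    simp only [h1, h3]
    calc t ^ (-1/2 : ℝ) * Real.exp (-(w * t))
          - t ^ (-1/2 : ℝ) * (Real.exp (-(w * t)) * Real.exp (-(t ^ 3 / 12)))
        = t ^ (-1/2 : ℝ) * Real.exp (-(w * t)) * (1 - Real.exp (-(t ^ 3 / 12))) := by ring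
      _ ≤ t ^ (-1/2 : ℝ) * Real.exp (-(w * t)) * (t ^ 3 / 12) := by gcongr
      _ = _ := by ring

/-- A rotated Airy function solves `F'' = -w F` on the real line when the rotation `ζ` has `ζ³ = -1`. -/
theorem hasDerivAt_rotated {Ai : ℂ → ℂ} (hd : Differentiable ℂ Ai) (ζ : ℂ) (w : ℝ) :
    HasDerivAt (fun w : ℝ => ζ * Ai (ζ * w)) (ζ ^ 2 * deriv Ai (ζ * w)) w := by
  have h1 : HasDerivAt (fun z : ℂ => Ai (ζ * z)) (deriv Ai (ζ * w) * (ζ * 1)) (w : ℂ) :=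
    HasDerivAt.comp (w : ℂ) (hd (ζ * w)).hasDerivAt ((hasDerivAt_id (w : ℂ)).const_mul ζ)
  refine ((h1.comp_ofReal).const_mul ζ).congr_deriv ?_
  ring

theorem hasDerivAt_rotated_deriv {Ai : ℂ → ℂ} (hd : Differentiable ℂ (deriv Ai))
    (ho : ∀ z : ℂ, deriv (deriv Ai) z = z * Ai z) {ζ : ℂ} (hζ : ζ ^ 3 = -1) (w : ℝ) :
    HasDerivAt (fun w : ℝ => ζ ^ 2 * deriv Ai (ζ * w)) (-(w * (ζ * Ai (ζ * w)))) w := by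
  have h1 : HasDerivAt (fun z : ℂ => deriv Ai (ζ * z)) (deriv (deriv Ai) (ζ * w) * (ζ * 1)) (w : ℂ) :=
    HasDerivAt.comp (w : ℂ) (hd (ζ * w)).hasDerivAt ((hasDerivAt_id (w : ℂ)).const_mul ζ)
  refine ((h1.comp_ofReal).const_mul (ζ ^ 2)).congr_deriv ?_
  rw [ho]
  linear_combination (ζ * w * Ai (ζ * w)) * hζ

/-- Uniqueness for the equation `P''' + 4wP' + 2P = 0` in first-order form. -/
theorem eq_of_product_ode {f g : ℝ → ℂ × ℂ × ℂ}
    (hf : ∀ w, HasDerivAt f ((f w).2.1, (f w).2.2, -(4 * w * (f w).2.1) - 2 * (f w).1) w)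
    (hg : ∀ w, HasDerivAt g ((g w).2.1, (g w).2.2, -(4 * w * (g w).2.1) - 2 * (g w).1) w)
    (h0 : f 0 = g 0) {w : ℝ} (hw : 0 ≤ w) : f w = g w := by
  have hL : ∀ t ∈ Set.Ico (0:ℝ) w, LipschitzOnWith (4 * w + 3).toNNReal
      (fun x : ℂ × ℂ × ℂ => (x.2.1, x.2.2, -(4 * (t:ℂ) * x.2.1) - 2 * x.1)) Set.univ := by
    intro t ht
    refine LipschitzOnWith.of_dist_le_mul fun x _ y _ => ?_
    rw [Real.coe_toNNReal _ (by linarith), dist_eq_norm, dist_eq_norm]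
    have n1 : ‖x.1 - y.1‖ ≤ ‖x - y‖ := norm_fst_le (x - y)
    have n2 : ‖x.2.1 - y.2.1‖ ≤ ‖x - y‖ := (norm_fst_le (x - y).2).trans (norm_snd_le (x - y))
    have n3 : ‖x.2.2 - y.2.2‖ ≤ ‖x - y‖ := (norm_snd_le (x - y).2).trans (norm_snd_le (x - y))
    have n0 := norm_nonneg (x - y)
    have ht0 := ht.1
    have htw := ht.2
    have m1 : ‖x - y‖ ≤ (4 * w + 3) * ‖x - y‖ := by nlinarith
    simp only [Prod.mk_sub_mk]
    rw [Prod.norm_mk, Prod.norm_mk]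
    refine max_le (n2.trans m1) (max_le (n3.trans m1) ?_)
    have : -(4 * (t:ℂ) * x.2.1) - 2 * x.1 - (-(4 * (t:ℂ) * y.2.1) - 2 * y.1)
        = -((4 * t : ℝ) * (x.2.1 - y.2.1)) - (2:ℝ) * (x.1 - y.1) := by push_cast; ring
    rw [this]
    refine (norm_sub_le _ _).trans ?_
    rw [norm_neg, norm_mul, norm_mul, Complex.norm_real, Complex.norm_real,
      Real.norm_of_nonneg (by linarith), Real.norm_of_nonneg (by norm_num)]
    nlinarith [mul_le_mul_of_nonneg_left n2 ht0]
  have key := ODE_solution_unique_of_mem_Icc_right (a := 0) (b := w) (s := fun _ => Set.univ)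
    (v := fun t x => (x.2.1, x.2.2, -(4 * (t:ℂ) * x.2.1) - 2 * x.1)) hL
    (fun t _ => (hf t).continuousAt.continuousWithinAt) (fun t _ => (hf t).hasDerivWithinAt)
    (fun _ _ => trivial)
    (fun t _ => (hg t).continuousAt.continuousWithinAt) (fun t _ => (hg t).hasDerivWithinAt)
    (fun _ _ => trivial) h0
  exact key ⟨hw, le_rfl⟩

/-- Products of solutions of `F'' = -wF` solve the product equation. -/
theorem hasDerivAt_product_triple {F F' G G' : ℝ → ℂ}
    (hF : ∀ w, HasDerivAt F (F' w) w) (hF' : ∀ w, HasDerivAt F' (-(w * F w)) w)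
    (hG : ∀ w, HasDerivAt G (G' w) w) (hG' : ∀ w, HasDerivAt G' (-(w * G w)) w) (w : ℝ) :
    HasDerivAt (fun w : ℝ => (F w * G w, F' w * G w + F w * G' w,
        2 * (F' w * G' w) - 2 * w * (F w * G w)))
      (F' w * G w + F w * G' w, 2 * (F' w * G' w) - 2 * w * (F w * G w),
        -(4 * w * (F' w * G w + F w * G' w)) - 2 * (F w * G w)) w := by
  have h1 := (hF w).mul (hG w)
  have h2 := ((hF' w).mul (hG w)).add ((hF w).mul (hG' w))
  have hw : HasDerivAt (fun w : ℝ => 2 * (w : ℂ)) (2 * 1) w :=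
    ((hasDerivAt_id (w : ℂ)).comp_ofReal).const_mul 2
  have h3 := (((hF' w).mul (hG' w)).const_mul (2:ℂ)).sub (hw.mul h1)
  refine (h1.congr_deriv rfl).prodMk ((h2.congr_deriv ?_).prodMk (h3.congr_deriv ?_))
  · ring
  · simp only [Pi.mul_apply]; ring

theorem hasDerivAt_cubicLaplace_triple (k : ℂ) (w : ℝ) :
    HasDerivAt (fun w : ℝ => (k * (cubicLaplace (-1/2) w : ℂ), -(k * (cubicLaplace (1/2) w : ℂ)),
        k * (cubicLaplace (3/2) w : ℂ)))
      (-(k * (cubicLaplace (1/2) w : ℂ)), k * (cubicLaplace (3/2) w : ℂ),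
        -(4 * w * -(k * (cubicLaplace (1/2) w : ℂ))) - 2 * (k * (cubicLaplace (-1/2) w : ℂ))) w := by
  have h0 := ((hasDerivAt_cubicLaplace (q := -1/2) (by norm_num) w).ofReal_comp).const_mul k
  have h1 := (((hasDerivAt_cubicLaplace (q := 1/2) (by norm_num) w).ofReal_comp).const_mul k).neg
  have h2 := ((hasDerivAt_cubicLaplace (q := 3/2) (by norm_num) w).ofReal_comp).const_mul k
  refine (h0.congr_deriv ?_).prodMk ((h1.congr_deriv ?_).prodMk (h2.congr_deriv ?_))
  · norm_num
  · norm_num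
  · rw [show (3/2 + 1 : ℝ) = 5/2 by norm_num, cubicLaplace_ode]
    push_cast
    ring

theorem one_div_twelve_rpow (x : ℝ) : (1/12 : ℝ) ^ (-x) = 2 ^ (2 * x) * 3 ^ x := by
  rw [Real.rpow_neg (by norm_num), ← Real.inv_rpow (by norm_num), Real.rpow_mul (by norm_num),
    ← Real.mul_rpow (by norm_num) (by norm_num)]
  norm_num

theorem gamma_ratio_first :
    cubicLaplace (1/2) 0 * Real.Gamma (1/3)
      = cubicLaplace (-1/2) 0 * (3 ^ (1/3 : ℝ) * Real.Gamma (2/3)) := by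
  have d := Real.Gamma_mul_Gamma_add_half (1/6)
  rw [cubicLaplace_zero (by norm_num), cubicLaplace_zero (by norm_num),
    show (-(1/2 + 1) / 3 : ℝ) = -(1/2) by norm_num, show (-(-1/2 + 1) / 3 : ℝ) = -(1/6) by norm_num,
    one_div_twelve_rpow, one_div_twelve_rpow, show ((1/2 + 1) / 3 : ℝ) = 1/2 by norm_num,
    Real.Gamma_one_half_eq, show ((-1/2 + 1) / 3 : ℝ) = 1/6 by norm_num]
  rw [show (1/6 + 1/2 : ℝ) = 2/3 by norm_num, show (2 * (1/6) : ℝ) = 1/3 by norm_num,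
    show (1 - 1/3 : ℝ) = 2/3 by norm_num] at d
  have a2 : (2:ℝ) ^ (2 * (1/2) : ℝ) = 2 ^ (2 * (1/6) : ℝ) * 2 ^ (2/3 : ℝ) := by
    rw [← Real.rpow_add (by norm_num)]; norm_num
  have a3 : (3:ℝ) ^ (1/2 : ℝ) = 3 ^ (1/6 : ℝ) * 3 ^ (1/3 : ℝ) := by
    rw [← Real.rpow_add (by norm_num)]; norm_num
  rw [a2, a3]
  linear_combination -(2 ^ (2 * (1/6) : ℝ) * 3 ^ (1/6 : ℝ) * 3 ^ (1/3 : ℝ) / 3) * d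

theorem gamma_ratio_second :
    cubicLaplace (3/2) 0 * Real.Gamma (1/3) ^ 2
      = 2 * cubicLaplace (-1/2) 0 * (3 ^ (1/3 : ℝ) * Real.Gamma (2/3)) ^ 2 := by
  have d := Real.Gamma_mul_Gamma_add_half (1/6)
  have d' := Real.Gamma_mul_Gamma_add_half (1/3)
  rw [cubicLaplace_zero (by norm_num), cubicLaplace_zero (by norm_num),
    show (-(3/2 + 1) / 3 : ℝ) = -(5/6) by norm_num, show (-(-1/2 + 1) / 3 : ℝ) = -(1/6) by norm_num,
    one_div_twelve_rpow, one_div_twelve_rpow, show ((3/2 + 1) / 3 : ℝ) = 5/6 by norm_num,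
    show ((-1/2 + 1) / 3 : ℝ) = 1/6 by norm_num]
  rw [show (1/6 + 1/2 : ℝ) = 2/3 by norm_num, show (2 * (1/6) : ℝ) = 1/3 by norm_num,
    show (1 - 1/3 : ℝ) = 2/3 by norm_num] at d
  rw [show (1/3 + 1/2 : ℝ) = 5/6 by norm_num, show (2 * (1/3) : ℝ) = 2/3 by norm_num,
    show (1 - 2/3 : ℝ) = 1/3 by norm_num] at d'
  have a2 : (2:ℝ) ^ (2 * (5/6) : ℝ) * 2 ^ (1/3 : ℝ) = 2 * 2 ^ (2 * (1/6) : ℝ) * 2 ^ (2/3 : ℝ) := by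
    rw [← Real.rpow_add (by norm_num), mul_assoc, ← Real.rpow_add (by norm_num),
      ← Real.rpow_one_add' (by norm_num) (by norm_num)]
    norm_num
  have a3 : (3:ℝ) ^ (5/6 : ℝ) = 3 ^ (1/6 : ℝ) * (3 ^ (1/3 : ℝ)) ^ 2 := by
    rw [← Real.rpow_natCast (3 ^ (1/3 : ℝ)), ← Real.rpow_mul (by norm_num),
      ← Real.rpow_add (by norm_num)]
    norm_num
  rw [a3]
  linear_combination (2 ^ (2 * (5/6) : ℝ) * 3 ^ (1/6 : ℝ) * (3 ^ (1/3 : ℝ)) ^ 2 / 3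
      * Real.Gamma (1/3)) * d'
    - (2 * 2 ^ (2 * (1/6) : ℝ) * 3 ^ (1/6 : ℝ) * (3 ^ (1/3 : ℝ)) ^ 2 / 3 * Real.Gamma (2/3)) * d
    + (3 ^ (1/6 : ℝ) * (3 ^ (1/3 : ℝ)) ^ 2 / 3 * √Real.pi * Real.Gamma (1/3) * Real.Gamma (2/3)) * a2

/-- The phase function of a unimodular quotient inherits differentiability by continuity. -/
theorem hasDerivAt_of_exp_eq {L : ℝ → ℝ} (hL : Continuous L) {R : ℝ → ℂ} {R' : ℂ} {w : ℝ}
    (hR : ∀ w, Complex.exp (-(L w : ℂ) * Complex.I) = R w) (hd : HasDerivAt R R' w) :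
    HasDerivAt L (Complex.I * (R' / R w)).re w := by
  have hne : R w ≠ 0 := by rw [← hR]; exact Complex.exp_ne_zero _
  have h1 : HasDerivAt (fun x => Complex.log (R x / R w)) (R' / R w) w := by
    have h2 := (hd.div_const (R w)).clog_real (by
      rw [div_self hne]; exact Complex.one_mem_slitPlane)
    rw [div_self hne, div_one] at h2
    exact h2
  have h3 : HasDerivAt (fun x => L w + (Complex.I * Complex.log (R x / R w)).re)
      (Complex.I * (R' / R w)).re w :=
    (Complex.reCLM.hasFDerivAt.comp_hasDerivAt w (h1.const_mul Complex.I)).const_add (L w)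
  refine h3.congr_of_eventuallyEq ?_
  have hc : ∀ᶠ x in nhds w, |L x - L w| < Real.pi := by
    have := hL.continuousAt.eventually (Metric.ball_mem_nhds (L w) Real.pi_pos)
    simpa [Real.dist_eq] using this
  filter_upwards [hc] with x hx
  have e1 : R x / R w = Complex.exp (-((L x - L w : ℝ) : ℂ) * Complex.I) := by
    rw [← hR, ← hR, ← Complex.exp_sub]
    push_cast
    ring_nf
  have hx2 := abs_lt.mp hx
  have him : (-((L x - L w : ℝ) : ℂ) * Complex.I).im = -(L x - L w) := by simp
  rw [e1, Complex.log_exp (by rw [him]; linarith) (by rw [him]; linarith)]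
  simp

theorem cubicLaplace_neg_half_zero_pos : 0 < cubicLaplace (-1/2) 0 := by
  rw [cubicLaplace_zero (by norm_num)]
  have : 0 < Real.Gamma ((-1/2 + 1) / 3) := Real.Gamma_pos_of_pos (by norm_num)
  positivity

theorem hasDerivAt_phase_of_airy {Ai : ℂ → ℂ}
    (hd : Differentiable ℂ Ai) (hd' : Differentiable ℂ (deriv Ai))
    (ho : ∀ z : ℂ, deriv (deriv Ai) z = z * Ai z)
    (hz : Ai 0 = (3 : ℂ) ^ (-(2 : ℂ)/3) / Complex.Gamma (2/3))
    (hz' : deriv Ai 0 = -((3 : ℂ) ^ (-(1 : ℂ)/3)) / Complex.Gamma (1/3))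
    {L : ℝ → ℝ} (hL : Continuous L) (hAp : ∀ w : ℝ, Aplus Ai w ≠ 0)
    (hLc : ∀ w : ℝ, Complex.exp (-(L w : ℂ) * Complex.I) = -(Aminus Ai w) / (Aplus Ai w))
    {w : ℝ} (hw : 0 ≤ w) :
    HasDerivAt L (2 * √Real.pi / cubicLaplace (-1/2) w) w := by
  set ζ : ℂ := Complex.exp (-(Real.pi / 3 : ℂ) * Complex.I) with hζ
  set ξ : ℂ := Complex.exp ((Real.pi / 3 : ℂ) * Complex.I) with hξ
  have h1 : ζ * ξ = 1 := by rw [hζ, hξ, ← Complex.exp_add]; simp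
  have hξ3 : ξ ^ 3 = -1 := by
    rw [hξ, ← Complex.exp_nat_mul, ← Complex.exp_pi_mul_I]
    congr 1
    push_cast
    ring
  have hζ3 : ζ ^ 3 = -1 := by
    have : ζ ^ 3 * ξ ^ 3 = 1 := by rw [← mul_pow, h1, one_pow]
    rw [hξ3] at this
    linear_combination -this
  have hξv : ξ = 1/2 + (√3 / 2 : ℝ) * Complex.I := by
    rw [hξ, Complex.exp_mul_I]
    have : (Real.pi / 3 : ℂ) = ((Real.pi / 3 : ℝ) : ℂ) := by push_cast; ring
    rw [this, ← Complex.ofReal_cos, ← Complex.ofReal_sin, Real.cos_pi_div_three, Real.sin_pi_div_three]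
    push_cast
    ring
  have hζv : ζ = 1/2 - (√3 / 2 : ℝ) * Complex.I := by
    have : (-(Real.pi / 3 : ℂ)) = ((-(Real.pi / 3) : ℝ) : ℂ) := by push_cast; ring
    rw [hζ, this, Complex.exp_mul_I, ← Complex.ofReal_cos, ← Complex.ofReal_sin, Real.cos_neg,
      Real.sin_neg, Real.cos_pi_div_three, Real.sin_pi_div_three]
    push_cast
    ring
  have hsum : ζ + ξ = 1 := by rw [hζv, hξv]; ring
  set F : ℝ → ℂ := fun w => ζ * Ai (ζ * w) with hF
  set F' : ℝ → ℂ := fun w => ζ ^ 2 * deriv Ai (ζ * w) with hF'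
  set G : ℝ → ℂ := fun w => ξ * Ai (ξ * w) with hG
  set G' : ℝ → ℂ := fun w => ξ ^ 2 * deriv Ai (ξ * w) with hG'
  have dF : ∀ w, HasDerivAt F (F' w) w := hasDerivAt_rotated hd ζ
  have dF' : ∀ w, HasDerivAt F' (-(w * F w)) w := hasDerivAt_rotated_deriv hd' ho hζ3
  have dG : ∀ w, HasDerivAt G (G' w) w := hasDerivAt_rotated hd ξ
  have dG' : ∀ w, HasDerivAt G' (-(w * G w)) w := hasDerivAt_rotated_deriv hd' ho hξ3
  have hFne : ∀ w, F w ≠ 0 := hAp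
  have hLR : ∀ w : ℝ, Complex.exp (-(L w : ℂ) * Complex.I) = -(G w) / F w := hLc
  have hGne : ∀ w, G w ≠ 0 := by
    intro x h0
    have := hLR x
    rw [h0, neg_zero, zero_div] at this
    exact Complex.exp_ne_zero _ this
  -- the Wronskian is constant
  have hW : ∀ w, G' w * F w - F' w * G w = (ζ - ξ) * -(Ai 0 * deriv Ai 0) := by
    have hc : ∀ x, HasDerivAt (fun w => G' w * F w - F' w * G w) 0 x := fun x =>
      (((dG' x).mul (dF x)).sub ((dF' x).mul (dG x))).congr_deriv (by ring)
    intro x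
    rw [is_const_of_deriv_eq_zero (fun x => (hc x).differentiableAt) (fun x => (hc x).deriv) x 0]
    simp only [hF, hF', hG, hG', Complex.ofReal_zero, mul_zero]
    linear_combination (Ai 0 * deriv Ai 0 * (ξ - ζ)) * h1
  have g1 : Real.Gamma (1/3) ≠ 0 := (Real.Gamma_pos_of_pos (by norm_num)).ne'
  have g2 : Real.Gamma (2/3) ≠ 0 := (Real.Gamma_pos_of_pos (by norm_num)).ne'
  have hJ0 := cubicLaplace_neg_half_zero_pos
  have hz0 : Ai 0 ≠ 0 := by
    have := hFne 0
    simp only [hF, Complex.ofReal_zero, mul_zero] at this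
    exact right_ne_zero_of_mul this
  set ρ : ℝ := 3 ^ (1/3 : ℝ) * Real.Gamma (2/3) / Real.Gamma (1/3) with hρ
  have hratio : deriv Ai 0 = -(ρ : ℂ) * Ai 0 := by
    have c1 : Complex.Gamma (1/3) = (Real.Gamma (1/3) : ℂ) := by
      rw [← Complex.Gamma_ofReal]; norm_num
    have c2 : Complex.Gamma (2/3) = (Real.Gamma (2/3) : ℂ) := by
      rw [← Complex.Gamma_ofReal]; norm_num
    have c3 : (3:ℂ) ^ (-(1:ℂ)/3) = ((3 ^ (1/3 : ℝ) : ℝ) : ℂ) * (3:ℂ) ^ (-(2:ℂ)/3) := by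
      rw [Complex.ofReal_cpow (by norm_num)]
      push_cast
      rw [← Complex.cpow_add _ _ (by norm_num)]
      norm_num
    have g1' : (Real.Gamma (1/3) : ℂ) ≠ 0 := by exact_mod_cast g1
    have g2' : (Real.Gamma (2/3) : ℂ) ≠ 0 := by exact_mod_cast g2
    rw [hz, hz', c1, c2, c3, hρ]
    push_cast
    field_simp
  have r1 : cubicLaplace (1/2) 0 = cubicLaplace (-1/2) 0 * ρ := by
    rw [hρ, mul_div_assoc', eq_div_iff g1]
    exact gamma_ratio_first
  have r2 : cubicLaplace (3/2) 0 = 2 * cubicLaplace (-1/2) 0 * ρ ^ 2 := by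
    rw [hρ, div_pow, mul_div_assoc', eq_div_iff (pow_ne_zero 2 g1)]
    exact gamma_ratio_second
  have hJ0c : (cubicLaplace (-1/2) 0 : ℂ) ≠ 0 := by exact_mod_cast hJ0.ne'
  have hk : Ai 0 ^ 2 / (cubicLaplace (-1/2) 0 : ℂ) * (cubicLaplace (-1/2) 0 : ℂ) = Ai 0 ^ 2 :=
    div_mul_cancel₀ _ hJ0c
  have hP := congrArg Prod.fst (eq_of_product_ode (hasDerivAt_product_triple dF dF' dG dG')
    (hasDerivAt_cubicLaplace_triple (Ai 0 ^ 2 / (cubicLaplace (-1/2) 0 : ℂ))) (by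
      simp only [hF, hF', hG, hG', Complex.ofReal_zero, mul_zero, zero_mul, sub_zero, Prod.mk.injEq]
      rw [r1, r2, hratio]
      push_cast
      refine ⟨?_, ?_, ?_⟩
      · rw [div_mul_cancel₀ _ hJ0c]
        linear_combination (Ai 0 ^ 2) * h1
      · linear_combination (-(ρ : ℂ) * Ai 0 ^ 2 * (ζ + ξ)) * h1 - (ρ : ℂ) * Ai 0 ^ 2 * hsum + ρ * hk
      · linear_combination (2 * (ρ : ℂ) ^ 2 * Ai 0 ^ 2 * (ζ * ξ + 1)) * h1 - 2 * ρ ^ 2 * hk) hw)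
  simp only at hP
  have hJw : (cubicLaplace (-1/2) w : ℂ) ≠ 0 := by
    intro h0
    rw [h0, mul_zero] at hP
    exact mul_ne_zero (hFne w) (hGne w) hP
  have key := hasDerivAt_of_exp_eq hL hLR (((dG w).neg).div (dF w) (hFne w))
  refine key.congr_deriv ?_
  have hval : Complex.I * ((-G' w * F w - -G w * F' w) / F w ^ 2 / (-(G w) / F w))
      = ((2 * √Real.pi / cubicLaplace (-1/2) w : ℝ) : ℂ) := by
    have e1 : Complex.I * ((-G' w * F w - -G w * F' w) / F w ^ 2 / (-(G w) / F w))
        = Complex.I * (G' w * F w - F' w * G w) / (F w * G w) := by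
      have := hFne w
      have := hGne w
      field_simp
      ring
    have e2 : ζ - ξ = -((√3 : ℝ) : ℂ) * Complex.I := by rw [hζv, hξv]; push_cast; ring
    have e3 : 2 * √Real.pi = √3 * cubicLaplace (1/2) 0 := by
      rw [cubicLaplace_zero (by norm_num), show ((1/2 + 1) / 3 : ℝ) = 1/2 by norm_num,
        Real.Gamma_one_half_eq, show (-(1/2 + 1) / 3 : ℝ) = -(1/2) by norm_num,
        one_div_twelve_rpow, ← Real.sqrt_eq_rpow]
      have : √3 * √3 = (3:ℝ) := Real.mul_self_sqrt (by norm_num)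
      norm_num
      linear_combination -(2/3 * √Real.pi) * this
    rw [e1, hW, hP, e2, hratio, e3, r1]
    push_cast
    rw [div_eq_div_iff (mul_ne_zero (div_ne_zero (pow_ne_zero 2 hz0) hJ0c) hJw) hJw]
    linear_combination (-(√3 : ℝ) * ρ * Ai 0 ^ 2 * (cubicLaplace (-1/2) w : ℂ)) * Complex.I_sq
      - ((√3 : ℝ) * ρ * (cubicLaplace (-1/2) w : ℂ)) * hk
  simp only [Pi.neg_apply] at *
  rw [hval, Complex.ofReal_re]

/-- The derivative of `B` decays quadratically. -/
theorem exists_hasDerivAt_Bfun {Ai : ℂ → ℂ}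
    (hd : Differentiable ℂ Ai) (hd' : Differentiable ℂ (deriv Ai))
    (ho : ∀ z : ℂ, deriv (deriv Ai) z = z * Ai z)
    (hz : Ai 0 = (3 : ℂ) ^ (-(2 : ℂ)/3) / Complex.Gamma (2/3))
    (hz' : deriv Ai 0 = -((3 : ℂ) ^ (-(1 : ℂ)/3)) / Complex.Gamma (1/3))
    {L : ℝ → ℝ} (hL : Continuous L) (hAp : ∀ w : ℝ, Aplus Ai w ≠ 0)
    (hLc : ∀ w : ℝ, Complex.exp (-(L w : ℂ) * Complex.I) = -(Aminus Ai w) / (Aplus Ai w)) :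
    ∃ b : ℝ → ℝ, ∀ u, 1 ≤ u → HasDerivAt (Bfun L) (b u) u ∧ |b u| ≤ 1 / u ^ 2 := by
  refine ⟨fun u => 4/3 - 2 * √Real.pi / cubicLaplace (-1/2) (u ^ (2/3 : ℝ)) * (2/3 * u ^ (2/3 - 1 : ℝ)),
    fun u hu => ⟨?_, ?_⟩⟩
  · have hu0 : 0 < u := by linarith
    have h1 := hasDerivAt_phase_of_airy hd hd' ho hz hz' hL hAp hLc
      (Real.rpow_nonneg hu0.le (2/3 : ℝ))
    have h2 := Real.hasDerivAt_rpow_const (x := u) (p := 2/3) (Or.inl hu0.ne')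
    have h3 := ((((hasDerivAt_id u).const_mul (4/3)).add_const (Real.pi / 2)).sub
      (HasDerivAt.comp u h1 h2))
    exact h3.congr_deriv (by ring)
  · have hu0 : 0 < u := by linarith
    set w : ℝ := u ^ (2/3 : ℝ) with hw
    have hw1 : 1 ≤ w := Real.one_le_rpow hu (by norm_num)
    have hw0 : 0 < w := by linarith
    obtain ⟨b1, b2⟩ := cubicLaplace_bounds hw0
    set s : ℝ := (1 / w) ^ (1/2 : ℝ) with hs
    have hs0 : 0 < s := Real.rpow_pos_of_pos (by positivity) _
    have hs1 : s ≤ 1 := Real.rpow_le_one (by positivity) ((div_le_one hw0).mpr hw1) (by norm_num)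
    have e7 : (1 / w) ^ (7/2 : ℝ) = s * s ^ 6 := by
      rw [hs, ← Real.rpow_natCast, ← Real.rpow_mul (by positivity), ← Real.rpow_add (by positivity)]
      norm_num
    have eu : u ^ (2/3 - 1 : ℝ) = s := by
      rw [hs, hw, one_div, ← Real.rpow_neg hu0.le, ← Real.rpow_mul hu0.le]; norm_num
    have e6 : s ^ 6 = 1 / u ^ 2 := by
      rw [← eu, ← Real.rpow_natCast, ← Real.rpow_mul hu0.le, one_div, ← Real.rpow_natCast u,
        ← Real.rpow_neg hu0.le]
      norm_num
    simp only
    rw [eu, ← e6]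
    rw [e7] at b2
    set J := cubicLaplace (-1/2) w with hJ
    have hpi : 0 < √Real.pi := Real.sqrt_pos.mpr Real.pi_pos
    have h61 : s ^ 6 ≤ 1 := pow_le_one₀ hs0.le hs1
    have hsp : 0 < s * √Real.pi := by positivity
    have hJl : s * √Real.pi / 2 ≤ J := by nlinarith [mul_le_mul_of_nonneg_left h61 hsp.le]
    have hJp : 0 < J := by linarith
    have e8 : 4/3 - 2 * √Real.pi / J * (2/3 * s) = -(4/3 * (s * √Real.pi - J) / J) := by
      field_simp; ring
    have hnn : 0 ≤ 4/3 * (s * √Real.pi - J) / J := by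
      apply div_nonneg _ hJp.le; linarith
    rw [e8, abs_neg, abs_of_nonneg hnn, div_le_iff₀ hJp]
    nlinarith [mul_le_mul_of_nonneg_left hJl (by positivity : 0 ≤ s ^ 6), pow_pos hs0 6]

/-- Differentiation under an interval integral with jointly continuous derivative. -/
theorem hasDerivAt_intervalIntegral_of_continuousOn {a b p₀ ε : ℝ} (hab : a ≤ b) (hε : 0 < ε)
    {F F' : ℝ → ℝ → ℂ}
    (hF : ∀ p ∈ Set.Icc (p₀ - ε) (p₀ + ε), ContinuousOn (F p) (Set.Icc a b))
    (hF' : ContinuousOn (fun z : ℝ × ℝ => F' z.1 z.2) (Set.Icc (p₀ - ε) (p₀ + ε) ×ˢ Set.Icc a b))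
    (hd : ∀ p ∈ Set.Icc (p₀ - ε) (p₀ + ε), ∀ x ∈ Set.Icc a b, HasDerivAt (fun p => F p x) (F' p x) p) :
    HasDerivAt (fun p => ∫ x in a..b, F p x) (∫ x in a..b, F' p₀ x) p₀ := by
  have hp₀ : p₀ ∈ Set.Icc (p₀ - ε) (p₀ + ε) := ⟨by linarith, by linarith⟩
  have hu : Set.uIoc a b ⊆ Set.Icc a b := by
    rw [Set.uIoc_of_le hab]; exact Set.Ioc_subset_Icc_self
  obtain ⟨K, hK⟩ := (isCompact_Icc.prod isCompact_Icc).exists_bound_of_continuousOn hF'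
  have hF'p : ContinuousOn (F' p₀) (Set.Icc a b) :=
    hF'.comp (f := fun x => (p₀, x)) (by fun_prop) (fun x hx => ⟨hp₀, hx⟩)
  refine (intervalIntegral.hasDerivAt_integral_of_dominated_loc_of_deriv_le
    (s := Set.Icc (p₀ - ε) (p₀ + ε)) (bound := fun _ => K)
    (Icc_mem_nhds (by linarith) (by linarith)) ?_ ?_ ?_ ?_ ?_ ?_).2
  · filter_upwards [Icc_mem_nhds (show p₀ - ε < p₀ by linarith) (show p₀ < p₀ + ε by linarith)] with p hp
    exact ((hF p hp).mono hu).aestronglyMeasurable measurableSet_uIoc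
  · exact (hF p₀ hp₀).intervalIntegrable_of_Icc hab
  · exact (hF'p.mono hu).aestronglyMeasurable measurableSet_uIoc
  · exact Filter.Eventually.of_forall fun x hx p hp => hK (p, x) ⟨hp, hu hx⟩
  · simp
  · exact Filter.Eventually.of_forall fun x hx p hp => hd p hp x (hu hx)

/-- Smooth compactly supported amplitudes on the plane living in the strip `|S| < 3`. -/
structure StripBump (g : ℝ × ℝ → ℝ) : Prop where
  contDiff : ContDiff ℝ (⊤ : ℕ∞) g
  compact : HasCompactSupport g
  strip : tsupport g ⊆ {p : ℝ × ℝ | |p.1| < 3}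

namespace StripBump

variable {g : ℝ × ℝ → ℝ}

theorem fderiv_apply (hg : StripBump g) (v : ℝ × ℝ) : StripBump (fun x => fderiv ℝ g x v) where
  contDiff := (hg.contDiff.fderiv_right (m := (⊤ : ℕ∞)) (by norm_cast)).clm_apply contDiff_const
  compact := hg.compact.fderiv_apply (𝕜 := ℝ) v
  strip := (tsupport_fderiv_apply_subset ℝ v).trans hg.strip

theorem snd_mul (hg : StripBump g) : StripBump (fun x => x.2 * g x) where
  contDiff := contDiff_snd.mul hg.contDiff
  compact := hg.compact.mul_left
  strip := tsupport_mul_subset_right.trans hg.strip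

theorem exists_bound (hg : StripBump g) : ∃ C, 0 ≤ C ∧ ∀ x, |g x| ≤ C := by
  obtain ⟨C, hC⟩ := hg.compact.exists_bound_of_continuous hg.contDiff.continuous
  exact ⟨C, (abs_nonneg _).trans (hC 0), hC⟩

theorem eq_zero (hg : StripBump g) {S Υ : ℝ} (hS : 3 ≤ |S|) : g (S, Υ) = 0 := by
  by_contra h
  have := hg.strip (subset_tsupport g h)
  exact absurd hS (not_le.mpr this)

theorem hasDerivAt_line (hg : StripBump g) (p S : ℝ) :
    HasDerivAt (fun S => g (S, p - S)) (fderiv ℝ g (S, p - S) (1, -1)) S := by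
  have h1 : HasDerivAt (fun S : ℝ => (S, p - S)) ((1 : ℝ), (-1 : ℝ)) S :=
    (hasDerivAt_id S).prodMk (((hasDerivAt_id S).const_sub p))
  have h2 := (hg.contDiff.differentiable (by simp) (S, p - S)).hasFDerivAt
  exact h2.comp_hasDerivAt S h1

theorem hasDerivAt_shift (hg : StripBump g) (p S : ℝ) :
    HasDerivAt (fun p => g (S, p - S)) (fderiv ℝ g (S, p - S) (0, 1)) p := by
  have h1 : HasDerivAt (fun p : ℝ => (S, p - S)) ((0 : ℝ), (1 : ℝ)) p :=
    (hasDerivAt_const p S).prodMk ((hasDerivAt_id p).sub_const S)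
  have h2 := (hg.contDiff.differentiable (by simp) (S, p - S)).hasFDerivAt
  exact h2.comp_hasDerivAt p h1

end StripBump

/-- The critical point in `S` after the change of variable `p = S + Υ`. -/
noncomputable def critS (y p : ℝ) : ℝ := (p - y / p) / 2

/-- The reduced oscillatory integral in `S`. -/
noncomputable def redM (g : ℝ × ℝ → ℝ) (Λ y p : ℝ) : ℂ :=
  ∫ S in (-3:ℝ)..3, (g (S, p - S) : ℂ) * cis (Λ * (p * (S - critS y p) ^ 2))

theorem hasDerivAt_quad (Λ p s S : ℝ) :
    HasDerivAt (fun S => Λ * (p * (S - s) ^ 2)) (2 * Λ * p * (S - s)) S := by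
  have := ((((hasDerivAt_id S).sub_const s).pow 2).const_mul p).const_mul Λ
  exact this.congr_deriv (by simp; ring)

theorem continuous_quad_cis (Λ p s : ℝ) : Continuous fun S => cis (Λ * (p * (S - s) ^ 2)) :=
  continuous_cis.comp (by fun_prop)

theorem norm_redM_le {g : ℝ × ℝ → ℝ} (hg : StripBump g) :
    ∃ C, 0 ≤ C ∧ ∀ Λ y p : ℝ, 0 < Λ → 0 < p → ‖redM g Λ y p‖ ≤ C / √(Λ * p) := by
  obtain ⟨C, hC0, hC⟩ := (hg.fderiv_apply (1, -1)).exists_bound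
  refine ⟨8 * (6 * C), by positivity, fun Λ y p hΛ hp => ?_⟩
  have hΛp : 0 < Λ * p := mul_pos hΛ hp
  have key := norm_integral_amplitude_le (a := -3) (b := 3) (V := 8 / √(Λ * p)) (by norm_num)
    (f := fun S => cis (Λ * (p * (S - critS y p) ^ 2)))
    (c := fun S => (g (S, p - S) : ℂ)) (g := fun _ => C)
    (continuous_quad_cis _ _ _).continuousOn
    (fun S _ => (hg.hasDerivAt_line p S).ofReal_comp) (fun S _ => by
      rw [Complex.norm_real]; exact hC _) (by simp) (fun t ht => by
      refine vdc_second ht.1 hΛp (fun x _ => hasDerivAt_quad Λ p _ x) (e2 := fun _ => 2 * Λ * p)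
        (fun x _ => ?_) continuousOn_const (fun x _ => by linarith)
      exact (((hasDerivAt_id x).sub_const _).const_mul _).congr_deriv (by ring))
  refine key.trans (le_of_eq ?_)
  rw [hg.eq_zero (by norm_num), Complex.ofReal_zero, norm_zero, intervalIntegral.integral_const,
    smul_eq_mul]
  ring

theorem hasDerivAt_critS {y p : ℝ} (hp : p ≠ 0) :
    HasDerivAt (critS y) ((1 + y / p ^ 2) / 2) p := by
  have h1 : HasDerivAt (fun p => y * p⁻¹) (y * (-(p ^ 2)⁻¹)) p := (hasDerivAt_inv hp).const_mul y
  exact (((hasDerivAt_id p).sub h1).div_const 2).congr_deriv (by field_simp; ring)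

theorem integral_mul_quad_cis {g : ℝ × ℝ → ℝ} (hg : StripBump g) {q q' : ℝ → ℝ}
    (hq : ∀ S, HasDerivAt q (q' S) S) (hq' : Continuous q') (Λ p s : ℝ) :
    ∫ S in (-3:ℝ)..3, (g (S, p - S) : ℂ) * q S *
        (Complex.I * (2 * Λ * p * (S - s) : ℝ) * cis (Λ * (p * (S - s) ^ 2)))
      = -∫ S in (-3:ℝ)..3, ((fderiv ℝ g (S, p - S) (1, -1) * q S + g (S, p - S) * q' S : ℝ) : ℂ) *
        cis (Λ * (p * (S - s) ^ 2)) := by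
  have hgc := hg.contDiff.continuous
  have hvc := (hg.fderiv_apply (1, -1)).contDiff.continuous
  have hqc : Continuous q := continuous_iff_continuousAt.mpr fun S => (hq S).continuousAt
  have hcc := continuous_quad_cis Λ p s
  have key := intervalIntegral.integral_mul_deriv_eq_deriv_mul (a := -3) (b := 3)
    (u := fun S => ((g (S, p - S) * q S : ℝ) : ℂ))
    (u' := fun S => ((fderiv ℝ g (S, p - S) (1, -1) * q S + g (S, p - S) * q' S : ℝ) : ℂ))
    (v := fun S => cis (Λ * (p * (S - s) ^ 2)))
    (v' := fun S => Complex.I * (2 * Λ * p * (S - s) : ℝ) * cis (Λ * (p * (S - s) ^ 2)))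
    (fun S _ => ((hg.hasDerivAt_line p S).mul (hq S)).ofReal_comp)
    (fun S _ => hasDerivAt_cis (hasDerivAt_quad Λ p s S))
    (Continuous.intervalIntegrable (by fun_prop) _ _)
    (Continuous.intervalIntegrable (by fun_prop) _ _)
  rw [hg.eq_zero (S := 3) (by norm_num), hg.eq_zero (S := -3) (by norm_num)] at key
  simp only [zero_mul, Complex.ofReal_zero, sub_self, zero_sub] at key
  rw [← key]
  refine intervalIntegral.integral_congr fun S _ => ?_
  push_cast
  ring

theorem exists_hasDerivAt_redM {g : ℝ × ℝ → ℝ} (hg : StripBump g) :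
    ∃ C, 0 ≤ C ∧ ∀ Λ y : ℝ, 0 < Λ → ∃ m' : ℝ → ℂ, ∀ p, 0 < p → p ≤ 6 → 1 ≤ Λ * p →
      HasDerivAt (redM g Λ y) (m' p) p ∧ ‖m' p‖ ≤ C / √(Λ * p) / p := by
  have hV := hg.fderiv_apply (1, -1)
  have hU := hg.fderiv_apply (0, 1)
  have hVV := hV.fderiv_apply (1, -1)
  have hYV := hV.snd_mul
  obtain ⟨C1, hC1, b1⟩ := norm_redM_le hg
  obtain ⟨C2, hC2, b2⟩ := norm_redM_le hU
  obtain ⟨C3, hC3, b3⟩ := norm_redM_le hVV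
  obtain ⟨C4, hC4, b4⟩ := norm_redM_le hYV
  refine ⟨C1 + 6 * C2 + C3 + 2 * C4, by positivity, fun Λ y hΛ => ?_⟩
  refine ⟨fun p => redM (fun x => fderiv ℝ g x (0, 1)) Λ y p
    + (1 / (2 * p) : ℝ) * (-redM g Λ y p + 2 * redM (fun x => x.2 * fderiv ℝ g x (1, -1)) Λ y p)
    - (1 / (4 * p ^ 2 * Λ) : ℝ) * Complex.I⁻¹ *
      redM (fun x => fderiv ℝ (fun x => fderiv ℝ g x (1, -1)) x (1, -1)) Λ y p,
    fun p hp hp6 hΛp => ⟨?_, ?_⟩⟩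
  · have hgc := hg.contDiff.continuous
    have hVc := hV.contDiff.continuous
    have hUc := hU.contDiff.continuous
    have hVVc := hVV.contDiff.continuous
    have hpos : ∀ q ∈ Set.Icc (p - p / 2) (p + p / 2), q ≠ 0 := fun q hq => by
      have := hq.1
      exact (show 0 < q by linarith).ne'
    have hcr : ContinuousOn (fun z : ℝ × ℝ => critS y z.1)
        (Set.Icc (p - p / 2) (p + p / 2) ×ˢ Set.Icc (-3) 3) := fun z hz =>
      ((hasDerivAt_critS (hpos z.1 hz.1)).continuousAt.comp continuousAt_fst).continuousWithinAt
    have key := hasDerivAt_intervalIntegral_of_continuousOn (a := -3) (b := 3) (p₀ := p) (ε := p / 2)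
      (by norm_num) (by linarith)
      (F := fun p S => (g (S, p - S) : ℂ) * cis (Λ * (p * (S - critS y p) ^ 2)))
      (F' := fun p S => (fderiv ℝ g (S, p - S) (0, 1) : ℂ) * cis (Λ * (p * (S - critS y p) ^ 2))
        + (g (S, p - S) : ℂ) * (Complex.I *
          ((-(Λ * ((S - critS y p) * (2 * (p - S) + (S - critS y p)))) : ℝ) : ℂ)
            * cis (Λ * (p * (S - critS y p) ^ 2))))
      (fun q _ => Continuous.continuousOn (by
        have := continuous_quad_cis Λ q (critS y q)
        fun_prop)) ?_ ?_
    · refine key.congr_deriv ?_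
      have hcc := continuous_quad_cis Λ p (critS y p)
      set s := critS y p with hs
      have hI : (Complex.I) ≠ 0 := Complex.I_ne_zero
      have hpc : (p : ℂ) ≠ 0 := by exact_mod_cast hp.ne'
      have hLc : (Λ : ℂ) ≠ 0 := by exact_mod_cast hΛ.ne'
      rw [intervalIntegral.integral_add (Continuous.intervalIntegrable (by fun_prop) _ _)
        (Continuous.intervalIntegrable (by fun_prop) _ _)]
      have e1 : ∫ S in (-3:ℝ)..3, (g (S, p - S) : ℂ) * (Complex.I *
          ((-(Λ * ((S - s) * (2 * (p - S) + (S - s)))) : ℝ) : ℂ) * cis (Λ * (p * (S - s) ^ 2)))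
          = -(1 / (2 * p)) * ∫ S in (-3:ℝ)..3, (g (S, p - S) : ℂ) * ((2 * (p - S) + (S - s) : ℝ) : ℂ) *
            (Complex.I * (2 * Λ * p * (S - s) : ℝ) * cis (Λ * (p * (S - s) ^ 2))) := by
        rw [← intervalIntegral.integral_const_mul]
        refine intervalIntegral.integral_congr fun S _ => ?_
        push_cast
        field_simp
      have e2 := integral_mul_quad_cis hg (q := fun S => 2 * (p - S) + (S - s)) (q' := fun _ => -1)
        (fun S => ((((hasDerivAt_id S).const_sub p).const_mul 2).add
          ((hasDerivAt_id S).sub_const s)).congr_deriv (by norm_num)) continuous_const Λ p s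
      have e3 := integral_mul_quad_cis hV (q := fun _ => 1) (q' := fun _ => 0)
        (fun S => hasDerivAt_const S 1) continuous_const Λ p s
      have e4 : ∫ S in (-3:ℝ)..3, ((fderiv ℝ g (S, p - S) (1, -1) * (2 * (p - S) + (S - s))
            + g (S, p - S) * -1 : ℝ) : ℂ) * cis (Λ * (p * (S - s) ^ 2))
          = (∫ S in (-3:ℝ)..3, 2 * (((p - S) * fderiv ℝ g (S, p - S) (1, -1) : ℝ) : ℂ)
              * cis (Λ * (p * (S - s) ^ 2)))
            + (1 / (2 * Λ * p * Complex.I)) * (∫ S in (-3:ℝ)..3, (fderiv ℝ g (S, p - S) (1, -1) : ℂ) *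
              ((1 : ℝ) : ℂ) * (Complex.I * (2 * Λ * p * (S - s) : ℝ) * cis (Λ * (p * (S - s) ^ 2))))
            - ∫ S in (-3:ℝ)..3, (g (S, p - S) : ℂ) * cis (Λ * (p * (S - s) ^ 2)) := by
        rw [← intervalIntegral.integral_const_mul, ← intervalIntegral.integral_add
          (Continuous.intervalIntegrable (by fun_prop) _ _)
          (Continuous.intervalIntegrable (by fun_prop) _ _), ← intervalIntegral.integral_sub
          (Continuous.intervalIntegrable (by fun_prop) _ _)
          (Continuous.intervalIntegrable (by fun_prop) _ _)]
        refine intervalIntegral.integral_congr fun S _ => ?_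
        push_cast
        field_simp
        ring
      rw [e1, e2, e4, e3]
      simp only [mul_one, mul_zero, add_zero, mul_assoc (2:ℂ), intervalIntegral.integral_const_mul]
      simp only [redM, ← hs]
      push_cast
      field_simp
      ring
    · have hphase : ContinuousOn (fun z : ℝ × ℝ => cis (Λ * (z.1 * (z.2 - critS y z.1) ^ 2)))
          (Set.Icc (p - p / 2) (p + p / 2) ×ˢ Set.Icc (-3) 3) :=
        continuous_cis.comp_continuousOn (by fun_prop)
      have hUz : Continuous fun z : ℝ × ℝ => ((fderiv ℝ g (z.2, z.1 - z.2) (0, 1) : ℝ) : ℂ) :=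
        Complex.continuous_ofReal.comp (hUc.comp (by fun_prop))
      have hgz : Continuous fun z : ℝ × ℝ => ((g (z.2, z.1 - z.2) : ℝ) : ℂ) :=
        Complex.continuous_ofReal.comp (hgc.comp (by fun_prop))
      have hamp : ContinuousOn (fun z : ℝ × ℝ => ((-(Λ * ((z.2 - critS y z.1) *
          (2 * (z.1 - z.2) + (z.2 - critS y z.1)))) : ℝ) : ℂ))
          (Set.Icc (p - p / 2) (p + p / 2) ×ˢ Set.Icc (-3) 3) :=
        Complex.continuous_ofReal.comp_continuousOn (by fun_prop)
      exact (hUz.continuousOn.mul hphase).add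
        (hgz.continuousOn.mul ((continuousOn_const.mul hamp).mul hphase))
    · intro q hq S _
      have hq0 := hpos q hq
      have h1 := (hasDerivAt_critS (y := y) hq0).const_sub S
      have h2 := ((hasDerivAt_id q).mul (h1.pow 2)).const_mul Λ
      have h3 : HasDerivAt (fun q => Λ * (q * (S - critS y q) ^ 2))
          (-(Λ * ((S - critS y q) * (2 * (q - S) + (S - critS y q))))) q := by
        refine h2.congr_deriv ?_
        change Λ * (1 * (S - critS y q) ^ 2 + q * (((2 : ℕ) : ℝ) * (S - critS y q) ^ (2 - 1)
          * -((1 + y / q ^ 2) / 2))) = _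
        norm_num [critS]
        field_simp
        ring
      exact ((hg.hasDerivAt_shift q S).ofReal_comp.mul (hasDerivAt_cis h3)).congr_deriv (by ring)
  · have hs : 0 < √(Λ * p) := Real.sqrt_pos.mpr (by linarith)
    have k1 := b1 Λ y p hΛ hp
    have k2 := b2 Λ y p hΛ hp
    have k3 := b3 Λ y p hΛ hp
    have k4 := b4 Λ y p hΛ hp
    set r := 1 / √(Λ * p) with hr
    have hr0 : 0 < r := by positivity
    have conv : ∀ C : ℝ, C / √(Λ * p) = C * r := fun C => by rw [hr]; ring
    rw [conv] at k1 k2 k3 k4 ⊢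
    have n1 : ‖((1 / (2 * p) : ℝ) : ℂ)‖ = 1 / (2 * p) := by
      rw [Complex.norm_real, Real.norm_of_nonneg (by positivity)]
    have n2 : ‖((1 / (4 * p ^ 2 * Λ) : ℝ) : ℂ)‖ = 1 / (4 * p ^ 2 * Λ) := by
      rw [Complex.norm_real, Real.norm_of_nonneg (by positivity)]
    have n3 : 1 / (4 * p ^ 2 * Λ) ≤ 1 / p := by
      apply one_div_le_one_div_of_le hp
      nlinarith
    have n4 : 1 / (2 * p) ≤ 1 / p := one_div_le_one_div_of_le hp (by linarith)
    have n5 : 1 ≤ 6 * (1 / p) := by rw [mul_one_div, le_div_iff₀ hp]; linarith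
    have hp1 : 0 < 1 / p := by positivity
    refine (norm_sub_le _ _).trans ((add_le_add_left (norm_add_le _ _) _).trans ?_)
    rw [norm_mul, norm_mul, norm_mul, n1, n2, norm_inv, Complex.norm_I, inv_one, mul_one]
    have k5 : ‖-redM g Λ y p + 2 * redM (fun x => x.2 * fderiv ℝ g x (1, -1)) Λ y p‖
        ≤ C1 * r + 2 * (C4 * r) := by
      refine (norm_add_le _ _).trans ?_
      rw [norm_neg, norm_mul, Complex.norm_ofNat]
      gcongr
    calc _ ≤ C2 * r + 1 / p * (C1 * r + 2 * (C4 * r)) + 1 / p * (C3 * r) := by gcongr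
      _ ≤ C2 * r * (6 * (1 / p)) + 1 / p * (C1 * r + 2 * (C4 * r)) + 1 / p * (C3 * r) := by
          have := le_mul_of_one_le_right (show 0 ≤ C2 * r by positivity) n5
          linarith
      _ = _ := by ring

/-- Amplitudes bounded by `K p ^ (-1/2)` with derivative bounded by `K p ^ (-3/2)`. -/
structure WeightBound (K α β : ℝ) (c c' : ℝ → ℂ) : Prop where
  pos : 0 < α
  nonneg : 0 ≤ K
  deriv : ∀ p ∈ Set.Icc α β, HasDerivAt c (c' p) p
  bound : ∀ p ∈ Set.Icc α β, ‖c p‖ ≤ K / √p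
  bound' : ∀ p ∈ Set.Icc α β, ‖c' p‖ ≤ K / (√p * p)

theorem WeightBound.mono {K α β α' β' : ℝ} {c c' : ℝ → ℂ} (h : WeightBound K α β c c')
    (h1 : α ≤ α') (h2 : β' ≤ β) : WeightBound K α' β' c c' where
  pos := h.pos.trans_le h1
  nonneg := h.nonneg
  deriv p hp := h.deriv p ⟨h1.trans hp.1, hp.2.trans h2⟩
  bound p hp := h.bound p ⟨h1.trans hp.1, hp.2.trans h2⟩
  bound' p hp := h.bound' p ⟨h1.trans hp.1, hp.2.trans h2⟩

theorem continuousOn_inv_sqrt_mul {α β : ℝ} (hα : 0 < α) :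
    ContinuousOn (fun p : ℝ => 1 / (√p * p)) (Set.Icc α β) := by
  refine ContinuousOn.div continuousOn_const (by fun_prop) fun p hp => ?_
  have : 0 < p := hα.trans_le hp.1
  positivity

theorem integral_inv_sqrt_mul {α β : ℝ} (hα : 0 < α) (hab : α ≤ β) :
    ∫ p in α..β, 1 / (√p * p) = 2 / √α - 2 / √β := by
  have hI : Set.uIcc α β = Set.Icc α β := Set.uIcc_of_le hab
  have key := intervalIntegral.integral_eq_sub_of_hasDerivAt (a := α) (b := β)
    (f := fun p => -(2 * (√p)⁻¹)) (f' := fun p => 1 / (√p * p)) (fun p hp => by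
      have hp0 : 0 < p := hα.trans_le (hI ▸ hp).1
      have hs := Real.sqrt_pos.mpr hp0
      have h1 := (((Real.hasDerivAt_sqrt hp0.ne').inv hs.ne').const_mul 2).neg
      refine h1.congr_deriv ?_
      have := Real.sq_sqrt hp0.le
      rw [this]
      field_simp) (by
      refine ContinuousOn.intervalIntegrable ?_
      rw [hI]
      exact continuousOn_inv_sqrt_mul hα)
  rw [key]
  ring

theorem WeightBound.norm_integral_le {K α β V : ℝ} {c c' : ℝ → ℂ} (h : WeightBound K α β c c')
    (hab : α ≤ β) {f : ℝ → ℂ} (hf : ContinuousOn f (Set.Icc α β))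
    (hV : ∀ t ∈ Set.Icc α β, ‖∫ x in α..t, f x‖ ≤ V) :
    ‖∫ x in α..β, c x * f x‖ ≤ 2 * K * V / √α := by
  have hV0 : 0 ≤ V := (norm_nonneg _).trans (hV α ⟨le_rfl, hab⟩)
  have hβ : 0 < β := h.pos.trans_le hab
  have hgi : IntervalIntegrable (fun p : ℝ => K * (1 / (√p * p))) MeasureTheory.volume α β :=
    (continuousOn_const.mul (continuousOn_inv_sqrt_mul h.pos)).intervalIntegrable_of_Icc hab
  refine (norm_integral_amplitude_le hab hf h.deriv (g := fun p => K * (1 / (√p * p)))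
    (fun p hp => (h.bound' p hp).trans (le_of_eq (by ring))) hgi hV).trans ?_
  rw [intervalIntegral.integral_const_mul, integral_inv_sqrt_mul h.pos hab]
  have h1 := h.bound β ⟨hab, le_rfl⟩
  have h2 : 0 ≤ K / √β := div_nonneg h.nonneg (Real.sqrt_nonneg _)
  calc V * (‖c β‖ + K * (2 / √α - 2 / √β)) ≤ V * (2 * (K / √α)) := by
        refine mul_le_mul_of_nonneg_left ?_ hV0
        have e : K * (2 / √α - 2 / √β) = 2 * (K / √α) - 2 * (K / √β) := by ring
        rw [e]
        linarith
    _ = _ := by ring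

theorem WeightBound.norm_integral_le_of_nonstationary {K α β μ M : ℝ} {c c' : ℝ → ℂ}
    (h : WeightBound K α β c c') (hab : α ≤ β) (hμ : 0 < μ) {E e1 e2 : ℝ → ℝ}
    (hE : ∀ x ∈ Set.Icc α β, HasDerivAt E (e1 x) x)
    (hE1 : ∀ x ∈ Set.Icc α β, HasDerivAt e1 (e2 x) x)
    (he2 : ContinuousOn e2 (Set.Icc α β))
    (h1 : ∀ x ∈ Set.Icc α β, μ ≤ |e1 x|) (h2 : ∀ x ∈ Set.Icc α β, |e2 x| ≤ M / x) :
    ‖∫ x in α..β, c x * cis (E x)‖ ≤ 2 * (K / μ) * (2 + M / μ) / √α := by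
  have hα := h.pos
  have hβ : 0 < β := hα.trans_le hab
  have hK := h.nonneg
  have hM : 0 ≤ M := by
    have := (abs_nonneg _).trans (h2 α ⟨le_rfl, hab⟩)
    by_contra hneg
    exact absurd this (not_le.mpr (div_neg_of_neg_of_pos (not_le.mp hneg) hα))
  have hwc := continuousOn_inv_sqrt_mul (β := β) hα
  have hci := intervalIntegrable_deriv_of_norm_le hab h.deriv (g := fun p => K * (1 / (√p * p)))
    (fun p hp => (h.bound' p hp).trans (le_of_eq (by ring)))
    ((continuousOn_const.mul hwc).intervalIntegrable_of_Icc hab)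
  refine (norm_integral_osc_le_of_ne_zero hab hE hE1 h.deriv
    (fun x hx h0 => by have := h1 x hx; rw [h0, abs_zero] at this; linarith) he2 hci).trans ?_
  have hαm : α ∈ Set.Icc α β := ⟨le_rfl, hab⟩
  have hβm : β ∈ Set.Icc α β := ⟨hab, le_rfl⟩
  have hsαβ : √α ≤ √β := Real.sqrt_le_sqrt hab
  have hsα := Real.sqrt_pos.mpr hα
  have t1 : ‖c β‖ / |e1 β| ≤ K / √α / μ := by
    have := (h.bound β hβm).trans (div_le_div_of_nonneg_left hK hsα hsαβ)
    have h3 := h1 β hβm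
    gcongr
  have t2 : ‖c α‖ / |e1 α| ≤ K / √α / μ := by
    have := h.bound α hαm
    have h3 := h1 α hαm
    gcongr
  have t3 : ∫ x in α..β, (‖c' x‖ / |e1 x| + ‖c x‖ * |e2 x| / e1 x ^ 2)
      ≤ ∫ x in α..β, (K / μ + K * M / μ ^ 2) * (1 / (√x * x)) := by
    have hle : ∀ x ∈ Set.Icc α β, ‖c' x‖ / |e1 x| + ‖c x‖ * |e2 x| / e1 x ^ 2
        ≤ (K / μ + K * M / μ ^ 2) * (1 / (√x * x)) := fun x hx => by
      have hx0 : 0 < x := hα.trans_le hx.1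
      have a1 := h1 x hx
      have a2 := h2 x hx
      have a3 := h.bound x hx
      have a4 := h.bound' x hx
      rw [← sq_abs (e1 x)]
      calc _ ≤ K / (√x * x) / μ + K / √x * (M / x) / μ ^ 2 := by gcongr
        _ = _ := by
          have := Real.sqrt_pos.mpr hx0
          field_simp
    by_cases h_int : IntervalIntegrable
        (fun x => ‖c' x‖ / |e1 x| + ‖c x‖ * |e2 x| / e1 x ^ 2) MeasureTheory.volume α β
    · exact intervalIntegral.integral_mono_on hab h_int
        ((continuousOn_const.mul hwc).intervalIntegrable_of_Icc hab) hle
    · rw [intervalIntegral.integral_undef h_int]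
      refine intervalIntegral.integral_nonneg hab fun x hx => ?_
      have hx0 : 0 < x := hα.trans_le hx.1
      positivity
  rw [intervalIntegral.integral_const_mul, integral_inv_sqrt_mul hα hab] at t3
  have t4 : (K / μ + K * M / μ ^ 2) * (2 / √α - 2 / √β) ≤ (K / μ + K * M / μ ^ 2) * (2 / √α) :=
    mul_le_mul_of_nonneg_left (by
      have : 0 ≤ 2 / √β := by positivity
      linarith) (by positivity)
  calc _ ≤ K / √α / μ + K / √α / μ + (K / μ + K * M / μ ^ 2) * (2 / √α) := by linarith
    _ = _ := by
      field_simp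
      ring

/-- Splitting an integral at a breakpoint which need not lie in the interval. -/
theorem norm_integral_le_add_of_breakpoint {α β B₁ B₂ : ℝ} (z : ℝ) (hab : α ≤ β) {f : ℝ → ℂ}
    (hf : ContinuousOn f (Set.Icc α β)) (hB₁ : 0 ≤ B₁) (hB₂ : 0 ≤ B₂)
    (h1 : ∀ α' β', α ≤ α' → α' ≤ β' → β' ≤ β → β' ≤ z → ‖∫ x in α'..β', f x‖ ≤ B₁)
    (h2 : ∀ α' β', α ≤ α' → α' ≤ β' → β' ≤ β → z ≤ α' → ‖∫ x in α'..β', f x‖ ≤ B₂) :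
    ‖∫ x in α..β, f x‖ ≤ B₁ + B₂ := by
  rcases le_total z α with hz | hz
  · linarith [h2 α β le_rfl hab le_rfl hz]
  rcases le_total β z with hz' | hz'
  · linarith [h1 α β le_rfl hab le_rfl hz']
  exact norm_integral_split hz hz' hf (h1 α z le_rfl hz hz' le_rfl) (h2 z β hz hz' le_rfl le_rfl)

theorem half_cube_le_sqrt {v α : ℝ} (hα : v ^ 6 / 3 ≤ α) : v ^ 3 / 2 ≤ √α :=
  Real.le_sqrt_of_sq_le (by nlinarith [sq_nonneg (v ^ 3)])

/-- The reduced one-dimensional phase after the integrations in `S` and `A` have been evaluated at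
their critical points; `R` is the critical value of `A`. -/
structure ReducedPhase (ℓ v y n τ α β : ℝ) (E R R1 R2 : ℝ → ℝ) : Prop where
  one_le : 1 ≤ ℓ
  v_pos : 0 < v
  n_cases : n = 1 ∨ n = -1 ∨ 2 ≤ |n|
  n_le : |n| ≤ 13 / 10 * ℓ
  le_n_mul : 7 / 10 ≤ |n| * v ^ 6
  v_eq : |τ / 2 - 2| = v ^ 12
  pos : 0 < α
  le_six : β ≤ 6
  deriv : ∀ p ∈ Set.Icc α β, HasDerivAt E (ℓ ^ 3 * ((p - y / p) ^ 2 / 4 + 1 - R p)) p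
  derivR : ∀ p ∈ Set.Icc α β, HasDerivAt R (R1 p) p
  derivR1 : ∀ p ∈ Set.Icc α β, HasDerivAt R1 (R2 p) p
  abs_R1 : ∀ p ∈ Set.Icc α β, |R1 p| ≤ 3 / |n|
  R2_le : ∀ p ∈ Set.Icc α β, R2 p ≤ (1 / 2 + 5 / 10 ^ 8) / n ^ 2
  far : ∀ p ∈ Set.Icc α β, |p / n - (τ / 2 - 2)| ≤ 2 * |R p - 1|
  R1_near : ∀ p ∈ Set.Icc α β, |R1 p + √(R p) / n| ≤ 1 / 1000
  R_near : ∀ p ∈ Set.Icc α β, |√(R p) - (τ / 4 - p / (2 * n))| ≤ 1 / 1000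
  le_R : ∀ p ∈ Set.Icc α β, 3 / 4 ≤ R p

namespace ReducedPhase

variable {ℓ v y n τ α β : ℝ} {E R R1 R2 : ℝ → ℝ}

theorem mono (h : ReducedPhase ℓ v y n τ α β E R R1 R2) {α' β' : ℝ} (h1 : α ≤ α') (h2 : β' ≤ β) :
    ReducedPhase ℓ v y n τ α' β' E R R1 R2 := by
  have hs : Set.Icc α' β' ⊆ Set.Icc α β := Set.Icc_subset_Icc h1 h2
  exact ⟨h.one_le, h.v_pos, h.n_cases, h.n_le, h.le_n_mul, h.v_eq, h.pos.trans_le h1,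
    h2.trans h.le_six, fun p hp => h.deriv p (hs hp), fun p hp => h.derivR p (hs hp),
    fun p hp => h.derivR1 p (hs hp), fun p hp => h.abs_R1 p (hs hp), fun p hp => h.R2_le p (hs hp),
    fun p hp => h.far p (hs hp), fun p hp => h.R1_near p (hs hp), fun p hp => h.R_near p (hs hp),
    fun p hp => h.le_R p (hs hp)⟩

theorem deriv2 (h : ReducedPhase ℓ v y n τ α β E R R1 R2) (p : ℝ) (hp : p ∈ Set.Icc α β) :
    HasDerivAt (fun p => ℓ ^ 3 * ((p - y / p) ^ 2 / 4 + 1 - R p))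
      (ℓ ^ 3 * (p / 2 - y ^ 2 / (2 * p ^ 3) - R1 p)) p := by
  have hp0 : p ≠ 0 := (h.pos.trans_le hp.1).ne'
  have h1 : HasDerivAt (fun p => p - y * p⁻¹) (1 - y * (-(p ^ 2)⁻¹)) p :=
    (hasDerivAt_id p).sub ((hasDerivAt_inv hp0).const_mul y)
  have h2 : HasDerivAt (fun p => ℓ ^ 3 * ((p - y * p⁻¹) ^ 2 / 4 + 1 - R p))
    (ℓ ^ 3 * (((2 : ℕ) : ℝ) * (p - y * p⁻¹) ^ (2 - 1) * (1 - y * (-(p ^ 2)⁻¹)) / 4 - R1 p)) p :=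
    ((((h1.pow 2).div_const 4).add_const 1).sub (h.derivR p hp)).const_mul _
  refine h2.congr_deriv ?_
  norm_num
  left
  field_simp
  ring

theorem deriv3 (h : ReducedPhase ℓ v y n τ α β E R R1 R2) (p : ℝ) (hp : p ∈ Set.Icc α β) :
    HasDerivAt (fun p => ℓ ^ 3 * (p / 2 - y ^ 2 / (2 * p ^ 3) - R1 p))
      (ℓ ^ 3 * (1 / 2 + 3 * y ^ 2 / (2 * p ^ 4) - R2 p)) p := by
  have hp0 : p ≠ 0 := (h.pos.trans_le hp.1).ne'
  have h1 : HasDerivAt (fun p : ℝ => (p ^ 3)⁻¹) (-(((3 : ℕ) : ℝ) * p ^ (3 - 1)) / (p ^ 3) ^ 2) p :=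
    (hasDerivAt_pow 3 p).inv (pow_ne_zero 3 hp0)
  have h2 := ((((hasDerivAt_id p).div_const 2).sub (h1.const_mul (y ^ 2 / 2))).sub
    (h.derivR1 p hp)).const_mul (ℓ ^ 3)
  refine (h2.congr_deriv (f' := _) ?_).congr_of_eventuallyEq (Filter.Eventually.of_forall fun q => ?_)
  · norm_num
    left
    field_simp
    ring
  · simp only [Pi.sub_apply, id]
    ring

theorem continuousOn_e2 (h : ReducedPhase ℓ v y n τ α β E R R1 R2) :
    ContinuousOn (fun p => ℓ ^ 3 * (p / 2 - y ^ 2 / (2 * p ^ 3) - R1 p)) (Set.Icc α β) :=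
  fun p hp => (h.deriv3 p hp).continuousAt.continuousWithinAt

theorem continuousOn_cis (h : ReducedPhase ℓ v y n τ α β E R R1 R2) :
    ContinuousOn (fun p => cis (E p)) (Set.Icc α β) :=
  fun p hp => (hasDerivAt_cis (h.deriv p hp)).continuousAt.continuousWithinAt

theorem third_test (h : ReducedPhase ℓ v y n τ α β E R R1 R2) (hab : α ≤ β) {δ : ℝ} (hδ : 0 < δ)
    (h3 : ∀ p ∈ Set.Icc α β, δ⁻¹ ^ 3 ≤ ℓ ^ 3 * (1 / 2 + 3 * y ^ 2 / (2 * p ^ 4) - R2 p))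
    {K : ℝ} {c c' : ℝ → ℂ} (hc : WeightBound K α β c c') :
    ‖∫ p in α..β, c p * cis (E p)‖ ≤ 2 * K * (18 * δ) / √α := by
  refine hc.norm_integral_le hab h.continuousOn_cis fun t ht => ?_
  have ht' := h.mono le_rfl ht.2
  exact vdc_third ht.1 hδ ht'.deriv ht'.deriv2 ht'.deriv3
    fun p hp => h3 p ⟨hp.1, hp.2.trans ht.2⟩

/-- Contribution of the momenta `p ≳ ρ`. -/
theorem norm_integral_le_large (h : ReducedPhase ℓ v y n τ α β E R R1 R2) (hab : α ≤ β)
    (hα : v ^ 6 / 3 ≤ α) {K : ℝ} {c c' : ℝ → ℂ} (hc : WeightBound K α β c c') :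
    ‖∫ p in α..β, c p * cis (E p)‖ ≤ 18000 * (K / (ℓ * v ^ 3)) := by
  have hℓ := h.one_le
  have hℓ0 : 0 < ℓ := by linarith
  have hv := h.v_pos
  have hK := hc.nonneg
  have hs := half_cube_le_sqrt hα
  have hv3 : 0 < v ^ 3 := by positivity
  have hℓ3 : ℓ ^ 2 ≤ ℓ ^ 3 := pow_le_pow_right₀ hℓ (by norm_num)
  have hαpos := h.pos
  have fin : ∀ V, V ≤ 4500 / ℓ → 2 * K * V / √α ≤ 18000 * (K / (ℓ * v ^ 3)) := fun V hV => by
    calc 2 * K * V / √α ≤ 2 * K * (4500 / ℓ) / (v ^ 3 / 2) := by gcongr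
      _ = _ := by field_simp; ring
  have third : (∀ p ∈ Set.Icc α β, 1 / 250 ^ 3 ≤ 1 / 2 + 3 * y ^ 2 / (2 * p ^ 4) - R2 p) →
      ‖∫ p in α..β, c p * cis (E p)‖ ≤ 18000 * (K / (ℓ * v ^ 3)) := fun h3 => by
    refine (h.third_test hab (δ := 250 / ℓ) (by positivity) (fun p hp => ?_) hc).trans
      (fin _ (le_of_eq (by ring)))
    have := mul_le_mul_of_nonneg_left (h3 p hp) (show 0 ≤ ℓ ^ 3 by positivity)
    refine le_trans (le_of_eq ?_) this
    field_simp
  have second : ∀ V, (∀ t ∈ Set.Icc α β, ‖∫ p in α..t, cis (E p)‖ ≤ V) → V ≤ 4500 / ℓ →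
      ‖∫ p in α..β, c p * cis (E p)‖ ≤ 18000 * (K / (ℓ * v ^ 3)) := fun V hV hle =>
    (hc.norm_integral_le hab h.continuousOn_cis hV).trans (fin V hle)
  have hsq : ∀ κ : ℝ, 1 / 100 ≤ κ → 8 / √(κ * ℓ ^ 3) ≤ 4500 / ℓ := fun κ hκ => by
    have : ℓ / 10 ≤ √(κ * ℓ ^ 3) := Real.le_sqrt_of_sq_le (by nlinarith)
    calc 8 / √(κ * ℓ ^ 3) ≤ 8 / (ℓ / 10) := by gcongr
      _ = 80 / ℓ := by field_simp; ring
      _ ≤ _ := by gcongr; norm_num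
  by_cases hn2 : 2 ≤ |n|
  · refine third fun p hp => ?_
    have hp0 : 0 < p := hαpos.trans_le hp.1
    have h4 : 4 ≤ n ^ 2 := by rw [← sq_abs]; nlinarith
    have h2 := h.R2_le p hp
    have h5 : (1 / 2 + 5 / 10 ^ 8) / n ^ 2 ≤ (1 / 2 + 5 / 10 ^ 8) / 4 := by gcongr
    have h6 : 0 ≤ 3 * y ^ 2 / (2 * p ^ 4) := by positivity
    norm_num at h5 ⊢
    linarith
  have hn1 : n = 1 ∨ n = -1 := by
    rcases h.n_cases with h1 | h1 | h1
    exacts [Or.inl h1, Or.inr h1, absurd h1 hn2]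
  have habs : |n| = 1 := by rcases hn1 with h1 | h1 <;> simp [h1]
  have hnsq : n ^ 2 = 1 := by rw [← sq_abs, habs, one_pow]
  by_cases hy : 1 / 100 ≤ |y|
  · refine third fun p hp => ?_
    have hp0 : 0 < p := hαpos.trans_le hp.1
    have hp6 : p ≤ 6 := hp.2.trans h.le_six
    have h2 := h.R2_le p hp
    rw [hnsq, div_one] at h2
    have hy2 : (1 / 100) ^ 2 ≤ y ^ 2 := by rw [← sq_abs y]; gcongr
    have h6 : 3 * (1 / 100) ^ 2 / (2 * 6 ^ 4) ≤ 3 * y ^ 2 / (2 * p ^ 4) := by gcongr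
    norm_num at h6 h2 ⊢
    linarith
  push Not at hy
  have hpl : ∀ p ∈ Set.Icc α β, 7 / 30 ≤ p := fun p hp => by
    have h1 := h.le_n_mul
    rw [habs] at h1
    linarith [hp.1]
  have hy2 : y ^ 2 ≤ (1 / 100) ^ 2 := by rw [← sq_abs y]; gcongr
  have hyp : ∀ p ∈ Set.Icc α β, y ^ 2 / (2 * p ^ 3) ≤ 1 / 200 := fun p hp => by
    have := hpl p hp
    calc y ^ 2 / (2 * p ^ 3) ≤ (1 / 100) ^ 2 / (2 * (7 / 30) ^ 3) := by gcongr
      _ ≤ _ := by norm_num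
  have hyp0 : ∀ p ∈ Set.Icc α β, 0 ≤ y ^ 2 / (2 * p ^ 3) := fun p hp => by
    have := hpl p hp
    positivity
  have hsR : ∀ p ∈ Set.Icc α β, 86 / 100 ≤ √(R p) := fun p hp =>
    Real.le_sqrt_of_sq_le (by have := h.le_R p hp; norm_num; linarith)
  rcases hn1 with h1 | h1
  · refine second (8 / √(1 / 2 * ℓ ^ 3)) (fun t ht => ?_) (hsq _ (by norm_num))
    have ht' := h.mono le_rfl ht.2
    refine vdc_second ht.1 (by positivity) ht'.deriv ht'.deriv2 ht'.continuousOn_e2 fun p hp => ?_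
    have hp' : p ∈ Set.Icc α β := ⟨hp.1, hp.2.trans ht.2⟩
    have k1 := abs_le.mp (h.R1_near p hp')
    rw [h1, div_one] at k1
    have k2 := hpl p hp'
    have k3 := hyp p hp'
    have k4 := hsR p hp'
    rw [mul_comm]
    refine mul_le_mul_of_nonneg_left ?_ (by positivity)
    linarith [k1.2]
  · by_cases hτ : 1 / 10 ≤ τ
    · refine second (8 / √(1 / 50 * ℓ ^ 3)) (fun t ht => ?_) (hsq _ (by norm_num))
      have ht' := h.mono le_rfl ht.2
      refine vdc_second_neg ht.1 (by positivity) ht'.deriv ht'.deriv2 ht'.continuousOn_e2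
        fun p hp => ?_
      have hp' : p ∈ Set.Icc α β := ⟨hp.1, hp.2.trans ht.2⟩
      have k1 := abs_le.mp (h.R1_near p hp')
      have k2 := abs_le.mp (h.R_near p hp')
      have k3 := hyp0 p hp'
      rw [h1] at k1 k2
      have e1 : √(R p) / -1 = -√(R p) := by ring
      have e2 : p / (2 * -1) = -(p / 2) := by ring
      rw [e1] at k1
      rw [e2] at k2
      have : ℓ ^ 3 * (p / 2 - y ^ 2 / (2 * p ^ 3) - R1 p) ≤ ℓ ^ 3 * (-(1 / 50)) :=
        mul_le_mul_of_nonneg_left (by linarith [k1.1, k2.1]) (by positivity)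
      linarith
    · push Not at hτ
      have hβ6 := h.le_six
      refine (hc.norm_integral_le_of_nonstationary hab (μ := 4 / 5 * ℓ ^ 3) (M := 40 * ℓ ^ 3)
        (by positivity) h.deriv h.deriv2 h.continuousOn_e2 (fun p hp => ?_) (fun p hp => ?_)).trans ?_
      · have k2 := abs_le.mp (h.R_near p hp)
        have e2 : p / (2 * n) = -(p / 2) := by rw [h1]; ring
        rw [e2] at k2
        have hp0 := hpl p hp
        have hp6 : p ≤ 6 := hp.2.trans hβ6
        have k4 := hsR p hp
        have hR : R p = √(R p) ^ 2 := (Real.sq_sqrt (by linarith [h.le_R p hp])).symm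
        have k5 : √(R p) ≤ p / 2 + 26 / 1000 := by linarith [k2.2]
        have k6 : R p ≤ (p / 2 + 26 / 1000) ^ 2 := by rw [hR]; gcongr
        have k7 : p ^ 2 / 4 - y / 2 ≤ (p - y / p) ^ 2 / 4 := by
          have : (p - y / p) ^ 2 / 4 = p ^ 2 / 4 - y / 2 + (y / p) ^ 2 / 4 := by field_simp; ring
          rw [this]
          linarith [sq_nonneg (y / p)]
        have k8 : y ≤ 1 / 100 := (le_abs_self y).trans hy.le
        have : ℓ ^ 3 * (4 / 5) ≤ ℓ ^ 3 * ((p - y / p) ^ 2 / 4 + 1 - R p) :=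
          mul_le_mul_of_nonneg_left (by nlinarith) (by positivity)
        rw [mul_comm]
        exact this.trans (le_abs_self _)
      · have hp0 := hpl p hp
        have hp6 : p ≤ 6 := hp.2.trans hβ6
        have k1 := abs_le.mp (h.abs_R1 p hp)
        rw [habs, div_one] at k1
        have k3 := hyp p hp
        have k4 := hyp0 p hp
        rw [le_div_iff₀ (by linarith), abs_mul, abs_of_nonneg (show 0 ≤ ℓ ^ 3 by positivity)]
        have : |p / 2 - y ^ 2 / (2 * p ^ 3) - R1 p| ≤ 20 / 3 :=
          abs_le.mpr ⟨by linarith [k1.2], by linarith [k1.1]⟩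
        calc _ ≤ ℓ ^ 3 * (20 / 3) * 6 := by gcongr
          _ = _ := by ring
      · have e1 : 40 * ℓ ^ 3 / (4 / 5 * ℓ ^ 3) = 50 := by field_simp; norm_num
        rw [e1]
        have : 2 * (K / (4 / 5 * ℓ ^ 3)) * (2 + 50) / √α = 2 * K * (65 / ℓ ^ 3) / √α := by
          field_simp; ring
        rw [this]
        refine fin _ ?_
        calc 65 / ℓ ^ 3 ≤ 65 / ℓ := by
              gcongr
              nlinarith
          _ ≤ _ := by gcongr; norm_num

theorem le_l_mul (h : ReducedPhase ℓ v y n τ α β E R R1 R2) : 1 / 2 ≤ ℓ * v ^ 6 := by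
  have h1 := h.le_n_mul
  have h2 := mul_le_mul_of_nonneg_right h.n_le (pow_pos h.v_pos 6).le
  nlinarith

theorem inv_n_le (h : ReducedPhase ℓ v y n τ α β E R R1 R2) : 1 / |n| ≤ 10 / 7 * v ^ 6 := by
  have hn : 0 < |n| := by
    rcases h.n_cases with h1 | h1 | h1
    · simp [h1]
    · simp [h1]
    · linarith
  rw [div_le_iff₀ hn]
  linarith [h.le_n_mul]

/-- Small momenta, away from the caustic. -/
theorem norm_integral_le_small (h : ReducedPhase ℓ v y n τ α β E R R1 R2) (hab : α ≤ β)
    (hβ : β ≤ v ^ 6 / 3) (hα : 1 / (ℓ ^ 2 * v ^ 6) ≤ α) (hy : ∀ p ∈ Set.Icc α β, |y| ≤ v ^ 6 * p / 3)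
    {K : ℝ} {c c' : ℝ → ℂ} (hc : WeightBound K α β c c') :
    ‖∫ p in α..β, c p * cis (E p)‖ ≤ 18000 * (K / (ℓ * v ^ 3)) := by
  have hℓ := h.one_le
  have hℓ0 : 0 < ℓ := by linarith
  have hv := h.v_pos
  have hK := hc.nonneg
  have hρ : 0 < v ^ 6 := by positivity
  have hn := h.inv_n_le
  have hαpos := h.pos
  have hyp : ∀ p ∈ Set.Icc α β, |y / p| ≤ v ^ 6 / 3 := fun p hp => by
    have hp0 : 0 < p := hαpos.trans_le hp.1
    rw [abs_div, abs_of_pos hp0, div_le_iff₀ hp0]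
    linarith [hy p hp]
  refine (hc.norm_integral_le_of_nonstationary hab (μ := ℓ ^ 3 * ((v ^ 6) ^ 2 / 8))
    (M := ℓ ^ 3 * (3 * (v ^ 6) ^ 2)) (by positivity) h.deriv h.deriv2 h.continuousOn_e2
    (fun p hp => ?_) (fun p hp => ?_)).trans ?_
  · have hp0 : 0 < p := hαpos.trans_le hp.1
    have hpρ : p ≤ v ^ 6 / 3 := hp.2.trans hβ
    have k1 := h.far p hp
    have k2 : |p / n| ≤ v ^ 6 / 3 * (10 / 7 * v ^ 6) := by
      rw [abs_div, abs_of_pos hp0]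
      calc p / |n| = p * (1 / |n|) := by ring
        _ ≤ _ := by gcongr
    have k3 : |τ / 2 - 2| = (v ^ 6) ^ 2 := by rw [h.v_eq]; ring
    have k4 := abs_sub_abs_le_abs_sub (τ / 2 - 2) (p / n)
    rw [abs_sub_comm (τ / 2 - 2) (p / n), k3] at k4
    have k5 := abs_le.mp (hyp p hp)
    have k6 : (p - y / p) ^ 2 ≤ (2 * v ^ 6 / 3) ^ 2 :=
      sq_le_sq' (by linarith [k5.2]) (by linarith [k5.1])
    rw [abs_mul, abs_of_pos (show 0 < ℓ ^ 3 by positivity)]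
    refine mul_le_mul_of_nonneg_left ?_ (by positivity)
    have k7 := abs_sub_abs_le_abs_sub (R p - 1) ((p - y / p) ^ 2 / 4)
    rw [abs_of_nonneg (show 0 ≤ (p - y / p) ^ 2 / 4 by positivity),
      abs_sub_comm (R p - 1) ((p - y / p) ^ 2 / 4)] at k7
    have k8 : (p - y / p) ^ 2 / 4 - (R p - 1) = (p - y / p) ^ 2 / 4 + 1 - R p := by ring
    rw [k8] at k7
    nlinarith
  · have hp0 : 0 < p := hαpos.trans_le hp.1
    have hpρ : p ≤ v ^ 6 / 3 := hp.2.trans hβ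
    have k1 := h.abs_R1 p hp
    have k2 : 3 / |n| ≤ 3 * (10 / 7 * v ^ 6) := by
      calc 3 / |n| = 3 * (1 / |n|) := by ring
        _ ≤ _ := by gcongr
    rw [le_div_iff₀ hp0, abs_mul, abs_of_pos (show 0 < ℓ ^ 3 by positivity), mul_assoc]
    refine mul_le_mul_of_nonneg_left ?_ (by positivity)
    have k3 : y ^ 2 / (2 * p ^ 3) * p = (y / p) ^ 2 / 2 := by field_simp
    have k4 : (y / p) ^ 2 ≤ (v ^ 6 / 3) ^ 2 := by rw [← sq_abs]; gcongr; exact hyp p hp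
    have k5 : |p / 2 - y ^ 2 / (2 * p ^ 3) - R1 p| ≤ p / 2 + y ^ 2 / (2 * p ^ 3) + |R1 p| := by
      refine (abs_sub _ _).trans (add_le_add_left ((abs_sub _ _).trans (le_of_eq ?_)) _)
      rw [abs_of_pos (by positivity), abs_of_nonneg (by positivity)]
    calc _ ≤ (p / 2 + y ^ 2 / (2 * p ^ 3) + |R1 p|) * p := by gcongr
      _ = p * p / 2 + (y / p) ^ 2 / 2 + |R1 p| * p := by rw [← k3]; ring
      _ ≤ (v ^ 6 / 3) * (v ^ 6 / 3) / 2 + (v ^ 6 / 3) ^ 2 / 2 + 3 * (10 / 7 * v ^ 6) * (v ^ 6 / 3) := by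
        have := k1.trans k2
        gcongr
      _ ≤ _ := by nlinarith
  · have hl := h.le_l_mul
    have hs : 1 / (ℓ * v ^ 3) ≤ √α := by
      refine Real.le_sqrt_of_sq_le (le_trans (le_of_eq ?_) hα)
      field_simp
    have e1 : ℓ ^ 3 * (3 * (v ^ 6) ^ 2) / (ℓ ^ 3 * ((v ^ 6) ^ 2 / 8)) = 24 := by
      field_simp; norm_num
    rw [e1]
    calc 2 * (K / (ℓ ^ 3 * ((v ^ 6) ^ 2 / 8))) * (2 + 24) / √α
        ≤ 2 * (K / (ℓ ^ 3 * ((v ^ 6) ^ 2 / 8))) * (2 + 24) / (1 / (ℓ * v ^ 3)) := by gcongr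
      _ = 416 * (K / (ℓ * v ^ 3)) * (1 / (ℓ * v ^ 6)) := by field_simp; ring
      _ ≤ 416 * (K / (ℓ * v ^ 3)) * (1 / (1 / 2)) := by gcongr
      _ ≤ _ := by
        have : 0 ≤ K / (ℓ * v ^ 3) := by positivity
        linarith

/-- Dyadic decomposition for small momenta near the degenerate region. -/
theorem norm_integral_le_dyadic (k : ℕ) : ∀ {u β α : ℝ}, 0 < u → β = u ^ 6 → α ≤ β →
    β ≤ v ^ 6 / 3 → β ≤ α * 64 ^ k → ReducedPhase ℓ v y n τ α β E R R1 R2 →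
    (∀ p ∈ Set.Icc α β, v ^ 6 * p / 3 ≤ |y|) → ∀ {K : ℝ} {c c' : ℝ → ℂ}, WeightBound K α β c c' →
    ‖∫ p in α..β, c p * cis (E p)‖ ≤ 1400 * (K * u / (ℓ * v ^ 4)) := by
  have piece : ∀ {u β α : ℝ}, 0 < u → β = u ^ 6 → α ≤ β →
    β ≤ v ^ 6 / 3 → β ≤ α * 64 → ReducedPhase ℓ v y n τ α β E R R1 R2 →
    (∀ p ∈ Set.Icc α β, v ^ 6 * p / 3 ≤ |y|) → ∀ {K : ℝ} {c c' : ℝ → ℂ}, WeightBound K α β c c' →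
    ‖∫ p in α..β, c p * cis (E p)‖ ≤ 700 * (K * u / (ℓ * v ^ 4)) := by
    intro u β α hu hβu hab hβ hαβ h hy K c c' hc
    have hℓ0 : 0 < ℓ := by linarith [h.one_le]
    have hv := h.v_pos
    have hK := hc.nonneg
    have hs : u ^ 3 / 8 ≤ √α := Real.le_sqrt_of_sq_le (by nlinarith)
    refine (h.third_test hab (δ := 23 / 10 * u ^ 4 / (ℓ * v ^ 4)) (by positivity)
      (fun p hp => ?_) hc).trans ?_
    · have hp0 : 0 < p := h.pos.trans_le hp.1
      have hpρ : p ≤ v ^ 6 / 3 := hp.2.trans hβ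
      have k1 : 3 * (v ^ 6 * p / 3) ^ 2 / (2 * p ^ 4) ≤ 3 * y ^ 2 / (2 * p ^ 4) := by
        rw [← sq_abs y]
        have := hy p hp
        gcongr
      have k2 : 3 * (v ^ 6 * p / 3) ^ 2 / (2 * p ^ 4) = (v ^ 6 / p) ^ 2 / 6 := by field_simp; norm_num
      have k3 : 3 ≤ v ^ 6 / p := by rw [le_div_iff₀ hp0]; linarith
      have k4 : R2 p ≤ 1 / 2 + 5 / 10 ^ 8 := by
        refine (h.R2_le p hp).trans (div_le_self (by norm_num) ?_)
        rcases h.n_cases with h1 | h1 | h1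
        · simp [h1]
        · simp [h1]
        · rw [← sq_abs]; nlinarith
      have k5 : v ^ 6 / u ^ 6 ≤ v ^ 6 / p := by rw [← hβu]; have := hp.2; gcongr
      have k6 : (v ^ 6 / u ^ 6) ^ 2 ≤ (v ^ 6 / p) ^ 2 := by gcongr
      have e : (23 / 10 * u ^ 4 / (ℓ * v ^ 4))⁻¹ ^ 3
          = ℓ ^ 3 * ((v ^ 6 / u ^ 6) ^ 2 * (10 / 23) ^ 3) := by field_simp
      rw [e]
      refine mul_le_mul_of_nonneg_left ?_ (by positivity)
      norm_num at k4 ⊢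
      nlinarith
    · calc 2 * K * (18 * (23 / 10 * u ^ 4 / (ℓ * v ^ 4))) / √α
          ≤ 2 * K * (18 * (23 / 10 * u ^ 4 / (ℓ * v ^ 4))) / (u ^ 3 / 8) := by gcongr
        _ = 3312 / 5 * (K * u / (ℓ * v ^ 4)) := by field_simp; ring
        _ ≤ _ := by
          have : 0 ≤ K * u / (ℓ * v ^ 4) := by positivity
          linarith
  induction k with
  | zero =>
    intro u β α hu hβu hab hβ hαβ h hy K c c' hc
    have : α = β := le_antisymm hab (by simpa using hαβ)
    have hℓ0 : 0 < ℓ := by linarith [h.one_le]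
    have hv := h.v_pos
    have hK := hc.nonneg
    rw [this, intervalIntegral.integral_same, norm_zero]
    positivity
  | succ k ih =>
    intro u β α hu hβu hab hβ hαβ h hy K c c' hc
    have hℓ0 : 0 < ℓ := by linarith [h.one_le]
    have hv := h.v_pos
    have hK := hc.nonneg
    have hnn : 0 ≤ K * u / (ℓ * v ^ 4) := by positivity
    rcases le_total (β / 64) α with h1 | h1
    · have := piece hu hβu hab hβ (by linarith) h hy hc
      linarith
    have hβ0 : 0 < β := h.pos.trans_le hab
    have hcont : ContinuousOn (fun p => c p * cis (E p)) (Set.Icc α β) :=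
      ContinuousOn.mul (fun p hp => (hc.deriv p hp).continuousAt.continuousWithinAt) h.continuousOn_cis
    have b1 := ih (u := u / 2) (β := β / 64) (α := α) (by positivity) (by rw [hβu]; ring) h1
      (by linarith) (by rw [pow_succ] at hαβ; linarith) (h.mono le_rfl (by linarith))
      (fun p hp => hy p ⟨hp.1, by linarith [hp.2]⟩) (hc.mono le_rfl (by linarith))
    have b2 := piece hu hβu (α := β / 64) (by linarith) hβ (by linarith) (h.mono h1 le_rfl)
      (fun p hp => hy p ⟨by linarith [hp.1], hp.2⟩) (hc.mono h1 le_rfl)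
    refine (norm_integral_split h1 (by linarith) hcont b1 b2).trans (le_of_eq ?_)
    ring

theorem norm_integral_le_degenerate (h : ReducedPhase ℓ v y n τ α β E R R1 R2) (hab : α ≤ β)
    (hβ : β ≤ v ^ 6 / 3) (hy : ∀ p ∈ Set.Icc α β, v ^ 6 * p / 3 ≤ |y|)
    {K : ℝ} {c c' : ℝ → ℂ} (hc : WeightBound K α β c c') :
    ‖∫ p in α..β, c p * cis (E p)‖ ≤ 18000 * (K / (ℓ * v ^ 3)) := by
  have hβ0 : 0 < β := h.pos.trans_le hab
  have hℓ0 : 0 < ℓ := by linarith [h.one_le]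
  have hv := h.v_pos
  have hK := hc.nonneg
  obtain ⟨k, hk⟩ := pow_unbounded_of_one_lt (β / α) (show (1 : ℝ) < 64 by norm_num)
  have hu : 0 < β ^ ((1 : ℝ) / 6) := Real.rpow_pos_of_pos hβ0 _
  have hu6 : β = (β ^ ((1 : ℝ) / 6)) ^ 6 := by
    rw [← Real.rpow_natCast, ← Real.rpow_mul hβ0.le]
    norm_num
  have key := norm_integral_le_dyadic k hu hu6 hab hβ
    (by rw [div_lt_iff₀ h.pos] at hk; linarith) h hy hc
  have huv : β ^ ((1 : ℝ) / 6) ≤ v := by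
    refine le_of_pow_le_pow_left₀ (n := 6) (by norm_num) hv.le ?_
    rw [← hu6]
    linarith [pow_pos hv 6]
  calc _ ≤ 1400 * (K * β ^ ((1 : ℝ) / 6) / (ℓ * v ^ 4)) := key
    _ ≤ 1400 * (K * v / (ℓ * v ^ 4)) := by gcongr
    _ = 1400 * (K / (ℓ * v ^ 3)) := by field_simp
    _ ≤ _ := by
      have : 0 ≤ K / (ℓ * v ^ 3) := by positivity
      linarith

/-- The bound for the one-dimensional integral in the momentum. -/
theorem norm_integral_le (h : ReducedPhase ℓ v y n τ α β E R R1 R2) (hab : α ≤ β)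
    (hα : 1 / (ℓ ^ 2 * v ^ 6) ≤ α) {K : ℝ} {c c' : ℝ → ℂ} (hc : WeightBound K α β c c') :
    ‖∫ p in α..β, c p * cis (E p)‖ ≤ 54000 * (K / (ℓ * v ^ 3)) := by
  have hℓ0 : 0 < ℓ := by linarith [h.one_le]
  have hv := h.v_pos
  have hK := hc.nonneg
  have hρ : 0 < v ^ 6 := by positivity
  have hnn : 0 ≤ 18000 * (K / (ℓ * v ^ 3)) := by positivity
  have hcont : ContinuousOn (fun p => c p * cis (E p)) (Set.Icc α β) :=
    ContinuousOn.mul (fun p hp => (hc.deriv p hp).continuousAt.continuousWithinAt) h.continuousOn_cis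
  refine (norm_integral_le_add_of_breakpoint (v ^ 6 / 3) hab hcont (B₁ := 36000 * (K / (ℓ * v ^ 3)))
    (B₂ := 18000 * (K / (ℓ * v ^ 3))) (by linarith) hnn
    (fun α₁ β₁ h1 h2 h3 h4 => ?_) (fun α₁ β₁ h1 h2 h3 h4 =>
      (h.mono h1 h3).norm_integral_le_large h2 h4 (hc.mono h1 h3))).trans (le_of_eq (by ring))
  have hα₁ : 0 < α₁ := h.pos.trans_le h1
  refine (norm_integral_le_add_of_breakpoint (3 * |y| / v ^ 6) h2
    (hcont.mono (Set.Icc_subset_Icc h1 h3)) hnn hnn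
    (fun α₂ β₂ g1 g2 g3 g4 => ?_) (fun α₂ β₂ g1 g2 g3 g4 => ?_)).trans (le_of_eq (by ring))
  · refine (h.mono (h1.trans g1) (g3.trans h3)).norm_integral_le_degenerate g2 (g3.trans h4)
      (fun p hp => ?_) (hc.mono (h1.trans g1) (g3.trans h3))
    rw [le_div_iff₀ hρ] at g4
    have := mul_le_mul_of_nonneg_right hp.2 hρ.le
    linarith
  · refine (h.mono (h1.trans g1) (g3.trans h3)).norm_integral_le_small g2 (g3.trans h4)
      (hα.trans (h1.trans g1)) (fun p hp => ?_) (hc.mono (h1.trans g1) (g3.trans h3))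
    rw [div_le_iff₀ hρ] at g4
    have := mul_le_mul_of_nonneg_right hp.1 hρ.le
    linarith

end ReducedPhase

/-- The `A`-dependent part of the phase divided by `N`, where `τ = T / N`. -/
noncomputable def flightPhase (a τ A : ℝ) : ℝ :=
  τ * √(1 + a) / a * (√(1 + a * A) - √(1 + a)) - 4 / 3 * √A ^ 3

noncomputable def flightPhase1 (a τ A : ℝ) : ℝ :=
  τ * √(1 + a) / 2 * (√(1 + a * A))⁻¹ - 2 * √A

noncomputable def flightPhase2 (a τ A : ℝ) : ℝ :=
  -(τ * √(1 + a) * a / 4) * (√(1 + a * A))⁻¹ ^ 3 - (√A)⁻¹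

noncomputable def flightPhase3 (a τ A : ℝ) : ℝ :=
  3 * τ * √(1 + a) * a ^ 2 / 8 * (√(1 + a * A))⁻¹ ^ 5 + 1 / 2 * (√A)⁻¹ ^ 3

/-- The divided difference of `flightPhase1`. -/
noncomputable def flightSlope (a τ r A : ℝ) : ℝ :=
  -(2 * (√A + √r)⁻¹) - τ * √(1 + a) * a / 2 * (√(1 + a * r))⁻¹ *
    (√(1 + a * A) * (√(1 + a * A) + √(1 + a * r)))⁻¹

section

variable {a τ A r : ℝ}

theorem hasDerivAt_sqrt_one_add (ha : 0 < a) (hA : 0 < A) :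
    HasDerivAt (fun A => √(1 + a * A)) (a / 2 * (√(1 + a * A))⁻¹) A := by
  have h1 : HasDerivAt (fun A => 1 + a * A) a A := by
    simpa using ((hasDerivAt_id A).const_mul a).const_add 1
  exact (h1.sqrt (by positivity)).congr_deriv (by field_simp)

theorem hasDerivAt_sqrt_pos (hA : 0 < A) :
    HasDerivAt (fun A => √A) (1 / 2 * (√A)⁻¹) A :=
  (Real.hasDerivAt_sqrt hA.ne').congr_deriv (by field_simp)

theorem hasDerivAt_flightPhase (ha : 0 < a) (hA : 0 < A) :
    HasDerivAt (flightPhase a τ) (flightPhase1 a τ A) A := by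
  have h1 := ((hasDerivAt_sqrt_one_add ha hA).sub_const (√(1 + a))).const_mul (τ * √(1 + a) / a)
  have h2 := ((hasDerivAt_sqrt_pos hA).pow 3).const_mul (4 / 3)
  have hs := Real.sqrt_pos.mpr hA
  refine (h1.sub h2).congr_deriv ?_
  unfold flightPhase1
  norm_num
  field_simp
  ring

theorem hasDerivAt_flightPhase1 (ha : 0 < a) (hA : 0 < A) :
    HasDerivAt (flightPhase1 a τ) (flightPhase2 a τ A) A := by
  have hu : 0 < √(1 + a * A) := Real.sqrt_pos.mpr (by positivity)
  have h1 := ((hasDerivAt_sqrt_one_add ha hA).inv hu.ne').const_mul (τ * √(1 + a) / 2)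
  have h2 := (hasDerivAt_sqrt_pos hA).const_mul 2
  refine (h1.sub h2).congr_deriv ?_
  unfold flightPhase2
  field_simp
  ring

theorem hasDerivAt_flightPhase2 (ha : 0 < a) (hA : 0 < A) :
    HasDerivAt (flightPhase2 a τ) (flightPhase3 a τ A) A := by
  have hu : 0 < √(1 + a * A) := Real.sqrt_pos.mpr (by positivity)
  have hs := Real.sqrt_pos.mpr hA
  have h1 := (((hasDerivAt_sqrt_one_add ha hA).inv hu.ne').pow 3).const_mul
    (-(τ * √(1 + a) * a / 4))
  have h2 := (hasDerivAt_sqrt_pos hA).inv hs.ne'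
  refine (h1.sub h2).congr_deriv ?_
  unfold flightPhase3
  norm_num
  field_simp
  ring

theorem flightPhase1_sub (ha : 0 < a) (hA : 0 < A) (hr : 0 < r) :
    flightPhase1 a τ A - flightPhase1 a τ r = flightSlope a τ r A * (A - r) := by
  have hu : 0 < √(1 + a * A) := Real.sqrt_pos.mpr (by positivity)
  have hv : 0 < √(1 + a * r) := Real.sqrt_pos.mpr (by positivity)
  have hs := Real.sqrt_pos.mpr hA
  have ht := Real.sqrt_pos.mpr hr
  have e1 : A - r = (√A - √r) * (√A + √r) := by
    have h1 := Real.sq_sqrt hA.le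
    have h2 := Real.sq_sqrt hr.le
    linear_combination h2 - h1
  have e2 : a * (A - r) = (√(1 + a * A) - √(1 + a * r)) * (√(1 + a * A) + √(1 + a * r)) := by
    have h1 := Real.sq_sqrt (show 0 ≤ 1 + a * A by positivity)
    have h2 := Real.sq_sqrt (show 0 ≤ 1 + a * r by positivity)
    linear_combination h2 - h1
  have e3 : flightSlope a τ r A * (A - r) = -(2 * (√A + √r)⁻¹) * (A - r)
      - τ * √(1 + a) / 2 * (√(1 + a * r))⁻¹ *
        (√(1 + a * A) * (√(1 + a * A) + √(1 + a * r)))⁻¹ * (a * (A - r)) := by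
    unfold flightSlope
    ring
  rw [e3, e2, e1]
  unfold flightPhase1
  field_simp
  ring

theorem flightPhase1_one (ha : 0 < a) : flightPhase1 a τ 1 = τ / 2 - 2 := by
  have hu : 0 < √(1 + a) := Real.sqrt_pos.mpr (by positivity)
  unfold flightPhase1
  rw [mul_one, Real.sqrt_one]
  field_simp

theorem one_le_sqrt_one_add (ha : 0 < a) (hA : 0 < A) : 1 ≤ √(1 + a * A) := by
  rw [Real.one_le_sqrt]
  nlinarith [mul_pos ha hA]

theorem inv_sqrt_one_add_mem (ha : 0 < a) (hA : 0 < A) :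
    0 < (√(1 + a * A))⁻¹ ∧ (√(1 + a * A))⁻¹ ≤ 1 := by
  have := one_le_sqrt_one_add ha hA
  exact ⟨by positivity, inv_le_one_of_one_le₀ this⟩

theorem sqrt_one_add_le (ha : 0 < a) (ha' : a ≤ 1 / 10 ^ 12) :
    1 ≤ √(1 + a) ∧ √(1 + a) ≤ 1 + 1 / 10 ^ 12 := by
  constructor
  · rw [Real.one_le_sqrt]; linarith
  · rw [Real.sqrt_le_left (by norm_num)]
    norm_num at ha' ⊢
    linarith

theorem abs_tau_mul_le (ha : 0 < a) (ha' : a ≤ 1 / 10 ^ 12) (hτ : |τ| ≤ 40) :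
    |τ * √(1 + a) * a| ≤ 41 / 10 ^ 12 := by
  have h1 := sqrt_one_add_le ha ha'
  rw [abs_mul, abs_mul, abs_of_pos ha, abs_of_nonneg (Real.sqrt_nonneg _)]
  calc |τ| * √(1 + a) * a ≤ 40 * (1 + 1 / 10 ^ 12) * (1 / 10 ^ 12) := by
        have := h1.2
        gcongr
    _ ≤ _ := by norm_num

theorem abs_flightPhase2_add_le (ha : 0 < a) (ha' : a ≤ 1 / 10 ^ 12) (hτ : |τ| ≤ 40) (hA : 0 < A) :
    |flightPhase2 a τ A + (√A)⁻¹| ≤ 11 / 10 ^ 12 := by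
  have h1 := abs_tau_mul_le ha ha' hτ
  obtain ⟨h2, h3⟩ := inv_sqrt_one_add_mem ha hA
  have e : flightPhase2 a τ A + (√A)⁻¹ = -(τ * √(1 + a) * a) * ((√(1 + a * A))⁻¹ ^ 3 / 4) := by
    unfold flightPhase2
    ring
  rw [e, abs_mul, abs_neg, abs_of_pos (show 0 < (√(1 + a * A))⁻¹ ^ 3 / 4 by positivity)]
  calc _ ≤ 41 / 10 ^ 12 * ((1 : ℝ) ^ 3 / 4) := by gcongr
    _ ≤ _ := by norm_num

theorem abs_flightPhase3_sub_le (ha : 0 < a) (ha' : a ≤ 1 / 10 ^ 12) (hτ : |τ| ≤ 40) (hA : 0 < A) :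
    |flightPhase3 a τ A - 1 / 2 * (√A)⁻¹ ^ 3| ≤ 1 / 10 ^ 12 := by
  have h1 := abs_tau_mul_le ha ha' hτ
  obtain ⟨h2, h3⟩ := inv_sqrt_one_add_mem ha hA
  have e : flightPhase3 a τ A - 1 / 2 * (√A)⁻¹ ^ 3
      = τ * √(1 + a) * a * (3 / 8 * a * (√(1 + a * A))⁻¹ ^ 5) := by
    unfold flightPhase3
    ring
  rw [e, abs_mul, abs_of_pos (show 0 < 3 / 8 * a * (√(1 + a * A))⁻¹ ^ 5 by positivity)]
  calc _ ≤ 41 / 10 ^ 12 * (3 / 8 * (1 / 10 ^ 12) * (1 : ℝ) ^ 5) := by gcongr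
    _ ≤ _ := by norm_num

theorem abs_flightPhase1_sub_le (ha : 0 < a) (ha' : a ≤ 1 / 10 ^ 12) (hτ : |τ| ≤ 40) (hA : 0 < A)
    (hA8 : A ≤ 8) : |flightPhase1 a τ A - (τ / 2 - 2 * √A)| ≤ 1 / 1000 := by
  obtain ⟨h2, h3⟩ := inv_sqrt_one_add_mem ha hA
  obtain ⟨h4, h5⟩ := sqrt_one_add_le ha ha'
  have h6 := one_le_sqrt_one_add ha hA
  have h7 : √(1 + a * A) ≤ 1 + 8 / 10 ^ 12 := by
    rw [Real.sqrt_le_left (by norm_num)]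
    have : a * A ≤ 1 / 10 ^ 12 * 8 := by gcongr
    norm_num at this ⊢
    linarith
  have h8 : 1 - 8 / 10 ^ 12 ≤ (√(1 + a * A))⁻¹ := by
    rw [le_inv_comm₀ (by norm_num) (by linarith)]
    refine h7.trans ?_
    norm_num
  have e : flightPhase1 a τ A - (τ / 2 - 2 * √A) = τ * ((√(1 + a) * (√(1 + a * A))⁻¹ - 1) / 2) := by
    unfold flightPhase1
    ring
  have h9 : |(√(1 + a) * (√(1 + a * A))⁻¹ - 1) / 2| ≤ 8 / 10 ^ 12 := by
    rw [abs_le]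
    constructor <;> nlinarith
  rw [e, abs_mul]
  calc |τ| * _ ≤ 40 * (8 / 10 ^ 12) := by gcongr
    _ ≤ _ := by norm_num

/-- The slope is a small perturbation of `-2 / (√A + √r)`. -/
theorem abs_flightSlope_add_le (ha : 0 < a) (ha' : a ≤ 1 / 10 ^ 12) (hτ : |τ| ≤ 40) (hA : 0 < A)
    (hr : 0 < r) : |flightSlope a τ r A + 2 * (√A + √r)⁻¹| ≤ 1 / 1000 := by
  have h1 := abs_tau_mul_le ha ha' hτ
  obtain ⟨h2, h3⟩ := inv_sqrt_one_add_mem ha hr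
  have h4 := one_le_sqrt_one_add ha hA
  have h5 := one_le_sqrt_one_add ha hr
  have h6 : 0 < √(1 + a * A) * (√(1 + a * A) + √(1 + a * r)) := by positivity
  have h7 : (√(1 + a * A) * (√(1 + a * A) + √(1 + a * r)))⁻¹ ≤ 1 :=
    inv_le_one_of_one_le₀ (by nlinarith)
  have e : flightSlope a τ r A + 2 * (√A + √r)⁻¹ = -(τ * √(1 + a) * a) *
      (1 / 2 * (√(1 + a * r))⁻¹ * (√(1 + a * A) * (√(1 + a * A) + √(1 + a * r)))⁻¹) := by
    unfold flightSlope
    ring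
  rw [e, abs_mul, abs_neg, abs_of_pos (show 0 < 1 / 2 * (√(1 + a * r))⁻¹ *
    (√(1 + a * A) * (√(1 + a * A) + √(1 + a * r)))⁻¹ by positivity)]
  calc _ ≤ 41 / 10 ^ 12 * (1 / 2 * (1 : ℝ) * 1) := by gcongr
    _ ≤ _ := by norm_num

theorem flightSlope_mem (ha : 0 < a) (ha' : a ≤ 1 / 10 ^ 12) (hτ : |τ| ≤ 40)
    (hA : A ∈ Set.Icc (1 / 2 : ℝ) 8) (hr : r ∈ Set.Icc (1 / 2 : ℝ) 8) :
    -2 ≤ flightSlope a τ r A ∧ flightSlope a τ r A ≤ -(3 / 10) := by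
  have h1 := abs_le.mp (abs_flightSlope_add_le ha ha' hτ (A := A) (r := r) (by linarith [hA.1])
    (by linarith [hr.1]))
  have lo : ∀ x ∈ Set.Icc (1 / 2 : ℝ) 8, 7 / 10 ≤ √x := fun x hx =>
    Real.le_sqrt_of_sq_le (by norm_num; linarith [hx.1])
  have hi : ∀ x ∈ Set.Icc (1 / 2 : ℝ) 8, √x ≤ 29 / 10 := fun x hx => by
    rw [Real.sqrt_le_left (by norm_num)]; norm_num; linarith [hx.2]
  have l1 := lo A hA
  have l2 := lo r hr
  have h2 : (√A + √r)⁻¹ ≤ (14 / 10)⁻¹ := inv_anti₀ (by norm_num) (by linarith)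
  have h3 : (58 / 10)⁻¹ ≤ (√A + √r)⁻¹ :=
    inv_anti₀ (by linarith) (by linarith [hi A hA, hi r hr])
  norm_num at h2 h3
  constructor <;> linarith [h1.1, h1.2]

theorem flightPhase2_le (ha : 0 < a) (ha' : a ≤ 1 / 10 ^ 12) (hτ : |τ| ≤ 40)
    (hA : A ∈ Set.Icc (1 / 2 : ℝ) 7) : flightPhase2 a τ A ≤ -(1 / 3) := by
  have hA0 : 0 < A := by linarith [hA.1]
  have h1 := abs_le.mp (abs_flightPhase2_add_le ha ha' hτ hA0)
  have h2 : √A ≤ 27 / 10 := by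
    rw [Real.sqrt_le_left (by norm_num)]; norm_num; linarith [hA.2]
  have h3 : (27 / 10)⁻¹ ≤ (√A)⁻¹ := inv_anti₀ (Real.sqrt_pos.mpr hA0) h2
  norm_num at h1 h3
  linarith [h1.2]

theorem neg_two_le_flightPhase2 (ha : 0 < a) (ha' : a ≤ 1 / 10 ^ 12) (hτ : |τ| ≤ 40)
    (hA : 1 / 2 ≤ A) : -2 ≤ flightPhase2 a τ A := by
  have hA0 : 0 < A := by linarith
  have h1 := abs_le.mp (abs_flightPhase2_add_le ha ha' hτ hA0)
  have h2 : 7 / 10 ≤ √A := Real.le_sqrt_of_sq_le (by norm_num; linarith)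
  have h3 : (√A)⁻¹ ≤ (7 / 10)⁻¹ := inv_anti₀ (by norm_num) h2
  norm_num at h1 h3
  linarith [h1.1]

end

section

variable {a τ : ℝ}

theorem exists_flight_critical_point (ha : 0 < a) (ha' : a ≤ 1 / 10 ^ 12) (hτ : |τ| ≤ 40) :
    ∃ r : ℝ → ℝ, ∀ w ∈ Set.Icc (flightPhase1 a τ 7) (flightPhase1 a τ (3 / 4)),
      r w ∈ Set.Icc (3 / 4 : ℝ) 7 ∧ flightPhase1 a τ (r w) = w ∧
        HasDerivAt r (flightPhase2 a τ (r w))⁻¹ w := by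
  have hpos : ∀ A ∈ Set.Icc (1 / 2 : ℝ) 8, 0 < A := fun A hA => by linarith [hA.1]
  have hcont : ContinuousOn (flightPhase1 a τ) (Set.Icc (1 / 2) 8) := fun A hA =>
    (hasDerivAt_flightPhase1 ha (hpos A hA)).continuousAt.continuousWithinAt
  have hlt : ∀ A ∈ Set.Icc (1 / 2 : ℝ) 8, ∀ B ∈ Set.Icc (1 / 2 : ℝ) 8, A < B →
      3 / 10 * (B - A) ≤ flightPhase1 a τ A - flightPhase1 a τ B := fun A hA B hB hAB => by
    have h1 := flightPhase1_sub (τ := τ) ha (hpos A hA) (hpos B hB)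
    have h2 := (flightSlope_mem ha ha' hτ hA hB).2
    nlinarith
  have hlip : ∀ A ∈ Set.Icc (1 / 2 : ℝ) 8, ∀ B ∈ Set.Icc (1 / 2 : ℝ) 8,
      |A - B| ≤ 10 / 3 * |flightPhase1 a τ A - flightPhase1 a τ B| := fun A hA B hB => by
    have h1 := flightPhase1_sub (τ := τ) ha (hpos A hA) (hpos B hB)
    have h2 := (flightSlope_mem ha ha' hτ hA hB).2
    rw [h1, abs_mul, abs_of_neg (show flightSlope a τ B A < 0 by linarith)]
    nlinarith [abs_nonneg (A - B)]
  have m34 : (3 / 4 : ℝ) ∈ Set.Icc (1 / 2 : ℝ) 8 := by constructor <;> norm_num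
  have m7 : (7 : ℝ) ∈ Set.Icc (1 / 2 : ℝ) 8 := by constructor <;> norm_num
  have mh : (1 / 2 : ℝ) ∈ Set.Icc (1 / 2 : ℝ) 8 := by constructor <;> norm_num
  have m8 : (8 : ℝ) ∈ Set.Icc (1 / 2 : ℝ) 8 := by constructor <;> norm_num
  have hex : ∀ w ∈ Set.Icc (flightPhase1 a τ 8) (flightPhase1 a τ (1 / 2)),
      ∃ A ∈ Set.Icc (1 / 2 : ℝ) 8, flightPhase1 a τ A = w := fun w hw =>
    intermediate_value_Icc' (by norm_num) hcont hw
  choose! r hr hrw using hex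
  have l1 := hlt (1 / 2) mh (3 / 4) m34 (by norm_num)
  have l2 := hlt 7 m7 8 m8 (by norm_num)
  have hmem : ∀ w ∈ Set.Icc (flightPhase1 a τ 7) (flightPhase1 a τ (3 / 4)),
      w ∈ Set.Ioo (flightPhase1 a τ 8) (flightPhase1 a τ (1 / 2)) := fun w hw =>
    ⟨by linarith [hw.1], by linarith [hw.2]⟩
  refine ⟨r, fun w hw => ?_⟩
  have hw' := hmem w hw
  have hwI := Set.Ioo_subset_Icc_self hw'
  have hrI := hr w hwI
  have hr34 : 3 / 4 ≤ r w := by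
    by_contra! hlt'
    have := hlt _ hrI _ m34 hlt'
    rw [hrw w hwI] at this
    linarith [hw.2]
  have hr7 : r w ≤ 7 := by
    by_contra! hlt'
    have := hlt _ m7 _ hrI hlt'
    rw [hrw w hwI] at this
    linarith [hw.1]
  refine ⟨⟨hr34, hr7⟩, hrw w hwI, ?_⟩
  have hrc : ContinuousAt r w := by
    have hL : LipschitzOnWith (10 / 3) r
        (Set.Icc (flightPhase1 a τ 8) (flightPhase1 a τ (1 / 2))) := by
      refine LipschitzOnWith.of_dist_le_mul fun x hx z hz => ?_
      have := hlip _ (hr x hx) _ (hr z hz)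
      rw [hrw x hx, hrw z hz] at this
      rw [Real.dist_eq, Real.dist_eq]
      push_cast
      exact this
    exact hL.continuousOn.continuousAt (Icc_mem_nhds hw'.1 hw'.2)
  refine HasDerivAt.of_local_left_inverse hrc (hasDerivAt_flightPhase1 ha (by linarith)) ?_ ?_
  · have := flightPhase2_le ha ha' hτ (A := r w) ⟨by linarith, hr7⟩
    linarith
  · filter_upwards [Icc_mem_nhds hw'.1 hw'.2] with x hx using hrw x hx

variable {n : ℝ} {r : ℝ → ℝ}

theorem hasDerivAt_critical_comp {p : ℝ}
    (h : HasDerivAt r (flightPhase2 a τ (r (p / n)))⁻¹ (p / n)) :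
    HasDerivAt (fun p => r (p / n)) (n * flightPhase2 a τ (r (p / n)))⁻¹ p := by
  have h1 : HasDerivAt (fun p : ℝ => p / n) (1 / n) p := (hasDerivAt_id p).div_const n
  exact (h.comp p h1).congr_deriv (by rw [mul_inv]; ring)

theorem hasDerivAt_critical_comp_deriv (ha : 0 < a) {p : ℝ} (hn : n ≠ 0) (hr : 0 < r (p / n))
    (hne : flightPhase2 a τ (r (p / n)) ≠ 0)
    (h : HasDerivAt r (flightPhase2 a τ (r (p / n)))⁻¹ (p / n)) :
    HasDerivAt (fun p => (n * flightPhase2 a τ (r (p / n)))⁻¹)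
      (flightPhase3 a τ (r (p / n)) / (-flightPhase2 a τ (r (p / n))) ^ 3 / n ^ 2) p := by
  have h1 := (hasDerivAt_flightPhase2 (τ := τ) ha hr).comp p (hasDerivAt_critical_comp h)
  have h2 := (h1.const_mul n).inv (mul_ne_zero hn hne)
  refine h2.congr_deriv ?_
  simp only [Function.comp]
  generalize flightPhase2 a τ (r (p / n)) = F at *
  have : (-F) ^ 3 = -F ^ 3 := by ring
  rw [this]
  field_simp

theorem flightPhase3_div_le (ha : 0 < a) (ha' : a ≤ 1 / 10 ^ 12) (hτ : |τ| ≤ 40) {A : ℝ}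
    (hA : A ∈ Set.Icc (3 / 4 : ℝ) 7) :
    flightPhase3 a τ A / (-flightPhase2 a τ A) ^ 3 ≤ 1 / 2 + 5 / 10 ^ 8 := by
  have hA0 : 0 < A := by linarith [hA.1]
  have h2 := abs_le.mp (abs_flightPhase2_add_le ha ha' hτ hA0)
  have h3 := abs_le.mp (abs_flightPhase3_sub_le ha ha' hτ hA0)
  have hs := Real.sqrt_pos.mpr hA0
  have u1 : √A ≤ 27 / 10 := by
    rw [Real.sqrt_le_left (by norm_num)]; norm_num; linarith [hA.2]
  have u2 : 86 / 100 ≤ √A := Real.le_sqrt_of_sq_le (by norm_num; linarith [hA.1])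
  have v1 : (27 / 10)⁻¹ ≤ (√A)⁻¹ := inv_anti₀ hs u1
  have v2 : (√A)⁻¹ ≤ (86 / 100)⁻¹ := inv_anti₀ (by norm_num) u2
  generalize (√A)⁻¹ = x at *
  generalize flightPhase2 a τ A = F at *
  generalize flightPhase3 a τ A = G at *
  norm_num at v1 v2
  have hF : x - 11 / 10 ^ 12 ≤ -F := by linarith [h2.2]
  have hx0 : 0 < x - 11 / 10 ^ 12 := by norm_num; linarith
  have hF3 : (x - 11 / 10 ^ 12) ^ 3 ≤ (-F) ^ 3 := by gcongr
  have hx3 : x ^ 3 - 5 * (11 / 10 ^ 12) ≤ (x - 11 / 10 ^ 12) ^ 3 := by nlinarith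
  have hxl : (10 / 27) ^ 3 ≤ x ^ 3 := by gcongr
  have hpos : 0 < (-F) ^ 3 := by have : 0 < -F := by linarith
                                 positivity
  rw [div_le_iff₀ hpos]
  norm_num at *
  linarith [h3.2]

theorem reducedPhase_of_critical (ha : 0 < a) (ha' : a ≤ 1 / 10 ^ 12) (hτ : |τ| ≤ 40)
    {ℓ v y α β : ℝ} {E : ℝ → ℝ} (hℓ : 1 ≤ ℓ) (hv : 0 < v) (hn : n = 1 ∨ n = -1 ∨ 2 ≤ |n|)
    (hnℓ : |n| ≤ 13 / 10 * ℓ) (hnv : 7 / 10 ≤ |n| * v ^ 6) (hvτ : |τ / 2 - 2| = v ^ 12)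
    (hα : 0 < α) (hβ : β ≤ 6)
    (hr : ∀ w ∈ Set.Icc (flightPhase1 a τ 7) (flightPhase1 a τ (3 / 4)),
      r w ∈ Set.Icc (3 / 4 : ℝ) 7 ∧ flightPhase1 a τ (r w) = w ∧
        HasDerivAt r (flightPhase2 a τ (r w))⁻¹ w)
    (hp : ∀ p ∈ Set.Icc α β, p / n ∈ Set.Icc (flightPhase1 a τ 7) (flightPhase1 a τ (3 / 4)))
    (hE : ∀ p ∈ Set.Icc α β, HasDerivAt E (ℓ ^ 3 * ((p - y / p) ^ 2 / 4 + 1 - r (p / n))) p) :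
    ReducedPhase ℓ v y n τ α β E (fun p => r (p / n))
      (fun p => (n * flightPhase2 a τ (r (p / n)))⁻¹)
      (fun p => flightPhase3 a τ (r (p / n)) / (-flightPhase2 a τ (r (p / n))) ^ 3 / n ^ 2) := by
  have hn0 : n ≠ 0 := by
    rintro rfl
    norm_num at hn
  have hn1 : 1 ≤ |n| := by
    rcases hn with h | h | h
    · simp [h]
    · simp [h]
    · linarith
  have key : ∀ p ∈ Set.Icc α β, r (p / n) ∈ Set.Icc (3 / 4 : ℝ) 7 := fun p h => (hr _ (hp p h)).1
  have pos : ∀ p ∈ Set.Icc α β, 0 < r (p / n) := fun p h => by linarith [(key p h).1]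
  have f2le : ∀ p ∈ Set.Icc α β, flightPhase2 a τ (r (p / n)) ≤ -(1 / 3) := fun p h =>
    flightPhase2_le ha ha' hτ ⟨by linarith [(key p h).1], (key p h).2⟩
  refine ⟨hℓ, hv, hn, hnℓ, hnv, hvτ, hα, hβ, hE,
    fun p h => hasDerivAt_critical_comp (hr _ (hp p h)).2.2,
    fun p h => hasDerivAt_critical_comp_deriv ha hn0 (pos p h) (by linarith [f2le p h])
      (hr _ (hp p h)).2.2,
    fun p h => ?_, fun p h => ?_, fun p h => ?_, fun p h => ?_, fun p h => ?_,
    fun p h => (key p h).1⟩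
  · have := f2le p h
    rw [abs_inv, abs_mul, abs_of_neg (show flightPhase2 a τ (r (p / n)) < 0 by linarith),
      inv_le_comm₀ (by nlinarith) (by positivity), inv_div]
    nlinarith
  · have := flightPhase3_div_le ha ha' hτ (key p h)
    gcongr
  · have h1 := (hr _ (hp p h)).2.1
    have h2 := flightPhase1_sub (τ := τ) ha (pos p h) one_pos
    rw [h1, flightPhase1_one ha] at h2
    rw [h2, abs_mul]
    have h3 := flightSlope_mem ha ha' hτ (A := r (p / n)) (r := 1)
      ⟨by linarith [(key p h).1], by linarith [(key p h).2]⟩ ⟨by norm_num, by norm_num⟩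
    have h4 : |flightSlope a τ 1 (r (p / n))| ≤ 2 := abs_le.mpr ⟨h3.1, by linarith [h3.2]⟩
    gcongr
  · have h1 := f2le p h
    have h2 := abs_flightPhase2_add_le ha ha' hτ (pos p h)
    have hs : 0 < √(r (p / n)) := Real.sqrt_pos.mpr (pos p h)
    have hs3 : √(r (p / n)) ≤ 3 := by
      rw [Real.sqrt_le_left (by norm_num)]; norm_num; linarith [(key p h).2]
    generalize flightPhase2 a τ (r (p / n)) = F at *
    generalize √(r (p / n)) = s at *
    have hF : F ≠ 0 := by linarith
    have e : (n * F)⁻¹ + s / n = s / (n * F) * (F + s⁻¹) := by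
      field_simp
      ring
    rw [e, abs_mul, abs_div, abs_mul, abs_of_pos hs]
    have h3 : 1 / 3 ≤ |n| * |F| := by
      rw [abs_of_neg (show F < 0 by linarith)]
      nlinarith
    calc s / (|n| * |F|) * |F + s⁻¹| ≤ 3 / (1 / 3) * (11 / 10 ^ 12) := by gcongr
      _ ≤ _ := by norm_num
  · have h1 := abs_le.mp (abs_flightPhase1_sub_le ha ha' hτ (pos p h) (by linarith [(key p h).2]))
    rw [(hr _ (hp p h)).2.1] at h1
    have e : p / (2 * n) = p / n / 2 := by field_simp
    rw [e, abs_le]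
    constructor <;> linarith [h1.1, h1.2]

end

/-- Functions with two derivatives on `[4/5, 13/2]`, all bounded by `K`. -/
def BoundedC2 (K : ℝ) (F : ℝ → ℝ) : Prop :=
  ∃ F1 F2 : ℝ → ℝ, ∀ A ∈ Set.Icc (4 / 5 : ℝ) (13 / 2),
    HasDerivAt F (F1 A) A ∧ HasDerivAt F1 (F2 A) A ∧ |F A| ≤ K ∧ |F1 A| ≤ K ∧ |F2 A| ≤ K

namespace BoundedC2

variable {F G : ℝ → ℝ} {K M : ℝ}

theorem nonneg (hF : BoundedC2 K F) : 0 ≤ K := by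
  obtain ⟨F1, F2, h⟩ := hF
  exact (abs_nonneg _).trans (h 1 ⟨by norm_num, by norm_num⟩).2.2.1

theorem mono (hF : BoundedC2 K F) (h : K ≤ M) : BoundedC2 M F := by
  obtain ⟨F1, F2, hF⟩ := hF
  refine ⟨F1, F2, fun A hA => ?_⟩
  obtain ⟨h1, h2, h3, h4, h5⟩ := hF A hA
  exact ⟨h1, h2, h3.trans h, h4.trans h, h5.trans h⟩

theorem const (c : ℝ) : BoundedC2 |c| (fun _ => c) :=
  ⟨fun _ => 0, fun _ => 0, fun A _ => ⟨hasDerivAt_const _ _, hasDerivAt_const _ _, le_rfl,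
    by simp, by simp⟩⟩

theorem add (hF : BoundedC2 K F) (hG : BoundedC2 M G) :
    BoundedC2 (K + M) (fun A => F A + G A) := by
  obtain ⟨F1, F2, hF⟩ := hF
  obtain ⟨G1, G2, hG⟩ := hG
  refine ⟨fun A => F1 A + G1 A, fun A => F2 A + G2 A, fun A hA => ?_⟩
  obtain ⟨h1, h2, h3, h4, h5⟩ := hF A hA
  obtain ⟨g1, g2, g3, g4, g5⟩ := hG A hA
  exact ⟨h1.add g1, h2.add g2, (abs_add_le _ _).trans (add_le_add h3 g3),
    (abs_add_le _ _).trans (add_le_add h4 g4), (abs_add_le _ _).trans (add_le_add h5 g5)⟩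

theorem mul (hF : BoundedC2 K F) (hG : BoundedC2 M G) :
    BoundedC2 (4 * (K * M)) (fun A => F A * G A) := by
  have hK := hF.nonneg
  have hM := hG.nonneg
  obtain ⟨F1, F2, hF⟩ := hF
  obtain ⟨G1, G2, hG⟩ := hG
  refine ⟨fun A => F1 A * G A + F A * G1 A,
    fun A => (F2 A * G A + F1 A * G1 A) + (F1 A * G1 A + F A * G2 A), fun A hA => ?_⟩
  obtain ⟨h1, h2, h3, h4, h5⟩ := hF A hA
  obtain ⟨g1, g2, g3, g4, g5⟩ := hG A hA
  have key : ∀ x y : ℝ, |x| ≤ K → |y| ≤ M → |x * y| ≤ K * M := fun x y hx hy => by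
    rw [abs_mul]; gcongr
  have hKM := mul_nonneg hK hM
  refine ⟨h1.mul g1, (h2.mul g1).add (h1.mul g2), ?_, ?_, ?_⟩
  · linarith [key _ _ h3 g3]
  · linarith [key _ _ h4 g3, key _ _ h3 g4, abs_add_le (F1 A * G A) (F A * G1 A)]
  · linarith [key _ _ h5 g3, key _ _ h3 g5, key _ _ h4 g4,
      abs_add_le (F2 A * G A + F1 A * G1 A) (F1 A * G1 A + F A * G2 A),
      abs_add_le (F2 A * G A) (F1 A * G1 A), abs_add_le (F1 A * G1 A) (F A * G2 A)]

theorem inv (hF : BoundedC2 K F) {c : ℝ} (hc : 0 < c) (hc1 : c ≤ 1) (hK : 1 ≤ K)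
    (h : ∀ A ∈ Set.Icc (4 / 5 : ℝ) (13 / 2), c ≤ |F A|) :
    BoundedC2 (3 * K ^ 2 / c ^ 3) (fun A => (F A)⁻¹) := by
  obtain ⟨F1, F2, hF⟩ := hF
  refine ⟨fun A => -F1 A / F A ^ 2, fun A => -F2 A / F A ^ 2 + 2 * F1 A ^ 2 / F A ^ 3,
    fun A hA => ?_⟩
  obtain ⟨h1, h2, h3, h4, h5⟩ := hF A hA
  have hcA := h A hA
  have hne : F A ≠ 0 := by
    intro h0
    rw [h0, abs_zero] at hcA
    linarith
  have c3 : c ^ 3 ≤ c := pow_le_of_le_one hc.le hc1 (by norm_num)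
  have c32 : c ^ 3 ≤ c ^ 2 := pow_le_pow_of_le_one hc.le hc1 (by norm_num)
  have hK2 : K ≤ K ^ 2 := by nlinarith
  have b2 : |-F2 A / F A ^ 2| ≤ K ^ 2 / c ^ 3 := by
    rw [abs_div, abs_neg, abs_pow]
    calc |F2 A| / |F A| ^ 2 ≤ K ^ 2 / c ^ 2 := by
          have := h5.trans hK2
          gcongr
      _ ≤ _ := by gcongr
  have b1 : |-F1 A / F A ^ 2| ≤ K ^ 2 / c ^ 3 := by
    rw [abs_div, abs_neg, abs_pow]
    calc |F1 A| / |F A| ^ 2 ≤ K ^ 2 / c ^ 2 := by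
          have := h4.trans hK2
          gcongr
      _ ≤ _ := by gcongr
  have b3 : |2 * F1 A ^ 2 / F A ^ 3| ≤ 2 * K ^ 2 / c ^ 3 := by
    rw [abs_div, abs_mul, abs_pow, abs_pow, abs_two]
    gcongr
  have b0 : |(F A)⁻¹| ≤ K ^ 2 / c ^ 3 := by
    rw [abs_inv, ← one_div]
    have : 1 ≤ K ^ 2 := by nlinarith
    have h6 := c3.trans hcA
    gcongr
  have hpos : 0 ≤ K ^ 2 / c ^ 3 := by positivity
  have e1 : 3 * K ^ 2 / c ^ 3 = 3 * (K ^ 2 / c ^ 3) := by ring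
  have e2 : 2 * K ^ 2 / c ^ 3 = 2 * (K ^ 2 / c ^ 3) := by ring
  rw [e2] at b3
  rw [e1]
  refine ⟨h1.inv hne, ?_, by linarith, by linarith, ?_⟩
  · refine (h2.neg.div (h1.pow 2) (pow_ne_zero 2 hne)).congr_deriv ?_
    simp only [Pi.neg_apply, Pi.pow_apply]
    field_simp
    norm_num
    ring
  · linarith [abs_add_le (-F2 A / F A ^ 2) (2 * F1 A ^ 2 / F A ^ 3)]

end BoundedC2

section

variable {a τ r : ℝ}

theorem boundedC2_sqrt : BoundedC2 3 (fun A => √A) := by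
  refine ⟨fun A => 1 / 2 * (√A)⁻¹, fun A => -(1 / 4) * (√A)⁻¹ ^ 3, fun A hA => ?_⟩
  have hA0 : 0 < A := by linarith [hA.1]
  have hs := Real.sqrt_pos.mpr hA0
  have u1 : √A ≤ 3 := by
    rw [Real.sqrt_le_left (by norm_num)]; norm_num; linarith [hA.2]
  have u2 : 1 / 2 ≤ √A := Real.le_sqrt_of_sq_le (by norm_num; linarith [hA.1])
  have u3 : (√A)⁻¹ ≤ 2 := by
    rw [inv_le_comm₀ hs (by norm_num)]
    linarith
  have hi : 0 < (√A)⁻¹ := by positivity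
  refine ⟨hasDerivAt_sqrt_pos hA0, ?_, by rwa [abs_of_pos hs], ?_, ?_⟩
  · refine (((hasDerivAt_sqrt_pos hA0).inv hs.ne').const_mul (1 / 2)).congr_deriv ?_
    field_simp
    ring
  · rw [abs_of_pos (by positivity)]; linarith
  · rw [abs_mul, abs_of_pos (show 0 < (√A)⁻¹ ^ 3 by positivity), abs_neg, abs_of_pos (by norm_num)]
    calc 1 / 4 * (√A)⁻¹ ^ 3 ≤ 1 / 4 * 2 ^ 3 := by gcongr
      _ ≤ 3 := by norm_num

theorem boundedC2_sqrt_one_add (ha : 0 < a) (ha' : a ≤ 1 / 10 ^ 12) :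
    BoundedC2 2 (fun A => √(1 + a * A)) := by
  refine ⟨fun A => a / 2 * (√(1 + a * A))⁻¹, fun A => -(a ^ 2 / 4) * (√(1 + a * A))⁻¹ ^ 3,
    fun A hA => ?_⟩
  have hA0 : 0 < A := by linarith [hA.1]
  have hs : 0 < √(1 + a * A) := Real.sqrt_pos.mpr (by positivity)
  obtain ⟨h2, h3⟩ := inv_sqrt_one_add_mem ha hA0
  have u1 : √(1 + a * A) ≤ 2 := by
    rw [Real.sqrt_le_left (by norm_num)]
    have : a * A ≤ 1 / 10 ^ 12 * (13 / 2) := by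
      have := hA.2
      gcongr
    norm_num at this ⊢
    linarith
  have ha1 : a ≤ 1 := ha'.trans (by norm_num)
  refine ⟨hasDerivAt_sqrt_one_add ha hA0, ?_, by rwa [abs_of_pos hs], ?_, ?_⟩
  · refine (((hasDerivAt_sqrt_one_add ha hA0).inv hs.ne').const_mul (a / 2)).congr_deriv ?_
    field_simp
    ring
  · rw [abs_of_pos (by positivity)]
    calc a / 2 * (√(1 + a * A))⁻¹ ≤ 1 / 2 * 1 := by gcongr
      _ ≤ 2 := by norm_num
  · rw [abs_mul, abs_neg, abs_of_pos (by positivity),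
      abs_of_pos (show 0 < (√(1 + a * A))⁻¹ ^ 3 by positivity)]
    calc a ^ 2 / 4 * (√(1 + a * A))⁻¹ ^ 3 ≤ 1 ^ 2 / 4 * 1 ^ 3 := by gcongr
      _ ≤ 2 := by norm_num

theorem boundedC2_flightSlope (ha : 0 < a) (ha' : a ≤ 1 / 10 ^ 12) (hτ : |τ| ≤ 40)
    (hr : r ∈ Set.Icc (3 / 4 : ℝ) 7) : BoundedC2 (10 ^ 5) (flightSlope a τ r) := by
  have hr0 : 0 < r := by linarith [hr.1]
  have hpos : ∀ A ∈ Set.Icc (4 / 5 : ℝ) (13 / 2), 0 < A := fun A h => by linarith [h.1]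
  have s1 : √r ≤ 3 := by
    rw [Real.sqrt_le_left (by norm_num)]; norm_num; linarith [hr.2]
  have s2 : 1 / 2 ≤ √r := Real.le_sqrt_of_sq_le (by norm_num; linarith [hr.1])
  have t1 := one_le_sqrt_one_add ha hr0
  have t2 : √(1 + a * r) ≤ 2 := by
    rw [Real.sqrt_le_left (by norm_num)]
    have : a * r ≤ 1 / 10 ^ 12 * 7 := by
      have := hr.2
      gcongr
    norm_num at this ⊢
    linarith
  have c1 : BoundedC2 (3 * 6 ^ 2 / 1 ^ 3) (fun A => (√A + √r)⁻¹) := by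
    refine ((boundedC2_sqrt.add (BoundedC2.const (√r))).mono ?_).inv one_pos le_rfl
      (by norm_num) fun A hA => ?_
    · rw [abs_of_nonneg (Real.sqrt_nonneg _)]; linarith
    · have u2 : 1 / 2 ≤ √A := Real.le_sqrt_of_sq_le (by norm_num; linarith [hA.1])
      rw [abs_of_pos (by linarith)]
      linarith
  have c2 : BoundedC2 (3 * 32 ^ 2 / 1 ^ 3)
      (fun A => (√(1 + a * A) * (√(1 + a * A) + √(1 + a * r)))⁻¹) := by
    refine (((boundedC2_sqrt_one_add ha ha').mul ((boundedC2_sqrt_one_add ha ha').add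
      (BoundedC2.const (√(1 + a * r))))).mono ?_).inv one_pos le_rfl
      (by norm_num) fun A hA => ?_
    · rw [abs_of_nonneg (Real.sqrt_nonneg _)]; linarith
    · have u2 := one_le_sqrt_one_add ha (hpos A hA)
      rw [abs_of_pos (by positivity)]
      nlinarith
  have h1 := abs_tau_mul_le ha ha' hτ
  obtain ⟨h2, h3⟩ := inv_sqrt_one_add_mem ha hr0
  have c3 := ((BoundedC2.const (-2)).mul c1).add
    ((BoundedC2.const (-(τ * √(1 + a) * a / 2 * (√(1 + a * r))⁻¹))).mul c2)
  have e : flightSlope a τ r = fun A => -2 * (√A + √r)⁻¹ +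
      -(τ * √(1 + a) * a / 2 * (√(1 + a * r))⁻¹) *
        (√(1 + a * A) * (√(1 + a * A) + √(1 + a * r)))⁻¹ := by
    funext A
    unfold flightSlope
    ring
  rw [e]
  refine c3.mono ?_
  have h4 : |-(τ * √(1 + a) * a / 2 * (√(1 + a * r))⁻¹)| ≤ 1 := by
    rw [abs_neg, abs_mul, abs_div, abs_two, abs_of_pos h2]
    calc |τ * √(1 + a) * a| / 2 * (√(1 + a * r))⁻¹ ≤ 41 / 10 ^ 12 / 2 * 1 := by gcongr
      _ ≤ 1 := by norm_num
  rw [abs_neg, abs_two]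
  norm_num at h4 ⊢
  linarith

theorem boundedC2_inv_flightSlope (ha : 0 < a) (ha' : a ≤ 1 / 10 ^ 12) (hτ : |τ| ≤ 40)
    (hr : r ∈ Set.Icc (3 / 4 : ℝ) 7) :
    BoundedC2 (10 ^ 13) (fun A => (flightSlope a τ r A)⁻¹) := by
  refine ((boundedC2_flightSlope ha ha' hτ hr).inv (c := 3 / 10) (by norm_num) (by norm_num)
    (by norm_num) fun A hA => ?_).mono (by norm_num)
  have := flightSlope_mem ha ha' hτ (A := A) (r := r) ⟨by linarith [hA.1], by linarith [hA.2]⟩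
    ⟨by linarith [hr.1], by linarith [hr.2]⟩
  rw [abs_of_neg (by linarith [this.2])]
  linarith [this.2]

/-- A smooth function supported in `[9/10, 6]` is bounded with two derivatives. -/
theorem exists_boundedC2_of_contDiff {g : ℝ → ℝ} (hg : ContDiff ℝ (⊤ : ℕ∞) g) :
    ∃ K, BoundedC2 K g := by
  have h1 : ContDiff ℝ (⊤ : ℕ∞) (deriv g) := (contDiff_infty_iff_deriv.mp hg).2
  have h2 : ContDiff ℝ (⊤ : ℕ∞) (deriv (deriv g)) := (contDiff_infty_iff_deriv.mp h1).2
  obtain ⟨C0, hC0⟩ := (isCompact_Icc (a := (4 / 5 : ℝ)) (b := 13 / 2)).exists_bound_of_continuousOn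
    hg.continuous.continuousOn
  obtain ⟨C1, hC1⟩ := (isCompact_Icc (a := (4 / 5 : ℝ)) (b := 13 / 2)).exists_bound_of_continuousOn
    h1.continuous.continuousOn
  obtain ⟨C2, hC2⟩ := (isCompact_Icc (a := (4 / 5 : ℝ)) (b := 13 / 2)).exists_bound_of_continuousOn
    h2.continuous.continuousOn
  refine ⟨max C0 (max C1 C2), deriv g, deriv (deriv g), fun A hA => ⟨?_, ?_, ?_, ?_, ?_⟩⟩
  · exact (hg.differentiable (by norm_num) A).hasDerivAt
  · exact (h1.differentiable (by norm_num) A).hasDerivAt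
  · exact (hC0 A hA).trans (le_max_left _ _)
  · exact (hC1 A hA).trans ((le_max_left _ _).trans (le_max_right _ _))
  · exact (hC2 A hA).trans ((le_max_right _ _).trans (le_max_right _ _))

end

/-- A complex weight on `[4/5, 13/2]` with modulus at most one and derivative at most `B`. -/
structure SlowWeight (B : ℝ) (β β' : ℝ → ℂ) : Prop where
  deriv : ∀ A ∈ Set.Icc (4 / 5 : ℝ) (13 / 2), HasDerivAt β (β' A) A
  bound : ∀ A ∈ Set.Icc (4 / 5 : ℝ) (13 / 2), ‖β A‖ ≤ 1
  bound' : ∀ A ∈ Set.Icc (4 / 5 : ℝ) (13 / 2), ‖β' A‖ ≤ B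

/-- The phase of the `A`-integral at frequency `p`. -/
noncomputable def fiberPhase (a τ n Λ p A : ℝ) : ℝ :=
  Λ * (n * flightPhase a τ A - A * p)

/-- The `A`-integral with amplitude `c`. -/
noncomputable def fiberInt (a τ n Λ : ℝ) (c : ℝ → ℂ) (p : ℝ) : ℂ :=
  ∫ A in (4 / 5 : ℝ)..(13 / 2), c A * cis (fiberPhase a τ n Λ p A)

section

variable {a τ n Λ p B K : ℝ} {β β' : ℝ → ℂ}

theorem SlowWeight.nonneg (h : SlowWeight B β β') : 0 ≤ B :=
  (norm_nonneg _).trans (h.bound' 1 ⟨by norm_num, by norm_num⟩)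

theorem hasDerivAt_fiberPhase (ha : 0 < a) {A : ℝ} (hA : 0 < A) :
    HasDerivAt (fiberPhase a τ n Λ p) (Λ * (n * flightPhase1 a τ A - p)) A := by
  have h := (((hasDerivAt_flightPhase (τ := τ) ha hA).const_mul n).sub
    ((hasDerivAt_id A).mul_const p)).const_mul Λ
  exact h.congr_deriv (by ring)

theorem hasDerivAt_fiberPhase1 (ha : 0 < a) {A : ℝ} (hA : 0 < A) :
    HasDerivAt (fun A => Λ * (n * flightPhase1 a τ A - p)) (Λ * (n * flightPhase2 a τ A)) A :=
  (((hasDerivAt_flightPhase1 (τ := τ) ha hA).const_mul n).sub_const p).const_mul Λ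

theorem continuousOn_cis_fiberPhase (ha : 0 < a) :
    ContinuousOn (fun A => cis (fiberPhase a τ n Λ p A)) (Set.Icc (4 / 5) (13 / 2)) :=
  continuous_cis.comp_continuousOn fun A hA =>
    (hasDerivAt_fiberPhase ha (show 0 < A by linarith [hA.1])).continuousAt.continuousWithinAt

theorem norm_integral_cis_fiberPhase_le (ha : 0 < a) (ha' : a ≤ 1 / 10 ^ 12) (hτ : |τ| ≤ 40)
    (hn : n ≠ 0) (hΛ : 0 < Λ) {t : ℝ} (ht : t ∈ Set.Icc (4 / 5 : ℝ) (13 / 2)) :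
    ‖∫ A in (4 / 5 : ℝ)..t, cis (fiberPhase a τ n Λ p A)‖ ≤ 14 / √(Λ * |n|) := by
  have hpos : ∀ A ∈ Set.Icc (4 / 5 : ℝ) t, 0 < A := fun A h => by linarith [h.1]
  have hn' : 0 < |n| := abs_pos.mpr hn
  have hκ : 0 < Λ * |n| / 3 := by positivity
  have hs : 0 < √(Λ * |n|) := Real.sqrt_pos.mpr (by positivity)
  have hle : 8 / √(Λ * |n| / 3) ≤ 14 / √(Λ * |n|) := by
    have h3 : √3 ≤ 7 / 4 := by rw [Real.sqrt_le_left (by norm_num)]; norm_num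
    rw [Real.sqrt_div (by positivity), div_div_eq_mul_div]
    gcongr
    linarith
  have hf : ∀ A ∈ Set.Icc (4 / 5 : ℝ) t, flightPhase2 a τ A ≤ -(1 / 3) := fun A hA =>
    flightPhase2_le ha ha' hτ ⟨by linarith [hA.1], by linarith [hA.2, ht.2]⟩
  have hcont : ContinuousOn (fun A => Λ * (n * flightPhase2 a τ A)) (Set.Icc (4 / 5) t) := fun A hA =>
    ((hasDerivAt_flightPhase2 (τ := τ) ha (hpos A hA)).continuousAt.continuousWithinAt.const_smul
      n).const_smul Λ
  refine le_trans ?_ hle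
  rcases lt_or_gt_of_ne hn with h | h
  · refine vdc_second ht.1 hκ (fun A hA => hasDerivAt_fiberPhase ha (hpos A hA))
      (fun A hA => hasDerivAt_fiberPhase1 ha (hpos A hA)) hcont fun A hA => ?_
    rw [abs_of_neg h]
    have h1 : (-n) / 3 ≤ n * flightPhase2 a τ A := by nlinarith [hf A hA]
    have := mul_le_mul_of_nonneg_left h1 hΛ.le
    linarith
  · refine vdc_second_neg ht.1 hκ (fun A hA => hasDerivAt_fiberPhase ha (hpos A hA))
      (fun A hA => hasDerivAt_fiberPhase1 ha (hpos A hA)) hcont fun A hA => ?_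
    rw [abs_of_pos h]
    have h1 : n * flightPhase2 a τ A ≤ -(n / 3) := by nlinarith [hf A hA]
    have := mul_le_mul_of_nonneg_left h1 hΛ.le
    linarith

variable {φ φ1 : ℝ → ℝ}

theorem SlowWeight.hasDerivAt_mul (hβ : SlowWeight B β β') {A : ℝ}
    (hA : A ∈ Set.Icc (4 / 5 : ℝ) (13 / 2)) (hφ : HasDerivAt φ (φ1 A) A) :
    HasDerivAt (fun A => (φ A : ℂ) * β A) ((φ1 A : ℂ) * β A + φ A * β' A) A :=
  hφ.ofReal_comp.mul (hβ.deriv A hA)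

theorem SlowWeight.norm_mul_le (hβ : SlowWeight B β β') {A : ℝ}
    (hA : A ∈ Set.Icc (4 / 5 : ℝ) (13 / 2)) (h0 : |φ A| ≤ K) : ‖(φ A : ℂ) * β A‖ ≤ K := by
  rw [norm_mul, Complex.norm_real, Real.norm_eq_abs]
  calc |φ A| * ‖β A‖ ≤ K * 1 := by
        have := hβ.bound A hA
        have := (abs_nonneg _).trans h0
        gcongr
    _ = K := mul_one K

theorem SlowWeight.norm_mul_deriv_le (hβ : SlowWeight B β β') {A : ℝ}
    (hA : A ∈ Set.Icc (4 / 5 : ℝ) (13 / 2)) (h0 : |φ A| ≤ K) (h1 : |φ1 A| ≤ K) :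
    ‖(φ1 A : ℂ) * β A + φ A * β' A‖ ≤ K * (1 + B) := by
  refine (norm_add_le _ _).trans ?_
  have e1 := hβ.norm_mul_le hA h1
  have e2 : ‖(φ A : ℂ) * β' A‖ ≤ K * B := by
    rw [norm_mul, Complex.norm_real, Real.norm_eq_abs]
    have := hβ.bound' A hA
    have := (abs_nonneg _).trans h0
    gcongr
  linarith

theorem norm_fiberInt_le (ha : 0 < a) (ha' : a ≤ 1 / 10 ^ 12) (hτ : |τ| ≤ 40)
    (hn : n ≠ 0) (hΛ : 0 < Λ) (hβ : SlowWeight B β β')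
    (hφ : ∀ A ∈ Set.Icc (4 / 5 : ℝ) (13 / 2), HasDerivAt φ (φ1 A) A ∧ |φ A| ≤ K ∧ |φ1 A| ≤ K) :
    ‖fiberInt a τ n Λ (fun A => (φ A : ℂ) * β A) p‖ ≤ 100 * (K * (1 + B)) / √(Λ * |n|) := by
  have hB := hβ.nonneg
  have hK : 0 ≤ K := (abs_nonneg _).trans (hφ 1 ⟨by norm_num, by norm_num⟩).2.1
  have key := norm_integral_amplitude_le (a := 4 / 5) (b := 13 / 2) (by norm_num)
    (continuousOn_cis_fiberPhase (τ := τ) (n := n) (Λ := Λ) (p := p) ha)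
    (c := fun A => (φ A : ℂ) * β A) (g := fun _ => K * (1 + B))
    (fun A hA => hβ.hasDerivAt_mul hA (hφ A hA).1)
    (fun A hA => hβ.norm_mul_deriv_le hA (hφ A hA).2.1 (hφ A hA).2.2) (by simp)
    (fun t ht => norm_integral_cis_fiberPhase_le ha ha' hτ hn hΛ ht)
  refine key.trans ?_
  have h1 := hβ.norm_mul_le (A := 13 / 2) ⟨by norm_num, le_rfl⟩
    (hφ (13 / 2) ⟨by norm_num, le_rfl⟩).2.1
  rw [intervalIntegral.integral_const, smul_eq_mul]
  have hs : 0 < √(Λ * |n|) := Real.sqrt_pos.mpr (by have := abs_pos.mpr hn; positivity)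
  rw [div_mul_eq_mul_div]
  refine div_le_div_of_nonneg_right ?_ hs.le
  nlinarith [mul_nonneg hK hB]

theorem norm_fiberInt_le_of_ne_zero (ha : 0 < a) (hn : n ≠ 0) (hΛ : 0 < Λ)
    (hβ : SlowWeight B β β')
    (hφ : ∀ A ∈ Set.Icc (4 / 5 : ℝ) (13 / 2), HasDerivAt φ (φ1 A) A ∧ |φ A| ≤ K ∧ |φ1 A| ≤ K)
    (hφa : φ (4 / 5) = 0) (hφb : φ (13 / 2) = 0) {M μ : ℝ} (hμ : 0 < μ)
    (h1 : ∀ A ∈ Set.Icc (4 / 5 : ℝ) (13 / 2), μ ≤ |flightPhase1 a τ A - p / n|)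
    (h2 : ∀ A ∈ Set.Icc (4 / 5 : ℝ) (13 / 2), |flightPhase2 a τ A| ≤ M * μ) :
    ‖fiberInt a τ n Λ (fun A => (φ A : ℂ) * β A) p‖ ≤
      6 * (K * (1 + B + M)) / (Λ * |n| * μ) := by
  have hpos : ∀ A ∈ Set.Icc (4 / 5 : ℝ) (13 / 2), 0 < A := fun A h => by linarith [h.1]
  have hB := hβ.nonneg
  have hK : 0 ≤ K := (abs_nonneg _).trans (hφ 1 ⟨by norm_num, by norm_num⟩).2.1
  have hn' : 0 < |n| := abs_pos.mpr hn
  have e1 : ∀ A, Λ * (n * flightPhase1 a τ A - p) = Λ * (n * (flightPhase1 a τ A - p / n)) :=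
    fun A => by field_simp
  have hM : 0 ≤ M := nonneg_of_mul_nonneg_left ((abs_nonneg _).trans (h2 1
    ⟨by norm_num, by norm_num⟩)) hμ
  have hlow : ∀ A ∈ Set.Icc (4 / 5 : ℝ) (13 / 2),
      Λ * |n| * μ ≤ |Λ * (n * flightPhase1 a τ A - p)| := fun A hA => by
    rw [e1, abs_mul, abs_mul, abs_of_pos hΛ, ← mul_assoc]
    have := h1 A hA
    gcongr
  have hD : 0 < Λ * |n| * μ := by positivity
  have hcont : ContinuousOn (fun A => Λ * (n * flightPhase2 a τ A)) (Set.Icc (4 / 5) (13 / 2)) :=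
    fun A hA => ((hasDerivAt_flightPhase2 (τ := τ) ha
      (hpos A hA)).continuousAt.continuousWithinAt.const_smul n).const_smul Λ
  have key := norm_integral_osc_le_of_ne_zero (a := 4 / 5) (b := 13 / 2) (by norm_num)
    (c := fun A => (φ A : ℂ) * β A) (fun A hA => hasDerivAt_fiberPhase (τ := τ) (n := n) (Λ := Λ)
      (p := p) ha (hpos A hA))
    (fun A hA => hasDerivAt_fiberPhase1 ha (hpos A hA))
    (fun A hA => hβ.hasDerivAt_mul hA (hφ A hA).1)
    (fun A hA h0 => by
      have := hlow A hA
      rw [h0, abs_zero] at this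
      linarith) hcont
    (intervalIntegrable_deriv_of_norm_le (by norm_num)
      (fun A hA => hβ.hasDerivAt_mul hA (hφ A hA).1)
      (fun A hA => hβ.norm_mul_deriv_le hA (hφ A hA).2.1 (hφ A hA).2.2)
      (g := fun _ => K * (1 + B)) (by simp))
  refine key.trans ?_
  rw [hφa, hφb]
  simp only [Complex.ofReal_zero, zero_mul, norm_zero, zero_div, zero_add]
  have hbd : ∀ A ∈ Set.Icc (4 / 5 : ℝ) (13 / 2),
      ‖(φ1 A : ℂ) * β A + φ A * β' A‖ / |Λ * (n * flightPhase1 a τ A - p)| +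
        ‖(φ A : ℂ) * β A‖ * |Λ * (n * flightPhase2 a τ A)| / (Λ * (n * flightPhase1 a τ A - p)) ^ 2
      ≤ K * (1 + B + M) / (Λ * |n| * μ) := fun A hA => by
    have b1 : ‖(φ1 A : ℂ) * β A + φ A * β' A‖ / |Λ * (n * flightPhase1 a τ A - p)| ≤
        K * (1 + B) / (Λ * |n| * μ) := by
      have := hβ.norm_mul_deriv_le hA (hφ A hA).2.1 (hφ A hA).2.2
      have := hlow A hA
      gcongr
    have b2 : ‖(φ A : ℂ) * β A‖ * |Λ * (n * flightPhase2 a τ A)| /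
        (Λ * (n * flightPhase1 a τ A - p)) ^ 2 ≤ K * (Λ * |n| * (M * μ)) / (Λ * |n| * μ) ^ 2 := by
      rw [← sq_abs (Λ * (n * flightPhase1 a τ A - p)), abs_mul Λ (n * _), abs_mul n,
        abs_of_pos hΛ, ← mul_assoc Λ |n|]
      have t1 := hβ.norm_mul_le hA (hφ A hA).2.1
      have t2 := hlow A hA
      have t3 := h2 A hA
      gcongr
    have e : K * (Λ * |n| * (M * μ)) / (Λ * |n| * μ) ^ 2 = K * M / (Λ * |n| * μ) := by
      field_simp
    rw [e] at b2
    calc _ ≤ K * (1 + B) / (Λ * |n| * μ) + K * M / (Λ * |n| * μ) := add_le_add b1 b2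
      _ = _ := by ring
  have hI := intervalIntegral.norm_integral_le_of_norm_le_const (a := 4 / 5) (b := 13 / 2)
    (f := fun A => ‖(φ1 A : ℂ) * β A + φ A * β' A‖ / |Λ * (n * flightPhase1 a τ A - p)| +
        ‖(φ A : ℂ) * β A‖ * |Λ * (n * flightPhase2 a τ A)| /
          (Λ * (n * flightPhase1 a τ A - p)) ^ 2)
    (C := K * (1 + B + M) / (Λ * |n| * μ)) (fun A hA => by
      rw [Set.uIoc_of_le (by norm_num)] at hA
      rw [Real.norm_of_nonneg (by positivity)]
      exact hbd A (Set.Ioc_subset_Icc_self hA))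
  refine (Real.le_norm_self _).trans (hI.trans ?_)
  have : 0 ≤ K * (1 + B + M) / (Λ * |n| * μ) := by positivity
  have e57 : |(13 / 2 - 4 / 5 : ℝ)| = 57 / 10 := by norm_num
  rw [e57, mul_div_assoc 6]
  linarith

end

/-- The critical value of `fiberPhase`, where `r` inverts `flightPhase1`. -/
noncomputable def criticalPhase (a τ n Λ : ℝ) (r : ℝ → ℝ) (p : ℝ) : ℝ :=
  fiberPhase a τ n Λ p (r (p / n))

section

variable {a τ n Λ p B K : ℝ} {β β' : ℝ → ℂ} {φ : ℝ → ℝ} {r : ℝ → ℝ}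

theorem hasDerivAt_fiberInt (ha : 0 < a) {c : ℝ → ℂ}
    (hc : ContinuousOn c (Set.Icc (4 / 5) (13 / 2))) :
    HasDerivAt (fiberInt a τ n Λ c) (∫ A in (4 / 5 : ℝ)..(13 / 2),
      c A * (Complex.I * ((-(Λ * A) : ℝ) : ℂ) * cis (fiberPhase a τ n Λ p A))) p := by
  refine hasDerivAt_intervalIntegral_of_continuousOn (by norm_num) one_pos
    (F := fun p A => c A * cis (fiberPhase a τ n Λ p A))
    (F' := fun p A => c A * (Complex.I * ((-(Λ * A) : ℝ) : ℂ) * cis (fiberPhase a τ n Λ p A)))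
    (fun q _ => hc.mul (continuousOn_cis_fiberPhase ha)) ?_ fun q _ A _ => ?_
  · have h1 : ContinuousOn (fun z : ℝ × ℝ => c z.2)
        (Set.Icc (p - 1) (p + 1) ×ˢ Set.Icc (4 / 5) (13 / 2)) :=
      hc.comp continuousOn_snd fun z hz => hz.2
    have h2 : ContinuousOn (fun z : ℝ × ℝ => flightPhase a τ z.2)
        (Set.Icc (p - 1) (p + 1) ×ˢ Set.Icc (4 / 5) (13 / 2)) :=
      ContinuousOn.comp (t := Set.Icc (4 / 5) (13 / 2)) (g := flightPhase a τ)
        (fun A hA => (hasDerivAt_flightPhase ha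
          (show 0 < A by linarith [hA.1])).continuousAt.continuousWithinAt)
        continuousOn_snd fun z hz => hz.2
    have h3 : ContinuousOn (fun z : ℝ × ℝ => cis (fiberPhase a τ n Λ z.1 z.2))
        (Set.Icc (p - 1) (p + 1) ×ˢ Set.Icc (4 / 5) (13 / 2)) := by
      refine continuous_cis.comp_continuousOn ?_
      unfold fiberPhase
      fun_prop
    have h4 : Continuous fun z : ℝ × ℝ => Complex.I * ((-(Λ * z.2) : ℝ) : ℂ) := by fun_prop
    exact h1.mul (h4.continuousOn.mul h3)
  · have h1 : HasDerivAt (fun q => fiberPhase a τ n Λ q A) (-(Λ * A)) q := by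
      have := (((hasDerivAt_id q).const_mul A).const_sub (n * flightPhase a τ A)).const_mul Λ
      exact this.congr_deriv (by ring)
    exact (hasDerivAt_cis h1).const_mul (c A)

theorem hasDerivAt_criticalPhase (ha : 0 < a) (hn : n ≠ 0) (hr0 : 0 < r (p / n))
    (hr1 : flightPhase1 a τ (r (p / n)) = p / n)
    (hr2 : HasDerivAt r (flightPhase2 a τ (r (p / n)))⁻¹ (p / n)) :
    HasDerivAt (criticalPhase a τ n Λ r) (-(Λ * r (p / n))) p := by
  have h1 := hasDerivAt_critical_comp hr2
  have h2 := (hasDerivAt_flightPhase (τ := τ) ha hr0).comp p h1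
  have h3 := ((h2.const_mul n).sub (h1.mul (hasDerivAt_id p))).const_mul Λ
  refine h3.congr_deriv ?_
  simp only [id]
  rw [hr1]
  field_simp
  ring

theorem norm_fiberInt_deriv_le (ha : 0 < a) (ha' : a ≤ 1 / 10 ^ 12) (hτ : |τ| ≤ 40)
    (hn : n ≠ 0) (hΛ : 0 < Λ) (hβ : SlowWeight B β β') (hφ : BoundedC2 K φ)
    (hφa : φ (4 / 5) = 0) (hφb : φ (13 / 2) = 0) {s : ℝ} (hs : s ∈ Set.Icc (3 / 4 : ℝ) 7)
    (hsp : flightPhase1 a τ s = p / n) :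
    ‖∫ A in (4 / 5 : ℝ)..(13 / 2), (φ A * β A) *
        (Complex.I * ((Λ * (s - A) : ℝ) : ℂ) * cis (fiberPhase a τ n Λ p A))‖ ≤
      (4 * (K * 10 ^ 13)) * (100 * (1 + B) / √(Λ * |n|) + 6 * B) / |n| := by
  have hψ := hφ.mul (boundedC2_inv_flightSlope ha ha' hτ hs)
  set K' := 4 * (K * 10 ^ 13) with hK'
  have hK0 := hψ.nonneg
  obtain ⟨ψ1, ψ2, hψ⟩ := hψ
  set ψ : ℝ → ℝ := fun A => φ A * (flightSlope a τ s A)⁻¹ with hψdef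
  have hpos : ∀ A ∈ Set.Icc (4 / 5 : ℝ) (13 / 2), 0 < A := fun A h => by linarith [h.1]
  have hI : Set.uIcc (4 / 5 : ℝ) (13 / 2) = Set.Icc (4 / 5) (13 / 2) :=
    Set.uIcc_of_le (by norm_num)
  set e : ℝ → ℂ := fun A => cis (fiberPhase a τ n Λ p A) with he
  have hec : ContinuousOn e (Set.uIcc (4 / 5) (13 / 2)) := by
    rw [hI]; exact continuousOn_cis_fiberPhase ha
  have hβi : IntervalIntegrable β' MeasureTheory.volume (4 / 5) (13 / 2) :=
    intervalIntegrable_deriv_of_norm_le (by norm_num) hβ.deriv hβ.bound' (g := fun _ => B) (by simp)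
  have hβc : ContinuousOn β (Set.uIcc (4 / 5) (13 / 2)) := by
    rw [hI]; exact fun A hA => (hβ.deriv A hA).continuousAt.continuousWithinAt
  have hψc : ContinuousOn (fun A => (ψ A : ℂ)) (Set.uIcc (4 / 5) (13 / 2)) := by
    rw [hI]; exact fun A hA => (hψ A hA).1.ofReal_comp.continuousAt.continuousWithinAt
  have hψ1c : ContinuousOn (fun A => (ψ1 A : ℂ)) (Set.uIcc (4 / 5) (13 / 2)) := by
    rw [hI]; exact fun A hA => (hψ A hA).2.1.ofReal_comp.continuousAt.continuousWithinAt
  have hφc : ContinuousOn (fun A => (φ A : ℂ)) (Set.uIcc (4 / 5) (13 / 2)) := by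
    obtain ⟨φ1, φ2, hφ⟩ := hφ
    rw [hI]; exact fun A hA => (hφ A hA).1.ofReal_comp.continuousAt.continuousWithinAt
  set D : ℝ → ℂ := fun A => (φ A * β A) * (Complex.I * ((Λ * (s - A) : ℝ) : ℂ) * e A) with hD
  have hDc : ContinuousOn D (Set.uIcc (4 / 5) (13 / 2)) := by fun_prop
  have hder : ∀ A ∈ Set.uIcc (4 / 5 : ℝ) (13 / 2), HasDerivAt (fun A => (ψ A * β A) * e A)
      (((ψ1 A * β A) * e A + (ψ A : ℂ) * e A * β' A) - (n : ℂ) * D A) A := by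
    intro A hA
    rw [hI] at hA
    have h1 := hasDerivAt_cis (hasDerivAt_fiberPhase (τ := τ) (n := n) (Λ := Λ) (p := p) ha
      (hpos A hA))
    refine ((hβ.hasDerivAt_mul hA (hψ A hA).1).mul h1).congr_deriv ?_
    have hκ := flightSlope_mem ha ha' hτ (A := A) (r := s) ⟨by linarith [hA.1], by linarith [hA.2]⟩
      ⟨by linarith [hs.1], by linarith [hs.2]⟩
    have hκ0 : flightSlope a τ s A ≠ 0 := by linarith [hκ.2]
    have e1 : ψ A * (Λ * (n * flightPhase1 a τ A - p)) = -(n * (φ A * (Λ * (s - A)))) := by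
      have h2 := flightPhase1_sub (τ := τ) ha (hpos A hA) (show 0 < s by linarith [hs.1])
      rw [hsp] at h2
      have h3 : n * flightPhase1 a τ A - p = n * (flightSlope a τ s A * (A - s)) := by
        rw [← h2]; field_simp
      rw [h3, hψdef]
      field_simp
      ring
    have e2 : (ψ A : ℂ) * ((Λ * (n * flightPhase1 a τ A - p) : ℝ) : ℂ) =
        -((n : ℂ) * ((φ A : ℂ) * ((Λ * (s - A) : ℝ) : ℂ))) := by exact_mod_cast e1
    change _ = ((ψ1 A * β A) * e A + (ψ A : ℂ) * e A * β' A) - (n : ℂ) * ((φ A * β A) *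
      (Complex.I * ((Λ * (s - A) : ℝ) : ℂ) * e A))
    change ((ψ1 A : ℂ) * β A + ψ A * β' A) * e A + (ψ A * β A) *
      (Complex.I * ((Λ * (n * flightPhase1 a τ A - p) : ℝ) : ℂ) * e A) = _
    linear_combination Complex.I * β A * e A * e2
  have i1 : IntervalIntegrable (fun A => (ψ1 A * β A) * e A) MeasureTheory.volume (4 / 5) (13 / 2) :=
    ((hψ1c.mul hβc).mul hec).intervalIntegrable
  have i2 : IntervalIntegrable (fun A => (ψ A : ℂ) * e A * β' A) MeasureTheory.volume (4 / 5) (13 / 2) :=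
    hβi.continuousOn_mul (hψc.mul hec)
  have i3 : IntervalIntegrable (fun A => (n : ℂ) * D A) MeasureTheory.volume (4 / 5) (13 / 2) :=
    (continuousOn_const.mul hDc).intervalIntegrable
  have hFTC := intervalIntegral.integral_eq_sub_of_hasDerivAt hder ((i1.add i2).sub i3)
  have hψa : ψ (4 / 5) = 0 := by simp [hψdef, hφa]
  have hψb : ψ (13 / 2) = 0 := by simp [hψdef, hφb]
  rw [hψa, hψb, intervalIntegral.integral_sub (i1.add i2) i3, intervalIntegral.integral_add i1 i2,
    intervalIntegral.integral_const_mul] at hFTC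
  simp only [Complex.ofReal_zero, zero_mul, sub_zero] at hFTC
  have hn' : 0 < |n| := abs_pos.mpr hn
  rw [le_div_iff₀ hn']
  have e3 : ‖∫ A in (4 / 5 : ℝ)..(13 / 2), D A‖ * |n| =
      ‖(∫ A in (4 / 5 : ℝ)..(13 / 2), (ψ1 A * β A) * e A) +
        ∫ A in (4 / 5 : ℝ)..(13 / 2), (ψ A : ℂ) * e A * β' A‖ := by
    rw [sub_eq_zero.mp hFTC, norm_mul, Complex.norm_real, Real.norm_eq_abs, mul_comm]
  change ‖∫ A in (4 / 5 : ℝ)..(13 / 2), D A‖ * |n| ≤ _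
  rw [e3]
  refine (norm_add_le _ _).trans ?_
  have b1 := norm_fiberInt_le (φ := ψ1) (φ1 := ψ2) (K := K') (p := p) ha ha' hτ hn hΛ hβ
    fun A hA => ⟨(hψ A hA).2.1, (hψ A hA).2.2.2⟩
  have b2 : ‖∫ A in (4 / 5 : ℝ)..(13 / 2), (ψ A : ℂ) * e A * β' A‖ ≤
      K' * B * |13 / 2 - 4 / 5| := by
    refine intervalIntegral.norm_integral_le_of_norm_le_const fun A hA => ?_
    rw [Set.uIoc_of_le (by norm_num)] at hA
    have hA' := Set.Ioc_subset_Icc_self hA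
    rw [norm_mul, norm_mul, Complex.norm_real, Real.norm_eq_abs, he, norm_cis, mul_one]
    have := hβ.bound' A hA'
    have := (hψ A hA').2.2.1
    gcongr
  have e57 : |(13 / 2 - 4 / 5 : ℝ)| = 57 / 10 := by norm_num
  rw [e57] at b2
  have := mul_nonneg hK0 hβ.nonneg
  calc _ ≤ 100 * (K' * (1 + B)) / √(Λ * |n|) + K' * B * (57 / 10) := add_le_add b1 b2
    _ ≤ 100 * (K' * (1 + B)) / √(Λ * |n|) + K' * B * 6 := by gcongr; norm_num
    _ = _ := by ring

/-- Removing the critical phase from the `A`-integral makes it slowly varying. -/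
theorem exists_hasDerivAt_demodulated (ha : 0 < a) (ha' : a ≤ 1 / 10 ^ 12) (hτ : |τ| ≤ 40)
    (hn : n ≠ 0) (hΛ : 0 < Λ) (hβ : SlowWeight B β β') (hφ : BoundedC2 K φ)
    (hφa : φ (4 / 5) = 0) (hφb : φ (13 / 2) = 0)
    (hs : r (p / n) ∈ Set.Icc (3 / 4 : ℝ) 7) (hr1 : flightPhase1 a τ (r (p / n)) = p / n)
    (hr2 : HasDerivAt r (flightPhase2 a τ (r (p / n)))⁻¹ (p / n)) :
    ∃ h', HasDerivAt (fun p => cis (-criticalPhase a τ n Λ r p) *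
        fiberInt a τ n Λ (fun A => (φ A : ℂ) * β A) p) h' p ∧
      ‖h'‖ ≤ (4 * (K * 10 ^ 13)) * (100 * (1 + B) / √(Λ * |n|) + 6 * B) / |n| := by
  have hc : ContinuousOn (fun A => (φ A : ℂ) * β A) (Set.Icc (4 / 5) (13 / 2)) := by
    obtain ⟨φ1, φ2, hφ⟩ := hφ
    exact fun A hA => (hβ.hasDerivAt_mul hA (hφ A hA).1).continuousAt.continuousWithinAt
  have h1 := hasDerivAt_cis (hasDerivAt_criticalPhase (Λ := Λ) ha hn (by linarith [hs.1])
    hr1 hr2).fun_neg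
  have h2 := h1.mul (hasDerivAt_fiberInt (τ := τ) (n := n) (Λ := Λ) (p := p) ha hc)
  refine ⟨_, h2, ?_⟩
  have key := norm_fiberInt_deriv_le ha ha' hτ hn hΛ hβ hφ hφa hφb hs hr1
  refine le_trans (le_of_eq ?_) key
  have e1 : ∀ x y z : ℂ, ∀ t : ℝ, x * cis t * y + cis t * z = cis t * (x * y + z) :=
    fun x y z t => by ring
  rw [e1, norm_mul, norm_cis, one_mul]
  congr 1
  have hec := continuousOn_cis_fiberPhase (τ := τ) (n := n) (Λ := Λ) (p := p) ha
  have hI : Set.uIcc (4 / 5 : ℝ) (13 / 2) = Set.Icc (4 / 5) (13 / 2) :=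
    Set.uIcc_of_le (by norm_num)
  rw [fiberInt, ← intervalIntegral.integral_const_mul, ← intervalIntegral.integral_add]
  · refine intervalIntegral.integral_congr fun A _ => ?_
    push_cast
    ring
  · refine ContinuousOn.intervalIntegrable ?_
    rw [hI]
    exact continuousOn_const.mul (hc.mul hec)
  · refine ContinuousOn.intervalIntegrable ?_
    rw [hI]
    fun_prop

end

theorem norm_integral_le_of_le_div_sqrt {f : ℝ → ℂ} {α β K : ℝ} (hα : 0 ≤ α) (hab : α ≤ β)
    (hK : 0 ≤ K) (h : ∀ p ∈ Set.Ioc α β, ‖f p‖ ≤ K / √p) :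
    ‖∫ p in α..β, f p‖ ≤ 2 * K * √β := by
  have hi : IntervalIntegrable (fun p : ℝ => K * p ^ (-(1 / 2) : ℝ)) MeasureTheory.volume α β :=
    (intervalIntegral.intervalIntegrable_rpow' (by norm_num)).const_mul K
  have h1 := intervalIntegral.norm_integral_le_of_norm_le (f := f) hab
    (Filter.Eventually.of_forall fun p hp => (h p hp).trans (le_of_eq (by
      have : 0 < p := hα.trans_lt hp.1
      rw [Real.rpow_neg this.le, ← Real.sqrt_eq_rpow, div_eq_mul_inv]))) hi
  refine h1.trans ?_
  rw [intervalIntegral.integral_const_mul, integral_rpow (Or.inl (by norm_num))]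
  norm_num
  rw [← Real.sqrt_eq_rpow, ← Real.sqrt_eq_rpow]
  have := mul_nonneg hK (Real.sqrt_nonneg α)
  linarith

/-- The `S`-integral on the line `S + Υ = p`, with its full phase. -/
noncomputable def normalInt (g : ℝ × ℝ → ℝ) (Λ y p : ℝ) : ℂ :=
  ∫ S in (-3:ℝ)..3, (g (S, p - S) : ℂ) *
    cis (Λ * (p ^ 3 / 3 + (1 - y) * p - p ^ 2 * S + p * S ^ 2 + y * S))

/-- The value of the phase of `normalInt` at its critical point. -/
noncomputable def normalPhase (y p : ℝ) : ℝ :=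
  p ^ 3 / 12 + p * (1 - y / 2) - y ^ 2 / (4 * p)

section

variable {g : ℝ × ℝ → ℝ} {Λ y p : ℝ}

theorem hasDerivAt_normalPhase (hp : 0 < p) :
    HasDerivAt (normalPhase y) ((p - y / p) ^ 2 / 4 + 1) p := by
  have h1 := ((hasDerivAt_id p).pow 3).div_const 12
  have h2 := (hasDerivAt_id p).mul_const (1 - y / 2)
  have h3 := (hasDerivAt_const p (y ^ 2)).div ((hasDerivAt_id p).const_mul 4)
    (by simp only [id]; positivity)
  refine ((h1.add h2).sub h3).congr_deriv ?_
  simp only [id]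
  norm_num
  field_simp
  ring

theorem normalInt_eq (hp : 0 < p) :
    normalInt g Λ y p = cis (Λ * normalPhase y p) * redM g Λ y p := by
  rw [normalInt, redM, ← intervalIntegral.integral_const_mul]
  refine intervalIntegral.integral_congr fun S _ => ?_
  have e : Λ * (p ^ 3 / 3 + (1 - y) * p - p ^ 2 * S + p * S ^ 2 + y * S) =
      Λ * normalPhase y p + Λ * (p * (S - critS y p) ^ 2) := by
    unfold normalPhase critS
    field_simp
    ring
  change _ * cis _ = cis _ * (_ * cis _)
  rw [e, cis_add]
  ring

theorem continuous_normalInt (hg : Continuous g) : Continuous (normalInt g Λ y) := by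
  refine intervalIntegral.continuous_parametric_intervalIntegral_of_continuous' ?_ _ _
  have := continuous_cis
  refine Continuous.mul ?_ ?_
  · exact Complex.continuous_ofReal.comp (hg.comp (by fun_prop))
  · exact continuous_cis.comp (by fun_prop)

end

/-- The parameter range of the far field: `Λ = ℓ ^ 3` and `|τ / 2 - 2| = v ^ 12`. -/
structure FarRegime (a τ n ℓ v : ℝ) : Prop where
  a_pos : 0 < a
  a_le : a ≤ 1 / 10 ^ 12
  le_l : 8 ≤ ℓ
  v_pos : 0 < v
  n_cases : n = 1 ∨ n = -1 ∨ 2 ≤ |n|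
  n_le : |n| ≤ 13 / 10 * ℓ
  le_n_mul : 7 / 10 ≤ |n| * v ^ 6
  v_eq : |τ / 2 - 2| = v ^ 12

namespace FarRegime

variable {a τ n ℓ v p K : ℝ} {β β' : ℝ → ℂ} {φ : ℝ → ℝ}

theorem one_le_n (h : FarRegime a τ n ℓ v) : 1 ≤ |n| := by
  rcases h.n_cases with h | h | h
  · simp [h]
  · simp [h]
  · linarith

theorem n_ne (h : FarRegime a τ n ℓ v) : n ≠ 0 :=
  abs_pos.mp (one_pos.trans_le h.one_le_n)

theorem l_pos (h : FarRegime a τ n ℓ v) : 0 < ℓ := by linarith [h.le_l]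

theorem one_le_cube (h : FarRegime a τ n ℓ v) : 1 ≤ ℓ ^ 3 :=
  one_le_pow₀ (by linarith [h.le_l])

theorem twelve_div_le (h : FarRegime a τ n ℓ v) : 12 / √(ℓ ^ 3 * |n|) ≤ 12 := by
  have h1 : 1 ≤ √(ℓ ^ 3 * |n|) := by
    rw [Real.one_le_sqrt]
    nlinarith [h.one_le_cube, h.one_le_n]
  exact div_le_self (by norm_num) h1

theorem v_six_le (h : FarRegime a τ n ℓ v) (hτ : |τ| ≤ 40) : v ^ 6 ≤ 5 := by
  have h1 := h.v_eq
  have h2 : |τ / 2 - 2| ≤ 22 := by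
    rw [abs_le] at hτ ⊢
    constructor <;> linarith [hτ.1, hτ.2]
  have : (v ^ 6) ^ 2 ≤ 5 ^ 2 := by
    have e : (v ^ 6) ^ 2 = v ^ 12 := by ring
    rw [e]
    linarith
  exact (le_abs_self _).trans (abs_le_of_sq_le_sq this (by norm_num))

theorem v_cube_le (h : FarRegime a τ n ℓ v) (hτ : |τ| ≤ 40) : v ^ 3 ≤ 3 := by
  have h1 := h.v_six_le hτ
  have : (v ^ 3) ^ 2 ≤ 3 ^ 2 := by
    have e : (v ^ 3) ^ 2 = v ^ 6 := by ring
    rw [e]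
    linarith
  exact (le_abs_self _).trans (abs_le_of_sq_le_sq this (by norm_num))

theorem v_cube_le_abs (h : FarRegime a τ n ℓ v) (hτ : 40 < |τ|) : v ^ 3 ≤ |τ| := by
  have h1 := h.v_eq
  have h2 : |τ / 2 - 2| ≤ |τ| := by
    calc |τ / 2 - 2| ≤ |τ / 2| + |2| := abs_sub _ _
      _ ≤ |τ| := by rw [abs_div, abs_two]; linarith
  have h3 : (v ^ 3) ^ 4 ≤ |τ| ^ 4 := by
    calc (v ^ 3) ^ 4 = v ^ 12 := by ring
      _ ≤ |τ| ^ 1 := by rw [pow_one]; linarith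
      _ ≤ |τ| ^ 4 := pow_le_pow_right₀ (by linarith) (by norm_num)
  exact (pow_le_pow_iff_left₀ (pow_nonneg h.v_pos.le 3) (abs_nonneg τ) (by norm_num)).mp h3

theorem one_le_cube_mul (h : FarRegime a τ n ℓ v) (hτ : |τ| ≤ 40) (hp : 1 / (ℓ ^ 2 * v ^ 6) ≤ p) :
    1 ≤ ℓ ^ 3 * p := by
  have hl := h.l_pos
  have hv := h.v_pos
  have h1 := h.v_six_le hτ
  calc 1 ≤ ℓ / v ^ 6 := by rw [le_div_iff₀ (by positivity)]; linarith [h.le_l]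
    _ = ℓ ^ 3 * (1 / (ℓ ^ 2 * v ^ 6)) := by field_simp
    _ ≤ ℓ ^ 3 * p := by gcongr

theorem threshold_le (h : FarRegime a τ n ℓ v) : 1 / (ℓ ^ 2 * v ^ 6) ≤ 1 := by
  have hl := h.l_pos
  have hv := h.v_pos
  have h1 : 7 / 10 ≤ 13 / 10 * ℓ * v ^ 6 := h.le_n_mul.trans (by
    have := h.n_le
    gcongr)
  rw [div_le_one (by positivity)]
  nlinarith [h.le_l]

theorem norm_fiberInt_le (h : FarRegime a τ n ℓ v) (hτ : |τ| ≤ 40)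
    (hβ : SlowWeight (12 / √(ℓ ^ 3 * |n|)) β β') (hφ : BoundedC2 K φ) :
    ‖fiberInt a τ n (ℓ ^ 3) (fun A => (φ A : ℂ) * β A) p‖ ≤ 1300 * K / √(ℓ ^ 3 * |n|) := by
  have hK := hφ.nonneg
  obtain ⟨φ1, φ2, hφ⟩ := hφ
  refine (_root_.norm_fiberInt_le h.a_pos h.a_le hτ h.n_ne (by linarith [h.one_le_cube]) hβ
    fun A hA => ⟨(hφ A hA).1, (hφ A hA).2.2.1, (hφ A hA).2.2.2.1⟩).trans ?_
  have := h.twelve_div_le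
  gcongr ?_ / _
  nlinarith

theorem norm_fiberInt_le_of_outside (h : FarRegime a τ n ℓ v) (hτ : |τ| ≤ 40)
    (hβ : SlowWeight (12 / √(ℓ ^ 3 * |n|)) β β') (hφ : BoundedC2 K φ)
    (hφa : φ (4 / 5) = 0) (hφb : φ (13 / 2) = 0)
    (hp : p / n ≤ flightPhase1 a τ 7 ∨ flightPhase1 a τ (3 / 4) ≤ p / n) :
    ‖fiberInt a τ n (ℓ ^ 3) (fun A => (φ A : ℂ) * β A) p‖ ≤ 10 ^ 5 * K / (ℓ ^ 3 * |n|) := by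
  have hK := hφ.nonneg
  obtain ⟨φ1, φ2, hφ⟩ := hφ
  have hl := h.l_pos
  have hn := h.one_le_n
  refine (norm_fiberInt_le_of_ne_zero h.a_pos h.n_ne (by linarith [h.one_le_cube]) hβ
    (fun A hA => ⟨(hφ A hA).1, (hφ A hA).2.2.1, (hφ A hA).2.2.2.1⟩) hφa hφb
    (μ := 15 / 1000) (M := 134) (by norm_num) (fun A hA => ?_) fun A hA => ?_).trans ?_
  · have hA0 : 0 < A := by linarith [hA.1]
    rcases hp with hp | hp
    · have h1 := flightPhase1_sub (τ := τ) h.a_pos hA0 (r := 7) (by norm_num)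
      have h2 := flightSlope_mem h.a_pos h.a_le hτ (A := A) (r := 7)
        ⟨by linarith [hA.1], by linarith [hA.2]⟩ ⟨by norm_num, by norm_num⟩
      refine le_trans ?_ (le_abs_self _)
      nlinarith [hA.2]
    · have h1 := flightPhase1_sub (τ := τ) h.a_pos hA0 (r := 3 / 4) (by norm_num)
      have h2 := flightSlope_mem h.a_pos h.a_le hτ (A := A) (r := 3 / 4)
        ⟨by linarith [hA.1], by linarith [hA.2]⟩ ⟨by norm_num, by norm_num⟩
      refine le_trans ?_ (neg_le_abs _)
      nlinarith [hA.1]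
  · have h1 := neg_two_le_flightPhase2 h.a_pos h.a_le hτ (A := A) (by linarith [hA.1])
    have h2 := flightPhase2_le h.a_pos h.a_le hτ (A := A) ⟨by linarith [hA.1], by linarith [hA.2]⟩
    rw [abs_le]
    constructor <;> linarith
  · have h1 := h.twelve_div_le
    rw [div_le_div_iff₀ (by positivity) (by positivity)]
    have h2 : 6 * (K * (1 + 12 / √(ℓ ^ 3 * |n|) + 134)) ≤ 1500 * K := by nlinarith
    have h3 : 0 < ℓ ^ 3 * |n| := by positivity
    calc _ ≤ 1500 * K * (ℓ ^ 3 * |n|) := by gcongr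
      _ = 10 ^ 5 * K * (ℓ ^ 3 * |n| * (15 / 1000)) := by ring

theorem norm_fiberInt_le_of_large (h : FarRegime a τ n ℓ v) (hτ : 40 < |τ|)
    (hβ : SlowWeight (12 / √(ℓ ^ 3 * |n|)) β β') (hφ : BoundedC2 K φ)
    (hφa : φ (4 / 5) = 0) (hφb : φ (13 / 2) = 0) (hp0 : 0 ≤ p) (hp6 : p ≤ 6) :
    ‖fiberInt a τ n (ℓ ^ 3) (fun A => (φ A : ℂ) * β A) p‖ ≤
      10 ^ 5 * K / (ℓ ^ 3 * |n| * |τ|) := by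
  have hK := hφ.nonneg
  obtain ⟨φ1, φ2, hφ⟩ := hφ
  have hl := h.l_pos
  have hn := h.one_le_n
  have ha := h.a_pos
  have hs := sqrt_one_add_le h.a_pos h.a_le
  refine (norm_fiberInt_le_of_ne_zero h.a_pos h.n_ne (by linarith [h.one_le_cube]) hβ
    (fun A hA => ⟨(hφ A hA).1, (hφ A hA).2.2.1, (hφ A hA).2.2.2.1⟩) hφa hφb
    (μ := |τ| / 10) (M := 10) (by positivity) (fun A hA => ?_) fun A hA => ?_).trans ?_
  · have hA0 : 0 < A := by linarith [hA.1]
    have h4 : √(1 + a * A) ≤ 101 / 100 := by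
      rw [Real.sqrt_le_left (by norm_num)]
      have : a * A ≤ 1 / 10 ^ 12 * (13 / 2) := by
        have := hA.2
        have := h.a_le
        gcongr
      norm_num at this ⊢
      linarith
    have h5 : (101 / 100)⁻¹ ≤ (√(1 + a * A))⁻¹ :=
      inv_anti₀ (by linarith [one_le_sqrt_one_add h.a_pos hA0]) h4
    have h6 : √A ≤ 26 / 10 := by
      rw [Real.sqrt_le_left (by norm_num)]; norm_num; linarith [hA.2]
    have h7 : |p / n| ≤ 6 := by
      rw [abs_div, abs_of_nonneg hp0, div_le_iff₀ (by linarith)]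
      nlinarith
    have h8 : 49 / 100 * |τ| ≤ |τ * √(1 + a) / 2 * (√(1 + a * A))⁻¹| := by
      rw [abs_mul, abs_div, abs_mul, abs_two, abs_of_nonneg (Real.sqrt_nonneg (1 + a)),
        abs_of_nonneg (by positivity : 0 ≤ (√(1 + a * A))⁻¹)]
      calc 49 / 100 * |τ| ≤ |τ| * 1 / 2 * (101 / 100)⁻¹ := by
            norm_num
            nlinarith [abs_nonneg τ]
        _ ≤ _ := by
            have := hs.1
            gcongr
    have h9 : |τ * √(1 + a) / 2 * (√(1 + a * A))⁻¹| ≤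
        |flightPhase1 a τ A - p / n| + |2 * √A| + |p / n| := by
      have e : τ * √(1 + a) / 2 * (√(1 + a * A))⁻¹ =
          flightPhase1 a τ A - p / n + 2 * √A + p / n := by
        unfold flightPhase1
        ring
      rw [e]
      exact abs_add_three _ _ _
    rw [abs_of_nonneg (by positivity : 0 ≤ 2 * √A)] at h9
    linarith
  · have hA0 : 0 < A := by linarith [hA.1]
    obtain ⟨h2, h3⟩ := inv_sqrt_one_add_mem h.a_pos hA0
    have h4 : 8 / 10 ≤ √A := Real.le_sqrt_of_sq_le (by norm_num; linarith [hA.1])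
    have h5 : (√A)⁻¹ ≤ (8 / 10)⁻¹ := inv_anti₀ (by norm_num) h4
    have h6 : |τ * √(1 + a) * a / 4 * (√(1 + a * A))⁻¹ ^ 3| ≤ |τ| / 2 := by
      rw [abs_mul, abs_div, abs_mul, abs_mul, abs_of_nonneg (Real.sqrt_nonneg (1 + a)),
        abs_of_pos ha, abs_of_pos (by positivity : 0 < (√(1 + a * A))⁻¹ ^ 3),
        abs_of_pos (by norm_num : (0:ℝ) < 4)]
      have hs2 : √(1 + a) ≤ 2 := hs.2.trans (by norm_num)
      have ha1 : a ≤ 1 := h.a_le.trans (by norm_num)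
      calc |τ| * √(1 + a) * a / 4 * (√(1 + a * A))⁻¹ ^ 3 ≤ |τ| * 2 * 1 / 4 * 1 ^ 3 := by gcongr
        _ = |τ| / 2 := by ring
    have e : flightPhase2 a τ A = -(τ * √(1 + a) * a / 4 * (√(1 + a * A))⁻¹ ^ 3) + -(√A)⁻¹ := by
      unfold flightPhase2
      ring
    rw [e]
    refine (abs_add_le _ _).trans ?_
    rw [abs_neg, abs_neg, abs_of_pos (by positivity : 0 < (√A)⁻¹)]
    have h5' : (√A)⁻¹ ≤ 5 / 4 := h5.trans (by norm_num)
    linarith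
  · have h1 := h.twelve_div_le
    rw [div_le_div_iff₀ (by positivity) (by positivity)]
    have h2 : 6 * (K * (1 + 12 / √(ℓ ^ 3 * |n|) + 10)) ≤ 10 ^ 4 * K := by nlinarith
    have h3 : 0 < ℓ ^ 3 * |n| * |τ| := by positivity
    calc _ ≤ 10 ^ 4 * K * (ℓ ^ 3 * |n| * |τ|) := by gcongr
      _ = 10 ^ 5 * K * (ℓ ^ 3 * |n| * (|τ| / 10)) := by ring

end FarRegime

/-- Size and variation of the `S`-integral, uniformly in the frequency and in `y`. -/
structure NormalBound (g : ℝ × ℝ → ℝ) (C : ℝ) : Prop where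
  continuous : Continuous g
  nonneg : 0 ≤ C
  bound : ∀ Λ y p : ℝ, 0 < Λ → 0 < p → ‖redM g Λ y p‖ ≤ C / √(Λ * p)
  deriv : ∀ Λ y : ℝ, 0 < Λ → ∃ m' : ℝ → ℂ, ∀ p, 0 < p → p ≤ 6 → 1 ≤ Λ * p →
    HasDerivAt (redM g Λ y) (m' p) p ∧ ‖m' p‖ ≤ C / √(Λ * p) / p

theorem StripBump.exists_normalBound {g : ℝ × ℝ → ℝ} (hg : StripBump g) :
    ∃ C, NormalBound g C := by
  obtain ⟨C1, h1, h1'⟩ := norm_redM_le hg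
  obtain ⟨C2, h2, h2'⟩ := exists_hasDerivAt_redM hg
  refine ⟨max C1 C2, hg.contDiff.continuous, h1.trans (le_max_left _ _),
    fun Λ y p hΛ hp => (h1' Λ y p hΛ hp).trans ?_, fun Λ y hΛ => ?_⟩
  · gcongr
    exact le_max_left _ _
  · obtain ⟨m', hm⟩ := h2' Λ y hΛ
    refine ⟨m', fun p hp hp6 hΛp => ⟨(hm p hp hp6 hΛp).1, (hm p hp hp6 hΛp).2.trans ?_⟩⟩
    gcongr
    exact le_max_right _ _

theorem NormalBound.norm_normalInt_le {g : ℝ × ℝ → ℝ} {C Λ y p : ℝ} (hC : NormalBound g C)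
    (hΛ : 0 < Λ) (hp : 0 < p) : ‖normalInt g Λ y p‖ ≤ C / √(Λ * p) := by
  rw [normalInt_eq hp, norm_mul, norm_cis, one_mul]
  exact hC.bound Λ y p hΛ hp

theorem NormalBound.norm_integral_le_of_fiber {g : ℝ × ℝ → ℝ} {C Λ y α β D : ℝ} {H : ℝ → ℂ}
    (hC : NormalBound g C) (hΛ : 0 < Λ) (hα : 0 ≤ α) (hab : α ≤ β) (hD : 0 ≤ D)
    (hH : ∀ p ∈ Set.Ioc α β, ‖H p‖ ≤ D) :
    ‖∫ p in α..β, normalInt g Λ y p * H p‖ ≤ 2 * (C * D / √Λ) * √β := by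
  have hC0 := hC.nonneg
  refine norm_integral_le_of_le_div_sqrt hα hab (by positivity) fun p hp => ?_
  have hp0 : 0 < p := hα.trans_lt hp.1
  rw [norm_mul]
  calc ‖normalInt g Λ y p‖ * ‖H p‖ ≤ C / √(Λ * p) * D := by
        gcongr
        · exact hC.norm_normalInt_le hΛ hp0
        · exact hH p hp
    _ = C * D / √Λ / √p := by
        rw [Real.sqrt_mul hΛ.le]
        field_simp

namespace FarRegime

variable {a τ n ℓ v y C K : ℝ} {β β' : ℝ → ℂ} {φ : ℝ → ℝ} {g : ℝ × ℝ → ℝ}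

theorem le_sqrt_cube (h : FarRegime a τ n ℓ v) : ℓ ≤ √(ℓ ^ 3) := by
  have := h.le_l
  refine Real.le_sqrt_of_sq_le ?_
  exact pow_le_pow_right₀ (by linarith) (by norm_num)

theorem one_le_sqrt_n (h : FarRegime a τ n ℓ v) : 1 ≤ √|n| := by
  rw [Real.one_le_sqrt]
  exact h.one_le_n

theorem sqrt_cube_mul (h : FarRegime a τ n ℓ v) (x : ℝ) : √(ℓ ^ 3 * x) = √(ℓ ^ 3) * √x :=
  Real.sqrt_mul (pow_nonneg h.l_pos.le 3) x

theorem continuousOn_amplitude {B : ℝ} (hβ : SlowWeight B β β') (hφ : BoundedC2 K φ) :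
    ContinuousOn (fun A => (φ A : ℂ) * β A) (Set.Icc (4 / 5) (13 / 2)) := by
  obtain ⟨φ1, φ2, hφ⟩ := hφ
  intro A hA
  exact (((Complex.continuous_ofReal.continuousAt).comp (hφ A hA).1.continuousAt).mul
    (hβ.deriv A hA).continuousAt).continuousWithinAt

theorem norm_integral_le_of_critical (h : FarRegime a τ n ℓ v) (hτ : |τ| ≤ 40)
    (hC : NormalBound g C) (hβ : SlowWeight (12 / √(ℓ ^ 3 * |n|)) β β') (hφ : BoundedC2 K φ)
    (hφa : φ (4 / 5) = 0) (hφb : φ (13 / 2) = 0) {α γ : ℝ} (hα : 1 / (ℓ ^ 2 * v ^ 6) ≤ α)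
    (hαγ : α ≤ γ) (hγ : γ ≤ 6)
    (hp : ∀ p ∈ Set.Icc α γ, p / n ∈ Set.Icc (flightPhase1 a τ 7) (flightPhase1 a τ (3 / 4))) :
    ‖∫ p in α..γ, normalInt g (ℓ ^ 3) y p *
        fiberInt a τ n (ℓ ^ 3) (fun A => (φ A : ℂ) * β A) p‖ ≤
      54000 * (10 ^ 18 * C * K / (ℓ ^ 3 * √|n|) / (ℓ * v ^ 3)) := by
  have hl := h.l_pos
  have hv := h.v_pos
  have hn := h.n_ne
  have hn1 := h.one_le_n
  have hC0 := hC.nonneg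
  have hK := hφ.nonneg
  have hα0 : 0 < α := lt_of_lt_of_le (by positivity) hα
  have hΛ : 0 < ℓ ^ 3 := by positivity
  have hs : 0 < √(ℓ ^ 3) := Real.sqrt_pos.mpr hΛ
  have ht : 1 ≤ √|n| := h.one_le_sqrt_n
  have hss : √(ℓ ^ 3) * √(ℓ ^ 3) = ℓ ^ 3 := Real.mul_self_sqrt hΛ.le
  obtain ⟨r, hr⟩ := exists_flight_critical_point h.a_pos h.a_le hτ
  obtain ⟨m', hm⟩ := hC.deriv (ℓ ^ 3) y hΛ
  set H : ℝ → ℂ := fun p => cis (-criticalPhase a τ n (ℓ ^ 3) r p) *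
    fiberInt a τ n (ℓ ^ 3) (fun A => (φ A : ℂ) * β A) p with hH
  have hHd : ∀ p, ∃ h', p ∈ Set.Icc α γ → HasDerivAt H h' p ∧
      ‖h'‖ ≤ 10 ^ 17 * K / (√(ℓ ^ 3) * √|n|) := by
    intro p
    by_cases hpI : p ∈ Set.Icc α γ
    · obtain ⟨hr0, hr1, hr2⟩ := hr _ (hp p hpI)
      obtain ⟨h', h1, h2⟩ := exists_hasDerivAt_demodulated h.a_pos h.a_le hτ hn hΛ hβ hφ hφa hφb
        hr0 hr1 hr2
      refine ⟨h', fun _ => ⟨h1, h2.trans ?_⟩⟩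
      have h3 := h.twelve_div_le
      have h4 := h.sqrt_cube_mul |n|
      rw [h4] at h3 ⊢
      rw [div_le_iff₀ (by linarith)]
      have hst : 0 < √(ℓ ^ 3) * √|n| := by positivity
      calc 4 * (K * 10 ^ 13) * (100 * (1 + 12 / (√(ℓ ^ 3) * √|n|)) / (√(ℓ ^ 3) * √|n|) +
            6 * (12 / (√(ℓ ^ 3) * √|n|)))
          ≤ 4 * (K * 10 ^ 13) * (100 * (1 + 12) / (√(ℓ ^ 3) * √|n|) +
            6 * (12 / (√(ℓ ^ 3) * √|n|))) := by gcongr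
        _ = 54880000000000000 * K / (√(ℓ ^ 3) * √|n|) * 1 := by field_simp; ring
        _ ≤ 10 ^ 17 * K / (√(ℓ ^ 3) * √|n|) * |n| := by
            gcongr
            norm_num
    · exact ⟨0, fun h => absurd h hpI⟩
  choose h' hh' using hHd
  have hHb : ∀ p, ‖H p‖ ≤ 1300 * K / (√(ℓ ^ 3) * √|n|) := by
    intro p
    rw [hH]
    simp only [norm_mul, norm_cis, one_mul]
    rw [← h.sqrt_cube_mul]
    exact h.norm_fiberInt_le hτ hβ hφ
  have hW : WeightBound (10 ^ 18 * C * K / (ℓ ^ 3 * √|n|)) α γ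
      (fun p => redM g (ℓ ^ 3) y p * H p)
      (fun p => m' p * H p + redM g (ℓ ^ 3) y p * h' p) := by
    refine ⟨hα0, by positivity, fun p hpI => ?_, fun p hpI => ?_, fun p hpI => ?_⟩
    all_goals
      have hp0 : 0 < p := hα0.trans_le hpI.1
      have hp6 : p ≤ 6 := hpI.2.trans hγ
      have hsp : 0 < √p := Real.sqrt_pos.mpr hp0
      have hm1 := hm p hp0 hp6 (h.one_le_cube_mul hτ (hα.trans hpI.1))
      have hb := hC.bound (ℓ ^ 3) y p hΛ hp0
      rw [h.sqrt_cube_mul] at hb hm1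
    · exact hm1.1.mul (hh' p hpI).1
    · rw [norm_mul]
      calc _ ≤ C / (√(ℓ ^ 3) * √p) * (1300 * K / (√(ℓ ^ 3) * √|n|)) := by
            gcongr
            exact hHb p
        _ = 1300 * C * K / (√(ℓ ^ 3) * √(ℓ ^ 3) * √|n|) / √p := by field_simp
        _ ≤ _ := by
            rw [hss]
            gcongr
            norm_num
    · refine (norm_add_le _ _).trans ?_
      rw [norm_mul (m' p) (H p), norm_mul (redM g (ℓ ^ 3) y p) (h' p)]
      calc _ ≤ C / (√(ℓ ^ 3) * √p) / p * (1300 * K / (√(ℓ ^ 3) * √|n|)) +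
            C / (√(ℓ ^ 3) * √p) * (10 ^ 17 * K / (√(ℓ ^ 3) * √|n|)) :=
            add_le_add (mul_le_mul hm1.2 (hHb p) (norm_nonneg _) (by positivity))
              (mul_le_mul hb (hh' p hpI).2 (norm_nonneg _) (by positivity))
        _ = (1300 + 10 ^ 17 * p) * (C * K / (√(ℓ ^ 3) * √(ℓ ^ 3) * √|n|) / (√p * p)) := by
            field_simp
        _ ≤ 10 ^ 18 * (C * K / (√(ℓ ^ 3) * √(ℓ ^ 3) * √|n|) / (√p * p)) := by
            gcongr
            linarith
        _ = _ := by
            rw [hss]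
            ring
  have hE : ∀ p ∈ Set.Icc α γ, HasDerivAt
      (fun p => ℓ ^ 3 * normalPhase y p + criticalPhase a τ n (ℓ ^ 3) r p)
      (ℓ ^ 3 * ((p - y / p) ^ 2 / 4 + 1 - r (p / n))) p := by
    intro p hpI
    have hp0 : 0 < p := hα0.trans_le hpI.1
    obtain ⟨hr0, hr1, hr2⟩ := hr _ (hp p hpI)
    refine (((hasDerivAt_normalPhase hp0).const_mul (ℓ ^ 3)).add (hasDerivAt_criticalPhase h.a_pos
      hn (by linarith [hr0.1]) hr1 hr2)).congr_deriv ?_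
    ring
  have hR := reducedPhase_of_critical h.a_pos h.a_le hτ (by linarith [h.le_l] : 1 ≤ ℓ) hv h.n_cases
    h.n_le h.le_n_mul h.v_eq hα0 hγ hr hp hE
  refine le_trans (le_of_eq ?_) (hR.norm_integral_le hαγ hα hW)
  congr 1
  refine intervalIntegral.integral_congr fun p hpI => ?_
  rw [Set.uIcc_of_le hαγ] at hpI
  have hp0 : 0 < p := hα0.trans_le hpI.1
  simp only [hH]
  rw [normalInt_eq hp0, cis_add]
  have e : cis (-criticalPhase a τ n (ℓ ^ 3) r p) * cis (criticalPhase a τ n (ℓ ^ 3) r p) = 1 := by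
    rw [← cis_add]
    simp [cis]
  linear_combination (-(cis (ℓ ^ 3 * normalPhase y p) * redM g (ℓ ^ 3) y p *
    fiberInt a τ n (ℓ ^ 3) (fun A => (φ A : ℂ) * β A) p)) * e

theorem norm_integral_le_of_fiber_le (h : FarRegime a τ n ℓ v) (hC : NormalBound g C) {H : ℝ → ℂ}
    {α γ D W : ℝ} (hα : 0 ≤ α) (hαγ : α ≤ γ) (hγ : γ ≤ 6) (hD : 0 ≤ D) (hW : v ^ 3 ≤ W)
    (hH : ∀ p ∈ Set.Ioc α γ, ‖H p‖ ≤ D / (ℓ ^ 3 * |n| * W)) :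
    ‖∫ p in α..γ, normalInt g (ℓ ^ 3) y p * H p‖ ≤
      5 * (C * D / (ℓ ^ 3 * √|n|) / (ℓ * v ^ 3)) := by
  have hl := h.l_pos
  have hv := h.v_pos
  have hn1 := h.one_le_n
  have hC0 := hC.nonneg
  have ht := h.one_le_sqrt_n
  have hv3 : 0 < v ^ 3 := by positivity
  have htt : √|n| * √|n| = |n| := Real.mul_self_sqrt (abs_nonneg n)
  have hW0 : 0 < W := hv3.trans_le hW
  refine (hC.norm_integral_le_of_fiber (by positivity) hα hαγ (by positivity) hH).trans ?_
  have h1 : √γ ≤ 5 / 2 := by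
    rw [Real.sqrt_le_left (by norm_num)]
    linarith
  calc 2 * (C * (D / (ℓ ^ 3 * |n| * W)) / √(ℓ ^ 3)) * √γ
      ≤ 2 * (C * (D / (ℓ ^ 3 * (√|n| * 1) * v ^ 3)) / ℓ) * (5 / 2) := by
        have := h.le_sqrt_cube
        gcongr
        exact (mul_le_mul_of_nonneg_left ht (Real.sqrt_nonneg _)).trans htt.le
    _ = _ := by
        field_simp

theorem norm_integral_pos_le (h : FarRegime a τ n ℓ v) (hC : NormalBound g C)
    (hβ : SlowWeight (12 / √(ℓ ^ 3 * |n|)) β β') (hφ : BoundedC2 K φ)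
    (hφa : φ (4 / 5) = 0) (hφb : φ (13 / 2) = 0) :
    ‖∫ p in (0:ℝ)..6, normalInt g (ℓ ^ 3) y p *
        fiberInt a τ n (ℓ ^ 3) (fun A => (φ A : ℂ) * β A) p‖ ≤
      10 ^ 23 * (C * K / (ℓ ^ 3 * √|n|) / (ℓ * v ^ 3)) := by
  have hl := h.l_pos
  have hv := h.v_pos
  have hn := h.n_ne
  have hn1 := h.one_le_n
  have hC0 := hC.nonneg
  have hK := hφ.nonneg
  have ht := h.one_le_sqrt_n
  have hX : 0 ≤ C * K / (ℓ ^ 3 * √|n|) / (ℓ * v ^ 3) := by positivity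
  rcases lt_or_ge 40 |τ| with hτ | hτ
  · refine (h.norm_integral_le_of_fiber_le hC le_rfl (by norm_num) le_rfl
      (by positivity : 0 ≤ 10 ^ 5 * K) (h.v_cube_le_abs hτ) fun p hp =>
      h.norm_fiberInt_le_of_large hτ hβ hφ hφa hφb hp.1.le hp.2).trans ?_
    have e : C * (10 ^ 5 * K) / (ℓ ^ 3 * √|n|) / (ℓ * v ^ 3) =
        10 ^ 5 * (C * K / (ℓ ^ 3 * √|n|) / (ℓ * v ^ 3)) := by ring
    rw [e]
    linarith
  set x := 1 / (ℓ ^ 2 * v ^ 6) with hx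
  have hx0 : 0 < x := by positivity
  have hx1 : x ≤ 1 := h.threshold_le
  have hcont : Continuous fun p => normalInt g (ℓ ^ 3) y p *
      fiberInt a τ n (ℓ ^ 3) (fun A => (φ A : ℂ) * β A) p :=
    (continuous_normalInt hC.continuous).mul (continuous_iff_continuousAt.mpr fun p =>
      (hasDerivAt_fiberInt h.a_pos (continuousOn_amplitude hβ hφ)).continuousAt)
  have hsmall : ‖∫ p in (0:ℝ)..x, normalInt g (ℓ ^ 3) y p *
      fiberInt a τ n (ℓ ^ 3) (fun A => (φ A : ℂ) * β A) p‖ ≤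
      10 ^ 4 * (C * K / (ℓ ^ 3 * √|n|) / (ℓ * v ^ 3)) := by
    refine (hC.norm_integral_le_of_fiber (by positivity) le_rfl hx0.le
      (by positivity : 0 ≤ 1300 * K / √(ℓ ^ 3 * |n|)) fun p _ =>
      h.norm_fiberInt_le hτ hβ hφ).trans ?_
    have hsx : √x = 1 / (ℓ * v ^ 3) := by
      have e : x = (1 / (ℓ * v ^ 3)) ^ 2 := by
        rw [hx]
        field_simp
      rw [e, Real.sqrt_sq (by positivity)]
    have hΛ : 0 < ℓ ^ 3 := by positivity
    have hs : 0 < √(ℓ ^ 3) := Real.sqrt_pos.mpr hΛ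
    have hss : √(ℓ ^ 3) * √(ℓ ^ 3) = ℓ ^ 3 := Real.mul_self_sqrt hΛ.le
    have e : 2 * (C * (1300 * K / √(ℓ ^ 3 * |n|)) / √(ℓ ^ 3)) * √x =
        2600 * (C * K / (√(ℓ ^ 3) * √(ℓ ^ 3) * √|n|) / (ℓ * v ^ 3)) := by
      rw [h.sqrt_cube_mul, hsx]
      field_simp
      ring
    rw [e, hss]
    linarith
  have hout : ∀ α γ, x ≤ α → α ≤ γ → γ ≤ 6 →
      (∀ p ∈ Set.Ioc α γ, p / n ≤ flightPhase1 a τ 7 ∨ flightPhase1 a τ (3 / 4) ≤ p / n) →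
      ‖∫ p in α..γ, normalInt g (ℓ ^ 3) y p *
        fiberInt a τ n (ℓ ^ 3) (fun A => (φ A : ℂ) * β A) p‖ ≤
      10 ^ 7 * (C * K / (ℓ ^ 3 * √|n|) / (ℓ * v ^ 3)) := by
    intro α γ hα hαγ hγ hp
    refine (h.norm_integral_le_of_fiber_le hC (hx0.le.trans hα) hαγ hγ
      (by positivity : 0 ≤ 3 * 10 ^ 5 * K) (h.v_cube_le hτ) fun p hpI =>
      (h.norm_fiberInt_le_of_outside hτ hβ hφ hφa hφb (hp p hpI)).trans (le_of_eq ?_)).trans ?_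
    · field_simp
    · have e : C * (3 * 10 ^ 5 * K) / (ℓ ^ 3 * √|n|) / (ℓ * v ^ 3) =
          3 * 10 ^ 5 * (C * K / (ℓ ^ 3 * √|n|) / (ℓ * v ^ 3)) := by ring
      rw [e]
      linarith
  have hin : ∀ α γ, x ≤ α → α ≤ γ → γ ≤ 6 →
      (∀ p ∈ Set.Icc α γ, p / n ∈ Set.Icc (flightPhase1 a τ 7) (flightPhase1 a τ (3 / 4))) →
      ‖∫ p in α..γ, normalInt g (ℓ ^ 3) y p *
        fiberInt a τ n (ℓ ^ 3) (fun A => (φ A : ℂ) * β A) p‖ ≤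
      54000 * 10 ^ 18 * (C * K / (ℓ ^ 3 * √|n|) / (ℓ * v ^ 3)) := by
    intro α γ hα hαγ hγ hp
    refine (h.norm_integral_le_of_critical hτ hC hβ hφ hφa hφb hα hαγ hγ hp).trans (le_of_eq ?_)
    ring
  have hmain : ∃ z₁ z₂ : ℝ, (∀ p, p ≤ z₁ → p / n ≤ flightPhase1 a τ 7 ∨
        flightPhase1 a τ (3 / 4) ≤ p / n) ∧
      (∀ p, z₂ ≤ p → p / n ≤ flightPhase1 a τ 7 ∨ flightPhase1 a τ (3 / 4) ≤ p / n) ∧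
      ∀ p, z₁ ≤ p → p ≤ z₂ →
        p / n ∈ Set.Icc (flightPhase1 a τ 7) (flightPhase1 a τ (3 / 4)) := by
    rcases lt_or_gt_of_ne hn with hneg | hpos
    · refine ⟨n * flightPhase1 a τ (3 / 4), n * flightPhase1 a τ 7, fun p hp => Or.inr ?_,
        fun p hp => Or.inl ?_, fun p h1 h2 => ⟨?_, ?_⟩⟩
      · rw [le_div_iff_of_neg hneg]; linarith
      · rw [div_le_iff_of_neg hneg]; linarith
      · rw [le_div_iff_of_neg hneg]; linarith
      · rw [div_le_iff_of_neg hneg]; linarith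
    · refine ⟨n * flightPhase1 a τ 7, n * flightPhase1 a τ (3 / 4), fun p hp => Or.inl ?_,
        fun p hp => Or.inr ?_, fun p h1 h2 => ⟨?_, ?_⟩⟩
      · rw [div_le_iff₀ hpos]; linarith
      · rw [le_div_iff₀ hpos]; linarith
      · rw [le_div_iff₀ hpos]; linarith
      · rw [div_le_iff₀ hpos]; linarith
  obtain ⟨z₁, z₂, hz1, hz2, hz⟩ := hmain
  have hbig : ‖∫ p in x..6, normalInt g (ℓ ^ 3) y p *
      fiberInt a τ n (ℓ ^ 3) (fun A => (φ A : ℂ) * β A) p‖ ≤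
      10 ^ 7 * (C * K / (ℓ ^ 3 * √|n|) / (ℓ * v ^ 3)) +
      (54000 * 10 ^ 18 * (C * K / (ℓ ^ 3 * √|n|) / (ℓ * v ^ 3)) +
      10 ^ 7 * (C * K / (ℓ ^ 3 * √|n|) / (ℓ * v ^ 3))) := by
    refine norm_integral_le_add_of_breakpoint z₁ (by linarith) hcont.continuousOn (by positivity)
      (by positivity) (fun α γ h1 h2 h3 h4 => ?_) fun α γ h1 h2 h3 h4 => ?_
    · exact hout α γ h1 h2 h3 fun p hp => hz1 p (hp.2.trans h4)
    · refine norm_integral_le_add_of_breakpoint z₂ h2 hcont.continuousOn (by positivity)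
        (by positivity) (fun α' γ' k1 k2 k3 k4 => ?_) fun α' γ' k1 k2 k3 k4 => ?_
      · exact hin α' γ' (h1.trans k1) k2 (k3.trans h3) fun p hp =>
          hz p ((h4.trans k1).trans hp.1) (hp.2.trans k4)
      · exact hout α' γ' (h1.trans k1) k2 (k3.trans h3) fun p hp => hz2 p (k4.trans hp.1.le)
  rw [← intervalIntegral.integral_add_adjacent_intervals (hcont.intervalIntegrable 0 x)
    (hcont.intervalIntegrable x 6)]
  refine (norm_add_le _ _).trans ((add_le_add hsmall hbig).trans ?_)
  linarith

end FarRegime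

theorem StripBump.comp_neg {g : ℝ × ℝ → ℝ} (hg : StripBump g) : StripBump fun x => g (-x) where
  contDiff := hg.contDiff.comp contDiff_neg
  compact := hg.compact.comp_homeomorph (Homeomorph.neg _)
  strip := by
    intro x hx
    have h1 : tsupport (fun x => g (-x)) ⊆ (fun x => -x) ⁻¹' tsupport g :=
      tsupport_comp_subset_preimage g continuous_neg
    have h2 := hg.strip (h1 hx)
    simpa using h2

theorem normalInt_neg {g : ℝ × ℝ → ℝ} {Λ y p : ℝ} :
    normalInt g Λ y (-p) = (starRingEnd ℂ) (normalInt (fun x => g (-x)) Λ y p) := by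
  rw [normalInt, normalInt, ← intervalIntegral.intervalIntegral_conj]
  have h1 := intervalIntegral.integral_comp_neg (a := -3) (b := 3) (fun S : ℝ =>
    (g (S, -p - S) : ℂ) *
      cis (Λ * ((-p) ^ 3 / 3 + (1 - y) * (-p) - (-p) ^ 2 * S + (-p) * S ^ 2 + y * S)))
  rw [neg_neg] at h1
  rw [← h1]
  refine intervalIntegral.integral_congr fun S _ => ?_
  simp only [map_mul, Complex.conj_ofReal, conj_cis, Prod.neg_mk]
  congr 2
  · congr 3
    ring
  · ring

theorem fiberInt_neg {a τ n Λ p : ℝ} {c : ℝ → ℂ} :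
    fiberInt a τ n Λ c (-p) =
      (starRingEnd ℂ) (fiberInt a τ (-n) Λ (fun A => (starRingEnd ℂ) (c A)) p) := by
  rw [fiberInt, fiberInt, ← intervalIntegral.intervalIntegral_conj]
  refine intervalIntegral.integral_congr fun A _ => ?_
  simp only [map_mul, Complex.conj_conj, conj_cis, fiberPhase]
  congr 2
  ring

theorem SlowWeight.conj {B : ℝ} {β β' : ℝ → ℂ} (hβ : SlowWeight B β β') :
    SlowWeight B (fun A => (starRingEnd ℂ) (β A)) (fun A => (starRingEnd ℂ) (β' A)) where
  deriv A hA := (hβ.deriv A hA).star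
  bound A hA := by
    rw [RCLike.norm_conj]
    exact hβ.bound A hA
  bound' A hA := by
    rw [RCLike.norm_conj]
    exact hβ.bound' A hA

namespace FarRegime

variable {a τ n ℓ v y C K : ℝ} {β β' : ℝ → ℂ} {φ : ℝ → ℝ} {g : ℝ × ℝ → ℝ}

theorem neg (h : FarRegime a τ n ℓ v) : FarRegime a τ (-n) ℓ v where
  a_pos := h.a_pos
  a_le := h.a_le
  le_l := h.le_l
  v_pos := h.v_pos
  n_cases := by
    rcases h.n_cases with h | h | h
    · exact Or.inr (Or.inl (by rw [h]))
    · exact Or.inl (by rw [h, neg_neg])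
    · exact Or.inr (Or.inr (by rwa [abs_neg]))
  n_le := by rw [abs_neg]; exact h.n_le
  le_n_mul := by rw [abs_neg]; exact h.le_n_mul
  v_eq := h.v_eq

theorem norm_integral_le (h : FarRegime a τ n ℓ v) (hC : NormalBound g C)
    (hC' : NormalBound (fun x => g (-x)) C)
    (hβ : SlowWeight (12 / √(ℓ ^ 3 * |n|)) β β') (hφ : BoundedC2 K φ)
    (hφa : φ (4 / 5) = 0) (hφb : φ (13 / 2) = 0) :
    ‖∫ p in (-6:ℝ)..6, normalInt g (ℓ ^ 3) y p *
        fiberInt a τ n (ℓ ^ 3) (fun A => (φ A : ℂ) * β A) p‖ ≤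
      2 * 10 ^ 23 * (C * K / (ℓ ^ 3 * √|n|) / (ℓ * v ^ 3)) := by
  have hcont : Continuous fun p => normalInt g (ℓ ^ 3) y p *
      fiberInt a τ n (ℓ ^ 3) (fun A => (φ A : ℂ) * β A) p :=
    (continuous_normalInt hC.continuous).mul (continuous_iff_continuousAt.mpr fun p =>
      (hasDerivAt_fiberInt h.a_pos (continuousOn_amplitude hβ hφ)).continuousAt)
  have hneg : ‖∫ p in (-6:ℝ)..0, normalInt g (ℓ ^ 3) y p *
      fiberInt a τ n (ℓ ^ 3) (fun A => (φ A : ℂ) * β A) p‖ ≤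
      10 ^ 23 * (C * K / (ℓ ^ 3 * √|n|) / (ℓ * v ^ 3)) := by
    have h1 := intervalIntegral.integral_comp_neg (a := 0) (b := 6) (fun p : ℝ =>
      normalInt g (ℓ ^ 3) y p * fiberInt a τ n (ℓ ^ 3) (fun A => (φ A : ℂ) * β A) p)
    rw [neg_zero] at h1
    have h2 := h.neg.norm_integral_pos_le (y := y) hC' (by rw [abs_neg]; exact hβ.conj) hφ hφa hφb
    rw [abs_neg] at h2
    refine le_trans (le_of_eq ?_) h2
    rw [← h1, ← RCLike.norm_conj, ← intervalIntegral.intervalIntegral_conj]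
    congr 1
    refine intervalIntegral.integral_congr fun p _ => ?_
    simp only [normalInt_neg, fiberInt_neg, map_mul, Complex.conj_conj, Complex.conj_ofReal]
  rw [← intervalIntegral.integral_add_adjacent_intervals (hcont.intervalIntegrable (-6) 0)
    (hcont.intervalIntegrable 0 6)]
  refine (norm_add_le _ _).trans ((add_le_add hneg
    (h.norm_integral_pos_le hC hβ hφ hφa hφb)).trans ?_)
  linarith

end FarRegime

theorem measurePreserving_shear :
    MeasureTheory.MeasurePreserving
      (fun x : ℝ × ℝ × ℝ × ℝ => (x.2.2.1, x.2.1 - x.2.2.1, x.2.2.2, x.1)) := by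
  have e1 : MeasureTheory.MeasurePreserving
      (fun x : ℝ × ℝ × ℝ × ℝ => ((x.2.1, x.2.2), x.1)) :=
    MeasureTheory.Measure.measurePreserving_swap
  have e2 : MeasureTheory.MeasurePreserving
      (fun x : (ℝ × ℝ × ℝ) × ℝ => (x.1.1, x.1.2, x.2)) :=
    MeasureTheory.volume_preserving_prodAssoc
  have e3 : MeasureTheory.MeasurePreserving
      (fun x : ℝ × (ℝ × ℝ) × ℝ => ((x.2.1, x.2.2), x.1)) :=
    MeasureTheory.Measure.measurePreserving_swap
  have e4 : MeasureTheory.MeasurePreserving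
      (fun x : ((ℝ × ℝ) × ℝ) × ℝ => ((x.1.1.1, x.1.1.2, x.1.2), x.2)) :=
    MeasureTheory.volume_preserving_prodAssoc.prod
      (MeasureTheory.MeasurePreserving.id MeasureTheory.volume)
  have e5 : MeasureTheory.MeasurePreserving
      (fun x : (ℝ × ℝ × ℝ) × ℝ => (x.1.1, x.1.2, x.2)) :=
    MeasureTheory.volume_preserving_prodAssoc
  have e6 : MeasureTheory.MeasurePreserving
      (fun x : ℝ × (ℝ × ℝ) × ℝ => (x.1, x.2.2 - x.1, x.2.1)) := by
    refine (MeasureTheory.MeasurePreserving.id MeasureTheory.volume).skew_product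
      (g := fun (S : ℝ) (x : (ℝ × ℝ) × ℝ) => (x.2 - S, x.1)) (by fun_prop)
      (Filter.Eventually.of_forall fun S => ?_)
    have k1 : MeasureTheory.MeasurePreserving (fun x : (ℝ × ℝ) × ℝ => (x.2, x.1)) :=
      MeasureTheory.Measure.measurePreserving_swap
    have k2 : MeasureTheory.MeasurePreserving (fun x : ℝ × ℝ × ℝ => (x.1 - S, x.2)) :=
      (MeasureTheory.measurePreserving_sub_right MeasureTheory.volume S).prod
        (MeasureTheory.MeasurePreserving.id MeasureTheory.volume)
    exact (k2.comp k1).map_eq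
  exact e6.comp (e5.comp (e4.comp (e3.comp (e2.comp e1))))

theorem integral_eq_iterated_shear {F : ℝ × ℝ × ℝ × ℝ → ℂ} (hF : Continuous F) {R : ℝ}
    (hR : ∀ x, F x ≠ 0 → ‖x‖ ≤ R) :
    ∫ x, F x = ∫ η, ∫ p, ∫ S, ∫ A, F (S, p - S, A, η) := by
  have key : ∀ {E : Type} [NormedAddCommGroup E] [ProperSpace E] [MeasureTheory.MeasureSpace E]
      [BorelSpace E] [SecondCountableTopology E]
      [MeasureTheory.IsFiniteMeasureOnCompacts (MeasureTheory.volume : MeasureTheory.Measure E)]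
      {G : E → ℂ}, Continuous G → ∀ {r : ℝ}, (∀ x, G x ≠ 0 → ‖x‖ ≤ r) →
      MeasureTheory.Integrable G := by
    intro E _ _ _ _ _ _ G hG r hr
    refine hG.integrable_of_hasCompactSupport
      (HasCompactSupport.intro (isCompact_closedBall (0 : E) r) fun x hx => ?_)
    by_contra h
    exact hx (by simpa using hr x h)
  set G : ℝ × ℝ × ℝ × ℝ → ℂ := fun x => F (x.2.2.1, x.2.1 - x.2.2.1, x.2.2.2, x.1) with hG
  have hGc : Continuous G := hF.comp (by fun_prop)
  have hGR : ∀ x, G x ≠ 0 → ‖x‖ ≤ 2 * R := by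
    intro x hx
    have h1 := hR _ hx
    simp only [Prod.norm_def, max_le_iff] at h1 ⊢
    obtain ⟨h1, h2, h3, h4⟩ := h1
    have h5 := norm_nonneg x.1
    refine ⟨by linarith, ?_, by linarith, by linarith⟩
    calc ‖x.2.1‖ = ‖(x.2.1 - x.2.2.1) + x.2.2.1‖ := by rw [sub_add_cancel]
      _ ≤ _ := (norm_add_le _ _).trans (by linarith)
  have h1 : ∫ x, F x = ∫ x, G x := by
    have h2 := MeasureTheory.integral_map (μ := MeasureTheory.volume)
      measurePreserving_shear.aemeasurable (f := F) hF.aestronglyMeasurable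
    rw [measurePreserving_shear.map_eq] at h2
    exact h2
  rw [h1]
  have i1 : MeasureTheory.Integrable G (MeasureTheory.volume.prod MeasureTheory.volume) :=
    key hGc hGR
  rw [MeasureTheory.Measure.volume_eq_prod, MeasureTheory.integral_prod _ i1]
  congr 1
  ext η
  have hG2 : ∀ x, G (η, x) ≠ 0 → ‖x‖ ≤ 2 * R := fun x hx =>
    (le_max_right _ _).trans (hGR _ hx)
  have i2 : MeasureTheory.Integrable (fun x => G (η, x))
      (MeasureTheory.volume.prod MeasureTheory.volume) :=
    key (hGc.comp (by fun_prop)) hG2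
  rw [MeasureTheory.Measure.volume_eq_prod, MeasureTheory.integral_prod _ i2]
  congr 1
  ext p
  have i3 : MeasureTheory.Integrable (fun x => G (η, p, x))
      (MeasureTheory.volume.prod MeasureTheory.volume) :=
    key (hGc.comp (by fun_prop)) fun x hx => (le_max_right _ _).trans (hG2 _ hx)
  rw [MeasureTheory.Measure.volume_eq_prod, MeasureTheory.integral_prod _ i3]

theorem mul_PsiTan_shear {L : ℝ → ℝ} {h a : ℝ} {N : ℤ} {T X Y p S A η : ℝ} (ha : 0 < a)
    (hh : 0 < h) (hN : (N : ℝ) ≠ 0) (hA : 0 < A) :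
    a ^ ((3:ℝ) / 2) / h * PsiTan L h a N T X Y (p - S) S A η =
      η * (a ^ ((3:ℝ) / 2) / h) * Y +
      η * (a ^ ((3:ℝ) / 2) / h) *
        (p ^ 3 / 3 + (1 - (1 - X)) * p - p ^ 2 * S + p * S ^ 2 + (1 - X) * S) +
      (fiberPhase a (T / N) N (η * (a ^ ((3:ℝ) / 2) / h)) p A +
        N * Bfun L (η * (a ^ ((3:ℝ) / 2) / h) * A ^ ((3:ℝ) / 2))) := by
  have hlam : 0 < a ^ ((3:ℝ) / 2) / h := by positivity
  have h1 : A ^ ((3:ℝ) / 2) = √A ^ 3 := by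
    rw [Real.sqrt_eq_rpow, ← Real.rpow_natCast, ← Real.rpow_mul hA.le]
    norm_num
  have h2 : T * √(1 + a) * (A - 1) / (√(1 + a * A) + √(1 + a)) =
      N * (T / N * √(1 + a) / a * (√(1 + a * A) - √(1 + a))) := by
    have k1 : √(1 + a * A) ^ 2 = 1 + a * A := Real.sq_sqrt (by positivity)
    have k2 : √(1 + a) ^ 2 = 1 + a := Real.sq_sqrt (by positivity)
    have k3 : 0 < √(1 + a) := Real.sqrt_pos.mpr (by positivity)
    have k4 : 0 ≤ √(1 + a * A) := Real.sqrt_nonneg _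
    have k5 : 0 < √(1 + a * A) + √(1 + a) := by positivity
    rw [div_eq_iff k5.ne']
    field_simp
    linear_combination (-T) * (k1 - k2)
  unfold PsiTan
  rw [h2]
  generalize a ^ ((3:ℝ) / 2) / h = lam at *
  rw [mul_add, ← mul_assoc lam (_ / _), mul_div_cancel₀ _ hlam.ne']
  unfold fiberPhase flightPhase
  rw [h1]
  ring

/-- The boundary phase factor of the `A`-integral. -/
noncomputable def reflectionFactor (L : ℝ → ℝ) (n Λ A : ℝ) : ℂ :=
  cis (n * Bfun L (Λ * A ^ ((3:ℝ) / 2)))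

theorem FarRegime.slowWeight_reflectionFactor {a τ n ℓ v : ℝ} {L b : ℝ → ℝ}
    (h : FarRegime a τ n ℓ v)
    (hb : ∀ u, 1 ≤ u → HasDerivAt (Bfun L) (b u) u ∧ |b u| ≤ 1 / u ^ 2) :
    SlowWeight (12 / √(ℓ ^ 3 * |n|)) (reflectionFactor L n (ℓ ^ 3)) (fun A =>
      Complex.I * ((n * (b (ℓ ^ 3 * A ^ ((3:ℝ) / 2)) * (ℓ ^ 3 * (3 / 2 * √A))) : ℝ) : ℂ) *
        reflectionFactor L n (ℓ ^ 3) A) := by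
  have hl := h.l_pos
  have hΛ : 512 ≤ ℓ ^ 3 := by
    calc (512:ℝ) = 8 ^ 3 := by norm_num
      _ ≤ ℓ ^ 3 := pow_le_pow_left₀ (by norm_num) h.le_l 3
  have hpow : ∀ A ∈ Set.Icc (4 / 5 : ℝ) (13 / 2), A ^ ((3:ℝ) / 2) = √A ^ 3 ∧ 8 / 9 ≤ √A := by
    intro A hA
    have hA0 : 0 < A := by linarith [hA.1]
    refine ⟨?_, Real.le_sqrt_of_sq_le (by norm_num; linarith [hA.1])⟩
    rw [Real.sqrt_eq_rpow, ← Real.rpow_natCast, ← Real.rpow_mul hA0.le]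
    norm_num
  have hone : ∀ A ∈ Set.Icc (4 / 5 : ℝ) (13 / 2), 1 ≤ ℓ ^ 3 * A ^ ((3:ℝ) / 2) := by
    intro A hA
    obtain ⟨h1, h2⟩ := hpow A hA
    rw [h1]
    calc (1:ℝ) ≤ 512 * (8 / 9) ^ 3 := by norm_num
      _ ≤ ℓ ^ 3 * √A ^ 3 := by gcongr
  refine ⟨fun A hA => ?_, fun A _ => (norm_cis _).le, fun A hA => ?_⟩
  · have hA0 : 0 < A := by linarith [hA.1]
    have h1 := (Real.hasDerivAt_rpow_const (x := A) (p := (3:ℝ) / 2) (Or.inl hA0.ne')).const_mul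
      (ℓ ^ 3)
    have h2 := ((hb _ (hone A hA)).1.comp A h1).const_mul n
    refine (hasDerivAt_cis h2).congr_deriv ?_
    have e : A ^ ((3:ℝ) / 2 - 1) = √A := by
      rw [Real.sqrt_eq_rpow]
      norm_num
    rw [e]
    rfl
  · obtain ⟨h1, h2⟩ := hpow A hA
    have h3 := (hb _ (hone A hA)).2
    have hn := h.one_le_n
    rw [norm_mul, norm_mul, Complex.norm_I, one_mul, reflectionFactor, norm_cis, mul_one,
      Complex.norm_real, Real.norm_eq_abs, abs_mul, abs_mul,
      abs_of_pos (show 0 < ℓ ^ 3 * (3 / 2 * √A) by positivity)]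
    rw [h1] at h3 ⊢
    have hw : 1 / 2 ≤ √A ^ 5 := by
      calc (1:ℝ) / 2 ≤ (8 / 9) ^ 5 := by norm_num
        _ ≤ √A ^ 5 := by gcongr
    have hX : 0 < √(ℓ ^ 3 * |n|) := Real.sqrt_pos.mpr (by positivity)
    have hXX : √(ℓ ^ 3 * |n|) ^ 2 = ℓ ^ 3 * |n| := Real.sq_sqrt (by positivity)
    have hX2 : |n| * √(ℓ ^ 3 * |n|) ≤ 4 * ℓ ^ 3 := by
      refine (le_abs_self _).trans (abs_le_of_sq_le_sq ?_ (by positivity))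
      rw [mul_pow, hXX]
      have h4 : |n| ^ 3 ≤ (13 / 10 * ℓ) ^ 3 := by
        have := h.n_le
        gcongr
      calc |n| ^ 2 * (ℓ ^ 3 * |n|) = ℓ ^ 3 * |n| ^ 3 := by ring
        _ ≤ ℓ ^ 3 * (13 / 10 * ℓ) ^ 3 := by gcongr
        _ ≤ (4 * ℓ ^ 3) ^ 2 := by nlinarith [pow_pos hl 6]
    calc |n| * (|b (ℓ ^ 3 * √A ^ 3)| * (ℓ ^ 3 * (3 / 2 * √A)))
        ≤ |n| * (1 / (ℓ ^ 3 * √A ^ 3) ^ 2 * (ℓ ^ 3 * (3 / 2 * √A))) := by gcongr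
      _ = 3 / 2 * |n| / (ℓ ^ 3 * √A ^ 5) := by
          have : 0 < √A := by linarith
          field_simp
      _ ≤ 3 / 2 * |n| / (ℓ ^ 3 * (1 / 2)) := by gcongr
      _ ≤ 12 / √(ℓ ^ 3 * |n|) := by
          rw [div_le_div_iff₀ (by positivity) hX]
          nlinarith

/-- The integrand of the tangential wave. -/
noncomputable def tanIntegrand (L : ℝ → ℝ) (ψ : ℝ → ℝ) (χ₂ : ℝ × ℝ → ℝ) (ψ₃ : ℝ → ℝ)
    (h a : ℝ) (N : ℤ) (T X Y : ℝ) (v : ℝ × ℝ × ℝ × ℝ) : ℂ :=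
  Complex.exp (Complex.I *
      (((a ^ ((3:ℝ)/2) / h) * PsiTan L h a N T X Y v.2.1 v.1 v.2.2.1 v.2.2.2 : ℝ) : ℂ)) *
    ((v.2.2.2 ^ 2 * ψ v.2.2.2 * χ₂ (v.1, v.2.1) * ψ₃ v.2.2.1 : ℝ) : ℂ)

section

variable {L : ℝ → ℝ} {ψ : ℝ → ℝ} {χ₂ : ℝ × ℝ → ℝ} {ψ₃ : ℝ → ℝ} {h a : ℝ} {N : ℤ} {T X Y : ℝ}

theorem continuous_tanIntegrand (ha : 0 < a) (hL : Continuous L) (hψ : Continuous ψ)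
    (hχ : Continuous χ₂) (hψ₃ : Continuous ψ₃) :
    Continuous (tanIntegrand L ψ χ₂ ψ₃ h a N T X Y) := by
  have h1 : Continuous fun x : ℝ => x ^ ((3:ℝ) / 2) := Real.continuous_rpow_const (by norm_num)
  have h2 : Continuous fun x : ℝ => x ^ ((2:ℝ) / 3) := Real.continuous_rpow_const (by norm_num)
  have hB : Continuous (Bfun L) := by
    unfold Bfun
    exact (by fun_prop : Continuous fun u : ℝ => (4 / 3) * u + Real.pi / 2).sub (hL.comp h2)
  have hden : ∀ v : ℝ × ℝ × ℝ × ℝ, √(1 + a * v.2.2.1) + √(1 + a) ≠ 0 := by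
    intro v
    have k1 : 0 < √(1 + a) := Real.sqrt_pos.mpr (by positivity)
    have k2 := Real.sqrt_nonneg (1 + a * v.2.2.1)
    positivity
  have hA : Continuous fun v : ℝ × ℝ × ℝ × ℝ => v.2.2.1 ^ ((3:ℝ) / 2) := h1.comp (by fun_prop)
  have hfrac : Continuous fun v : ℝ × ℝ × ℝ × ℝ =>
      T * √(1 + a) * (v.2.2.1 - 1) / (√(1 + a * v.2.2.1) + √(1 + a)) :=
    Continuous.div (by fun_prop) (by fun_prop) hden
  have hBA : Continuous fun v : ℝ × ℝ × ℝ × ℝ =>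
      Bfun L (v.2.2.2 * (a ^ ((3:ℝ) / 2) / h) * v.2.2.1 ^ ((3:ℝ) / 2)) :=
    hB.comp (by fun_prop)
  have hΨ : Continuous fun v : ℝ × ℝ × ℝ × ℝ =>
      PsiTan L h a N T X Y v.2.1 v.1 v.2.2.1 v.2.2.2 := by
    unfold PsiTan
    fun_prop
  have hχ' : Continuous fun v : ℝ × ℝ × ℝ × ℝ => χ₂ (v.1, v.2.1) := hχ.comp (by fun_prop)
  unfold tanIntegrand
  fun_prop

theorem norm_le_of_tanIntegrand_ne_zero (hψs : tsupport ψ ⊆ Set.Icc (1 / 2 : ℝ) (3 / 2))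
    (hχ₂s : tsupport χ₂ ⊆ {p : ℝ × ℝ | |p.1| < 3 ∧ |p.2| < 3})
    (hψ₃s : tsupport ψ₃ ⊆ Set.Icc (9 / 10 : ℝ) 6) (v : ℝ × ℝ × ℝ × ℝ)
    (hv : tanIntegrand L ψ χ₂ ψ₃ h a N T X Y v ≠ 0) : ‖v‖ ≤ 6 := by
  have h1 : ψ v.2.2.2 ≠ 0 := fun h0 => hv (by simp [tanIntegrand, h0])
  have h2 : χ₂ (v.1, v.2.1) ≠ 0 := fun h0 => hv (by simp [tanIntegrand, h0])
  have h3 : ψ₃ v.2.2.1 ≠ 0 := fun h0 => hv (by simp [tanIntegrand, h0])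
  have k1 := hψs (subset_tsupport ψ h1)
  have k2 := hχ₂s (subset_tsupport χ₂ h2)
  have k3 := hψ₃s (subset_tsupport ψ₃ h3)
  simp only [Prod.norm_def, max_le_iff, Real.norm_eq_abs]
  refine ⟨by linarith [k2.1], by linarith [k2.2], ?_, ?_⟩
  · rw [abs_le]
    constructor <;> linarith [k3.1, k3.2]
  · rw [abs_le]
    constructor <;> linarith [k1.1, k1.2]

theorem integral_tanIntegrand_slice (ha : 0 < a) (hh : 0 < h) (hN : (N : ℝ) ≠ 0)
    (hχ₂s : tsupport χ₂ ⊆ {p : ℝ × ℝ | |p.1| < 3 ∧ |p.2| < 3})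
    (hψ₃s : tsupport ψ₃ ⊆ Set.Icc (9 / 10 : ℝ) 6) (η : ℝ) :
    ∫ p, ∫ S, ∫ A, tanIntegrand L ψ χ₂ ψ₃ h a N T X Y (S, p - S, A, η) =
      cis (η * (a ^ ((3:ℝ) / 2) / h) * Y) * ((η ^ 2 * ψ η : ℝ) : ℂ) *
        ∫ p in (-6:ℝ)..6, normalInt χ₂ (η * (a ^ ((3:ℝ) / 2) / h)) (1 - X) p *
          fiberInt a (T / N) N (η * (a ^ ((3:ℝ) / 2) / h)) (fun A => (ψ₃ A : ℂ) *
            reflectionFactor L N (η * (a ^ ((3:ℝ) / 2) / h)) A) p := by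
  set Λ := η * (a ^ ((3:ℝ) / 2) / h) with hΛ
  set c : ℂ := cis (Λ * Y) * ((η ^ 2 * ψ η : ℝ) : ℂ) with hc
  set H := fiberInt a (T / N) N Λ (fun A => (ψ₃ A : ℂ) * reflectionFactor L N Λ A) with hH
  have hχ : ∀ S p : ℝ, χ₂ (S, p - S) ≠ 0 → |S| < 3 ∧ |p - S| < 3 := fun S p h0 =>
    hχ₂s (subset_tsupport χ₂ h0)
  have hA : ∀ S p, ∫ A, tanIntegrand L ψ χ₂ ψ₃ h a N T X Y (S, p - S, A, η) =
      c * H p * ((χ₂ (S, p - S) : ℂ) *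
        cis (Λ * (p ^ 3 / 3 + (1 - (1 - X)) * p - p ^ 2 * S + p * S ^ 2 + (1 - X) * S))) := by
    intro S p
    have h1 : H p = ∫ A, (ψ₃ A : ℂ) * reflectionFactor L N Λ A *
        cis (fiberPhase a (T / N) N Λ p A) := by
      rw [hH, fiberInt]
      refine intervalIntegral.integral_eq_integral_of_support_subset fun A hA0 => ?_
      have h2 : ψ₃ A ≠ 0 := fun h0 => hA0 (by simp [h0])
      have h3 := hψ₃s (subset_tsupport ψ₃ h2)
      exact ⟨by linarith [h3.1], by linarith [h3.2]⟩
    rw [h1, mul_comm c, mul_assoc, ← MeasureTheory.integral_mul_const]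
    refine MeasureTheory.integral_congr_ae (Filter.Eventually.of_forall fun A => ?_)
    by_cases h2 : ψ₃ A = 0
    · simp [tanIntegrand, h2]
    · have h3 := hψ₃s (subset_tsupport ψ₃ h2)
      have h4 := mul_PsiTan_shear (L := L) (T := T) (X := X) (Y := Y) (p := p) (S := S) (η := η)
        ha hh hN (by linarith [h3.1] : 0 < A)
      rw [← hΛ] at h4
      change cis _ * _ = _
      simp only [h4, cis_add, hc, reflectionFactor]
      push_cast
      ring
  have hS : ∀ p, ∫ S, ∫ A, tanIntegrand L ψ χ₂ ψ₃ h a N T X Y (S, p - S, A, η) =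
      c * (normalInt χ₂ Λ (1 - X) p * H p) := by
    intro p
    simp only [hA]
    rw [MeasureTheory.integral_const_mul, normalInt,
      intervalIntegral.integral_eq_integral_of_support_subset]
    · ring
    · intro S hS0
      have h2 : χ₂ (S, p - S) ≠ 0 := fun h0 => hS0 (by simp [h0])
      have h3 := abs_lt.mp (hχ S p h2).1
      exact ⟨h3.1, h3.2.le⟩
  simp only [hS]
  rw [MeasureTheory.integral_const_mul, intervalIntegral.integral_eq_integral_of_support_subset]
  intro p hp
  by_contra hp6
  refine hp ?_
  have h1 : normalInt χ₂ Λ (1 - X) p = 0 := by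
    rw [normalInt]
    refine intervalIntegral.integral_zero_ae (Filter.Eventually.of_forall fun S _ => ?_)
    have h2 : χ₂ (S, p - S) = 0 := by
      by_contra h0
      obtain ⟨h3, h4⟩ := hχ S p h0
      rw [abs_lt] at h3 h4
      exact hp6 ⟨by linarith, by linarith⟩
    simp [h2]
  simp [h1]

end

theorem NormalBound.mono {g : ℝ × ℝ → ℝ} {C C' : ℝ} (hC : NormalBound g C) (h : C ≤ C') :
    NormalBound g C' where
  continuous := hC.continuous
  nonneg := hC.nonneg.trans h
  bound Λ y p hΛ hp := (hC.bound Λ y p hΛ hp).trans (by gcongr)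
  deriv Λ y hΛ := by
    obtain ⟨m', hm⟩ := hC.deriv Λ y hΛ
    exact ⟨m', fun p hp hp6 hΛp => ⟨(hm p hp hp6 hΛp).1, (hm p hp hp6 hΛp).2.trans (by gcongr)⟩⟩

theorem farRegime_of_far {a lam η T ℓ : ℝ} {N : ℤ} (ha : 0 < a) (ha' : a ≤ 1 / 10 ^ 12)
    (hlam : 1100 ≤ lam) (hη : 1 / 2 ≤ η) (hℓ : 0 < ℓ) (hℓ3 : ℓ ^ 3 = η * lam)
    (hN : 1 ≤ |(N : ℝ)|) (hN3 : |(N : ℝ)| ^ 3 ≤ lam)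
    (hT : 1 / |(N : ℝ)| ≤ |T - 4 * (N : ℝ)|) :
    FarRegime a (T / N) N ℓ (|T / N / 2 - 2| ^ ((1:ℝ) / 12)) ∧
      2 * (√|(N : ℝ)| * (|T / N / 2 - 2| ^ ((1:ℝ) / 12)) ^ 3) ^ 4 =
        |(N : ℝ) * (T - 4 * (N : ℝ))| ∧ 1 ≤ |(N : ℝ) * (T - 4 * (N : ℝ))| := by
  have hN0 : 0 < |(N : ℝ)| := by linarith
  have hNne : (N : ℝ) ≠ 0 := abs_pos.mp hN0
  have hQ1 : 1 ≤ |(N : ℝ) * (T - 4 * (N : ℝ))| := by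
    rw [abs_mul]
    rwa [div_le_iff₀' hN0] at hT
  have hQ : |(N : ℝ) * (T - 4 * (N : ℝ))| = 2 * |(N : ℝ)| ^ 2 * |T / N / 2 - 2| := by
    have e : (N : ℝ) * (T - 4 * (N : ℝ)) = 2 * (N : ℝ) ^ 2 * (T / N / 2 - 2) := by
      field_simp
      ring
    rw [e, abs_mul, abs_mul, abs_two, abs_pow]
  have hw : 0 < |T / N / 2 - 2| := by
    by_contra h0
    have h1 : |T / N / 2 - 2| = 0 := le_antisymm (not_lt.mp h0) (abs_nonneg _)
    rw [hQ, h1] at hQ1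
    norm_num at hQ1
  set v := |T / N / 2 - 2| ^ ((1:ℝ) / 12) with hv
  have hv0 : 0 < v := Real.rpow_pos_of_pos hw _
  have hv12 : |T / N / 2 - 2| = v ^ 12 := by
    rw [hv, ← Real.rpow_natCast, ← Real.rpow_mul hw.le]
    norm_num
  have hsq : √|(N : ℝ)| ^ 2 = |(N : ℝ)| := Real.sq_sqrt hN0.le
  have hN3' : |(N : ℝ)| ^ 3 ≤ (13 / 10 * ℓ) ^ 3 := by
    rw [mul_pow, hℓ3]
    nlinarith
  refine ⟨⟨ha, ha', ?_, hv0, ?_, ?_, ?_, hv12⟩, ?_, hQ1⟩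
  · refine (pow_le_pow_iff_left₀ (by norm_num) hℓ.le (by norm_num : 3 ≠ 0)).mp ?_
    rw [hℓ3]
    nlinarith
  · have h1 : N ≠ 0 := by exact_mod_cast hNne
    rcases lt_trichotomy |N| 1 with h2 | h2 | h2
    · exact absurd (Int.abs_lt_one_iff.mp h2) h1
    · rcases (abs_eq (by norm_num)).mp h2 with h3 | h3
      · exact Or.inl (by exact_mod_cast h3)
      · exact Or.inr (Or.inl (by exact_mod_cast h3))
    · exact Or.inr (Or.inr (by exact_mod_cast h2))
  · exact (pow_le_pow_iff_left₀ hN0.le (by positivity) (by norm_num : 3 ≠ 0)).mp hN3'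
  · rw [hQ, hv12] at hQ1
    refine (abs_le_of_sq_le_sq ?_ (by positivity)).trans' (le_abs_self _)
    have e : (|(N : ℝ)| * v ^ 6) ^ 2 = |(N : ℝ)| ^ 2 * v ^ 12 := by ring
    rw [e]
    linarith
  · rw [hQ, hv12]
    have e : (√|(N : ℝ)| * v ^ 3) ^ 4 = (√|(N : ℝ)| ^ 2) ^ 2 * v ^ 12 := by ring
    rw [e, hsq]
    ring

theorem div_cube_root_pow_four {a h D z : ℝ} (ha : 0 < a) (hh : 0 < h) (hz : 0 < z) :
    a ^ 2 / h ^ 3 * (D / (((a ^ ((3:ℝ) / 2) / h) ^ ((1:ℝ) / 3)) ^ 4 * z)) =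
      D * (h ^ ((1:ℝ) / 3) / h ^ 2) / z := by
  have h1 : (a ^ ((3:ℝ) / 2) / h) ^ ((1:ℝ) / 3) = √a / h ^ ((1:ℝ) / 3) := by
    rw [Real.div_rpow (by positivity) hh.le, ← Real.rpow_mul ha.le, Real.sqrt_eq_rpow]
    norm_num
  have h2 : (h ^ ((1:ℝ) / 3)) ^ 3 = h := by
    rw [← Real.rpow_natCast, ← Real.rpow_mul hh.le]
    norm_num
  have hk : 0 < h ^ ((1:ℝ) / 3) := by positivity
  have h3 : √a ^ 2 = a := Real.sq_sqrt ha.le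
  have hs : 0 < √a := Real.sqrt_pos.mpr ha
  rw [h1]
  generalize h ^ ((1:ℝ) / 3) = k at *
  generalize √a = s at *
  subst h2 h3
  field_simp

theorem norm_Wtan_le {L ψ : ℝ → ℝ} {χ₂ : ℝ × ℝ → ℝ} {ψ₃ b : ℝ → ℝ} {C K M : ℝ}
    (hL : Continuous L)
    (hb : ∀ u, 1 ≤ u → HasDerivAt (Bfun L) (b u) u ∧ |b u| ≤ 1 / u ^ 2)
    (hψ : Continuous ψ) (hψs : tsupport ψ ⊆ Set.Icc (1 / 2 : ℝ) (3 / 2))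
    (hM : ∀ η ∈ Set.Icc (1 / 2 : ℝ) (3 / 2), ‖ψ η‖ ≤ M)
    (hC : NormalBound χ₂ C) (hC' : NormalBound (fun x => χ₂ (-x)) C)
    (hχ₂s : tsupport χ₂ ⊆ {p : ℝ × ℝ | |p.1| < 3 ∧ |p.2| < 3})
    (hK : BoundedC2 K ψ₃) (hψ₃ : Continuous ψ₃) (hψ₃s : tsupport ψ₃ ⊆ Set.Icc (9 / 10 : ℝ) 6)
    {h a : ℝ} (hh : 0 < h) (ha : 0 < a) (ha' : a ≤ 1 / 10 ^ 12)
    (hlam : 1100 ≤ a ^ ((3:ℝ) / 2) / h) {N : ℤ} (hN : 1 ≤ |(N : ℝ)|)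
    (hNl : |(N : ℝ)| ≤ (a ^ ((3:ℝ) / 2) / h) ^ ((1:ℝ) / 3)) {X Y T : ℝ}
    (hT : 1 / |(N : ℝ)| ≤ |T - 4 * (N : ℝ)|) :
    ‖Wtan L ψ χ₂ ψ₃ h a N T X Y‖ ≤ 10 ^ 26 * (M * C * K) * (h ^ ((1:ℝ) / 3) / h ^ 2) /
      (1 + |(N : ℝ) * (T - 4 * (N : ℝ))| ^ ((1:ℝ) / 4)) := by
  have hC0 := hC.nonneg
  have hK0 := hK.nonneg
  have hM0 : 0 ≤ M := (norm_nonneg _).trans (hM 1 ⟨by norm_num, by norm_num⟩)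
  have hNne : (N : ℝ) ≠ 0 := abs_pos.mp (by linarith)
  have hroot : ∀ x : ℝ, 0 ≤ x → (x ^ ((1:ℝ) / 3)) ^ 3 = x := by
    intro x hx
    rw [← Real.rpow_natCast, ← Real.rpow_mul hx]
    norm_num
  have hkey := fun D z (hz : 0 < z) => div_cube_root_pow_four (D := D) (z := z) ha hh hz
  have hsplit := fun η => integral_tanIntegrand_slice (L := L) (ψ := ψ) (χ₂ := χ₂) (T := T)
    (X := X) (Y := Y) ha hh hNne hχ₂s hψ₃s η
  have hW : Wtan L ψ χ₂ ψ₃ h a N T X Y = ((a ^ 2 / (2 * Real.pi * h) ^ 3 : ℝ) : ℂ) *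
      ∫ η, ∫ p, ∫ S, ∫ A, tanIntegrand L ψ χ₂ ψ₃ h a N T X Y (S, p - S, A, η) := by
    rw [← integral_eq_iterated_shear
      (continuous_tanIntegrand ha hL hψ hC.continuous hψ₃)
      (norm_le_of_tanIntegrand_ne_zero hψs hχ₂s hψ₃s)]
    rfl
  set lam := a ^ ((3:ℝ) / 2) / h with hlamdef
  set m := lam ^ ((1:ℝ) / 3) with hm
  have hlam0 : 0 < lam := by linarith
  have hm3 : m ^ 3 = lam := hroot lam hlam0.le
  have hm0 : 0 < m := Real.rpow_pos_of_pos hlam0 _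
  have hN3 : |(N : ℝ)| ^ 3 ≤ lam := by
    rw [← hm3]
    gcongr
  set z := √|(N : ℝ)| * (|T / N / 2 - 2| ^ ((1:ℝ) / 12)) ^ 3 with hz
  have hreg : ∀ η ℓ : ℝ, 1 / 2 ≤ η → 0 < ℓ → ℓ ^ 3 = η * lam →
      FarRegime a (T / N) N ℓ (|T / N / 2 - 2| ^ ((1:ℝ) / 12)) ∧
      2 * z ^ 4 = |(N : ℝ) * (T - 4 * (N : ℝ))| ∧ 1 ≤ |(N : ℝ) * (T - 4 * (N : ℝ))| :=
    fun η ℓ hη hℓ hℓ3 => farRegime_of_far ha ha' hlam hη hℓ hℓ3 hN hN3 hT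
  obtain ⟨hreg1, hz4, hQ1⟩ := hreg 1 m (by norm_num) hm0 (by rw [hm3, one_mul])
  have hz0 : 0 < z := by
    have h1 := hreg1.v_pos
    have h2 := hreg1.one_le_sqrt_n
    positivity
  have hslice : ∀ η, ‖∫ p, ∫ S, ∫ A, tanIntegrand L ψ χ₂ ψ₃ h a N T X Y (S, p - S, A, η)‖ ≤
      72 * 10 ^ 23 * (M * C * K) / (m ^ 4 * z) := by
    intro η
    rw [hsplit η]
    by_cases hη : ψ η = 0
    · simp only [hη, mul_zero, Complex.ofReal_zero, zero_mul, norm_zero]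
      positivity
    have hη1 := hψs (subset_tsupport ψ hη)
    have hη0 : 0 < η := by linarith [hη1.1]
    set ℓ := (η * lam) ^ ((1:ℝ) / 3) with hℓ
    have hℓ0 : 0 < ℓ := Real.rpow_pos_of_pos (by positivity) _
    have hℓ3 : ℓ ^ 3 = η * lam := hroot _ (by positivity)
    obtain ⟨h1, -, -⟩ := hreg η ℓ hη1.1 hℓ0 hℓ3
    have h2 := h1.norm_integral_le (y := 1 - X) hC hC' (h1.slowWeight_reflectionFactor hb) hK
      (image_eq_zero_of_notMem_tsupport fun h0 => by
        have := (hψ₃s h0).1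
        norm_num at this)
      (image_eq_zero_of_notMem_tsupport fun h0 => by
        have := (hψ₃s h0).2
        norm_num at this)
    rw [← hℓ3, norm_mul, norm_mul, norm_cis, one_mul, Complex.norm_real, norm_mul]
    have hmℓ : m / 2 ≤ ℓ := by
      refine (pow_le_pow_iff_left₀ (by positivity) hℓ0.le (by norm_num : 3 ≠ 0)).mp ?_
      rw [div_pow, hm3, hℓ3]
      nlinarith [hη1.1]
    have h3 : ‖η ^ 2‖ ≤ 9 / 4 := by
      rw [Real.norm_eq_abs, abs_of_nonneg (sq_nonneg η)]
      nlinarith [hη1.2]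
    calc _ ≤ 9 / 4 * M * (2 * 10 ^ 23 * (C * K / (ℓ ^ 3 * √|(N : ℝ)|) /
          (ℓ * (|T / N / 2 - 2| ^ ((1:ℝ) / 12)) ^ 3))) := by
          refine mul_le_mul (mul_le_mul h3 (hM η hη1) (norm_nonneg _) (by norm_num)) h2
            (norm_nonneg _) (by positivity)
      _ = 9 / 2 * 10 ^ 23 * (M * C * K) / (ℓ ^ 4 * z) := by
          rw [hz]
          have hv := h1.v_pos
          have hs := h1.one_le_sqrt_n
          generalize |T / N / 2 - 2| ^ ((1:ℝ) / 12) = v at *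
          field_simp
          ring
      _ ≤ 9 / 2 * 10 ^ 23 * (M * C * K) / ((m / 2) ^ 4 * z) := by gcongr
      _ = 72 * 10 ^ 23 * (M * C * K) / (m ^ 4 * z) := by
          field_simp
          ring
  have h_int : ‖∫ η, ∫ p, ∫ S, ∫ A, tanIntegrand L ψ χ₂ ψ₃ h a N T X Y (S, p - S, A, η)‖ ≤
      144 * 10 ^ 23 * (M * C * K) / (m ^ 4 * z) := by
    rw [← intervalIntegral.integral_eq_integral_of_support_subset (a := 0) (b := 2)]
    · refine (intervalIntegral.norm_integral_le_of_norm_le_const fun η _ => hslice η).trans ?_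
      refine le_of_eq ?_
      rw [sub_zero, abs_two]
      ring
    · intro η hη
      have h1 : ψ η ≠ 0 := fun h0 => hη (by simp [hsplit, h0])
      have h2 := hψs (subset_tsupport ψ h1)
      exact ⟨by linarith [h2.1], by linarith [h2.2]⟩
  have hpref : ‖((a ^ 2 / (2 * Real.pi * h) ^ 3 : ℝ) : ℂ)‖ ≤ a ^ 2 / h ^ 3 := by
    rw [Complex.norm_real, Real.norm_eq_abs, abs_of_pos (by positivity)]
    gcongr
    nlinarith [Real.pi_gt_three]
  have hk := hkey (144 * 10 ^ 23 * (M * C * K)) z hz0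
  have hq : 1 + |(N : ℝ) * (T - 4 * (N : ℝ))| ^ ((1:ℝ) / 4) ≤ 4 * z := by
    have h1 : 1 ≤ |(N : ℝ) * (T - 4 * (N : ℝ))| ^ ((1:ℝ) / 4) :=
      Real.one_le_rpow hQ1 (by norm_num)
    have h2 : (|(N : ℝ) * (T - 4 * (N : ℝ))| ^ ((1:ℝ) / 4)) ^ 4 = 2 * z ^ 4 := by
      rw [hz4, ← Real.rpow_natCast, ← Real.rpow_mul (abs_nonneg _)]
      norm_num
    have h3 : |(N : ℝ) * (T - 4 * (N : ℝ))| ^ ((1:ℝ) / 4) ≤ 2 * z := by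
      refine (pow_le_pow_iff_left₀ (by linarith) (by positivity) (by norm_num : 4 ≠ 0)).mp ?_
      rw [h2, mul_pow]
      have := pow_pos hz0 4
      linarith
    linarith
  rw [hW, norm_mul]
  calc _ ≤ a ^ 2 / h ^ 3 * (144 * 10 ^ 23 * (M * C * K) / (m ^ 4 * z)) := by gcongr
    _ = 144 * 10 ^ 23 * (M * C * K) * (h ^ ((1:ℝ) / 3) / h ^ 2) / z := hk
    _ = 576 * 10 ^ 23 * (M * C * K) * (h ^ ((1:ℝ) / 3) / h ^ 2) / (4 * z) := by
        field_simp
        ring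
    _ ≤ 576 * 10 ^ 23 * (M * C * K) * (h ^ ((1:ℝ) / 3) / h ^ 2) /
        (1 + |(N : ℝ) * (T - 4 * (N : ℝ))| ^ ((1:ℝ) / 4)) := by
        gcongr
    _ ≤ _ := by
        gcongr
        norm_num

/-- dispersive bound for `W_{N,a}`, `1 ≤ |N| ≤ λ^{1/3}`, away from the
swallowtail time: `1/|N| ≤ |T − 4N|`, `|T| ≤ 2a^{−1/2}`. -/
theorem dispersion_tangential_smallN_far
    (Ai : ℂ → ℂ)
    (hAi_diff : Differentiable ℂ Ai)
    (hAi_diff' : Differentiable ℂ (deriv Ai))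
    (hAi_ode : ∀ z : ℂ, deriv (deriv Ai) z = z * Ai z)
    (hAi_zero : Ai 0 = (3 : ℂ) ^ (-(2 : ℂ)/3) / Complex.Gamma (2/3))
    (hAi_zero' : deriv Ai 0 = -((3 : ℂ) ^ (-(1 : ℂ)/3)) / Complex.Gamma (1/3))
    (hAi_real : ∀ x : ℝ, (Ai x).im = 0)
    (L : ℝ → ℝ)
    (hL_cont : Continuous L)
    (hL_zero : L 0 = Real.pi / 3)
    (hAp_ne : ∀ w : ℝ, Aplus Ai w ≠ 0)
    (hL_char : ∀ w : ℝ, Complex.exp (-(L w : ℂ) * Complex.I) = -(Aminus Ai w) / (Aplus Ai w))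
    (ψ : ℝ → ℝ) (hψ : ContDiff ℝ (⊤ : ℕ∞) ψ) (hψs : tsupport ψ ⊆ Set.Icc (1/2 : ℝ) (3/2))
    (χ₂ : ℝ × ℝ → ℝ) (hχ₂ : ContDiff ℝ (⊤ : ℕ∞) χ₂) (hχ₂c : HasCompactSupport χ₂)
    (hχ₂s : tsupport χ₂ ⊆ {p : ℝ × ℝ | |p.1| < 3 ∧ |p.2| < 3})
    (ψ₃ : ℝ → ℝ) (hψ₃ : ContDiff ℝ (⊤ : ℕ∞) ψ₃) (hψ₃s : tsupport ψ₃ ⊆ Set.Icc (9/10 : ℝ) 6)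
    : ∃ a₀ ∈ Set.Ioo (0:ℝ) 1, ∃ lam₀ : ℝ, 8 ≤ lam₀ ∧ ∃ C : ℝ,
      ∀ h a : ℝ, 0 < h → h ≤ 1 → 0 < a → a ≤ a₀ → lam₀ ≤ a ^ ((3:ℝ)/2) / h →
      ∀ N : ℤ, 1 ≤ |(N : ℝ)| → |(N : ℝ)| ≤ (a ^ ((3:ℝ)/2) / h) ^ ((1:ℝ)/3) →
      ∀ X : ℝ, 0 ≤ X → ∀ Y T : ℝ,
        1 / |(N : ℝ)| ≤ |T - 4 * (N : ℝ)| → |T| ≤ 2 / Real.sqrt a →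
        ‖Wtan L ψ χ₂ ψ₃ h a N T X Y‖
          ≤ C * (h ^ ((1:ℝ)/3) / h ^ 2) /
            (1 + |(N : ℝ) * (T - 4 * (N : ℝ))| ^ ((1:ℝ)/4)) := by
  obtain ⟨b, hb⟩ := exists_hasDerivAt_Bfun hAi_diff hAi_diff' hAi_ode hAi_zero hAi_zero' hL_cont
    hAp_ne hL_char
  have hg : StripBump χ₂ := ⟨hχ₂, hχ₂c, fun x hx => (hχ₂s hx).1⟩
  obtain ⟨C1, hC1⟩ := hg.exists_normalBound
  obtain ⟨C2, hC2⟩ := hg.comp_neg.exists_normalBound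
  obtain ⟨K, hK⟩ := exists_boundedC2_of_contDiff hψ₃
  obtain ⟨M, hM⟩ := isCompact_Icc.exists_bound_of_continuousOn
    (hψ.continuous.continuousOn (s := Set.Icc (1 / 2 : ℝ) (3 / 2)))
  refine ⟨1 / 10 ^ 12, ⟨by norm_num, by norm_num⟩, 1100, by norm_num,
    10 ^ 26 * (M * max C1 C2 * K), fun h a hh _ ha ha' hlam N hN hNl X _ Y T hT _ => ?_⟩
  exact norm_Wtan_le hL_cont hb hψ.continuous hψs hM (hC1.mono (le_max_left _ _))
    (hC2.mono (le_max_right _ _)) hχ₂s hK hψ₃.continuous hψ₃s hh ha ha' hlam hN hNl hT
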